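/- Let n ≥ 1 and let f : ℝⁿ → ℝ be real analytic on a neighborhood U of 0 with f(0) = 0 and ∇f(0) = 0. Assume there exist an integer 0 ≤ k ≤ n−1 and r₀ > 0 such that for every 0 < r < r₀ there is c_r > 0 with m({x : |x| < r, |f(x)| < ε}) = c_r ε^{1/(n+1)} (log(1/ε))^k + o(ε^{1/(n+1)} (log(1/ε))^k) as ε → 0⁺ (that is, the sublevel index is g = 1/(n+1)). Then there is a neighborhood N ⊆ U of 0 such that for every smooth compactly supported φ : ℝⁿ → ℝ with support in N there is a constant C > 0 such that for all ξ = (ξ₁,…,ξ_{n+1}) ∈ ℝ^{n+1} with |ξ| > 2 one has |∫_{ℝⁿ} φ(x) e^{−i(ξ_{n+1} f(x) + ξ₁x₁ + ⋯ + ξₙxₙ)} dx| ≤ C |ξ|^{−1/(n+1)} (log|ξ|)^{k+1}. -/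

import Mathlib

namespace OscDecay

open Filter Topology

section Division

variable {E : Type*} [NormedAddCommGroup E] [NormedSpace ℝ E]

/-- The formal series of the divided difference of `p` in the direction `e`,
relative to the projection `P`. -/
noncomputable def divSeries (p : FormalMultilinearSeries ℝ E ℝ) (P : E →L[ℝ] E) (e : E) :
    FormalMultilinearSeries ℝ E ℝ := fun k =>
  ∑ j : Fin (k + 1), ((p (k + 1)).curryMid j e).compContinuousLinearMap
    (fun l : Fin k => if l.castSucc < j then P else ContinuousLinearMap.id ℝ E)

theorem norm_divSeries_le (p : FormalMultilinearSeries ℝ E ℝ) {P : E →L[ℝ] E} (hP : ‖P‖ ≤ 1)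
    (e : E) (k : ℕ) : ‖divSeries p P e k‖ ≤ (k + 1) * (‖p (k + 1)‖ * ‖e‖) := by
  have h : ∀ j : Fin (k + 1), ‖((p (k + 1)).curryMid j e).compContinuousLinearMap
      (fun l : Fin k => if l.castSucc < j then P else ContinuousLinearMap.id ℝ E)‖
      ≤ ‖p (k + 1)‖ * ‖e‖ := by
    intro j
    refine (ContinuousMultilinearMap.norm_compContinuousLinearMap_le _ _).trans ?_
    have h1 : ∏ l : Fin k, ‖(if l.castSucc < j then P else ContinuousLinearMap.id ℝ E)‖ ≤ 1 := by
      refine Finset.prod_le_one (fun _ _ => norm_nonneg _) fun l _ => ?_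
      split_ifs
      · exact hP
      · exact ContinuousLinearMap.norm_id_le
    have h2 : ‖(p (k + 1)).curryMid j e‖ ≤ ‖p (k + 1)‖ * ‖e‖ := by
      have := ((p (k + 1)).curryMid j).le_opNorm e
      rwa [ContinuousMultilinearMap.norm_curryMid] at this
    calc _ ≤ ‖(p (k + 1)).curryMid j e‖ * 1 := by gcongr
      _ ≤ _ := by simpa using h2
  refine (norm_sum_le _ _).trans ((Finset.sum_le_sum fun j _ => h j).trans ?_)
  simp

theorem divSeries_telescope (p : FormalMultilinearSeries ℝ E ℝ) {P : E →L[ℝ] E} {e : E}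
    {c : ℝ} {w : E} (hw : w = P w + c • e) (k : ℕ) :
    c * divSeries p P e k (fun _ => w) =
      p (k + 1) (fun _ => w) - p (k + 1) (fun _ => P w) := by
  classical
  set F : ℕ → ℝ := fun j => p (k + 1) (fun l : Fin (k + 1) => if l.val < j then P w else w) with hF
  have h0 : F 0 = p (k + 1) (fun _ => w) := by simp [hF]
  have h1 : F (k + 1) = p (k + 1) (fun _ => P w) := by
    simp only [hF]; congr 1; ext l; simp [l.2]
  rw [← h0, ← h1, ← neg_sub, ← Finset.sum_range_sub, ← Fin.sum_univ_eq_sum_range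
    (fun j => F (j + 1) - F j)]
  simp only [divSeries, _root_.sum_apply, Finset.mul_sum, ← Finset.sum_neg_distrib]
  refine Finset.sum_congr rfl fun j _ => ?_
  rw [neg_sub]
  set b : Fin k → E := fun l => if l.castSucc < j then P w else w with hb
  have key : ∀ x, (p (k + 1)) (j.insertNth x b) = ((p (k + 1)).curryMid j x) b := fun x =>
    ((p (k + 1)).curryMid_apply j x b).symm
  have e1 : (fun l : Fin (k + 1) => if l.val < j.val then P w else w) = j.insertNth w b := by
    rw [Fin.eq_insertNth_iff]
    refine ⟨by simp, ?_⟩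
    ext l
    simp only [hb, Fin.removeNth]
    rcases lt_or_ge l.castSucc j with h | h
    · rw [Fin.succAbove_of_castSucc_lt _ _ h]; simp [h]
      intro h'; exact absurd h (not_lt.mpr h')
    · rw [Fin.succAbove_of_le_castSucc _ _ h]
      have h' : j.val ≤ l.val := h
      have : ¬ (l.val + 1 < j.val) := by omega
      simp [this, not_lt.mpr h]
  have e2 : (fun l : Fin (k + 1) => if l.val < j.val + 1 then P w else w) = j.insertNth (P w) b := by
    rw [Fin.eq_insertNth_iff]
    refine ⟨by simp, ?_⟩
    ext l
    simp only [hb, Fin.removeNth]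
    rcases lt_or_ge l.castSucc j with h | h
    · rw [Fin.succAbove_of_castSucc_lt _ _ h]
      have h' : l.val < j.val := h
      have : l.val < j.val + 1 := by omega
      simp [h, this]
    · rw [Fin.succAbove_of_le_castSucc _ _ h]
      have h' : j.val ≤ l.val := h
      have : ¬ (l.val + 1 < j.val + 1) := by omega
      simp [not_lt.mpr h]
      intro h3; omega
  have e3 : F j.val - F (j.val + 1) = ((p (k + 1)).curryMid j (c • e)) b := by
    have : c • e = w - P w := by rw [eq_sub_iff_add_eq, add_comm]; exact hw.symm
    rw [this, map_sub]
    simp only [hF, e1, e2, key]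
    rfl
  rw [e3, map_smul]
  simp only [ContinuousMultilinearMap.compContinuousLinearMap_apply,
    _root_.smul_apply, smul_eq_mul]
  congr 2
  ext l
  simp only [hb]
  split_ifs <;> simp

theorem divSeries_radius_pos (p : FormalMultilinearSeries ℝ E ℝ) {P : E →L[ℝ] E} (hP : ‖P‖ ≤ 1)
    (e : E) (hp : 0 < p.radius) : 0 < (divSeries p P e).radius := by
  obtain ⟨r, hr0, hr⟩ := ENNReal.lt_iff_exists_nnreal_btwn.mp hp
  have hr0' : 0 < r := by exact_mod_cast hr0
  obtain ⟨C, hC, hCp⟩ := p.norm_mul_pow_le_of_lt_radius hr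
  have : ((r / 2 : NNReal) : ENNReal) ≤ (divSeries p P e).radius := by
    refine FormalMultilinearSeries.le_radius_of_bound _ (C / r * ‖e‖) fun k => ?_
    have h1 := norm_divSeries_le p hP e k
    have h2 := hCp (k + 1)
    have hr0'' : (0 : ℝ) < r := hr0'
    have h3 : ((k : ℝ) + 1) ≤ 2 ^ k := by exact_mod_cast (Nat.lt_two_pow_self (n := k))
    have h4 : ‖p (k + 1)‖ * (r : ℝ) ^ k ≤ C / r := by
      rw [le_div_iff₀ hr0'', mul_assoc, ← pow_succ]; exact h2
    calc ‖divSeries p P e k‖ * ((r / 2 : NNReal) : ℝ) ^ k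
        ≤ (2 ^ k * (‖p (k + 1)‖ * ‖e‖)) * ((r : ℝ) / 2) ^ k := by
          push_cast
          gcongr
          exact h1.trans (by gcongr)
      _ = (‖p (k + 1)‖ * (r : ℝ) ^ k) * ‖e‖ := by
          rw [div_pow]; field_simp
      _ ≤ C / r * ‖e‖ := by gcongr
  refine lt_of_lt_of_le ?_ this
  simp [hr0'.ne']

/-- Analytic division: the difference between `u` and its restriction to the range of a
projection `P` along `e` is analytically divisible by the complementary coordinate. -/
theorem exists_analytic_div {u : E → ℝ} (hu : AnalyticAt ℝ u 0) {P : E →L[ℝ] E} (hP : ‖P‖ ≤ 1)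
    {e : E} {l : E → ℝ} (hl : ∀ w, w = P w + l w • e) :
    ∃ v : E → ℝ, AnalyticAt ℝ v 0 ∧ ∀ᶠ w in 𝓝 0, u w = u (P w) + l w * v w := by
  obtain ⟨p, r, hp⟩ := hu
  have hq := divSeries_radius_pos p hP e (lt_of_lt_of_le hp.r_pos hp.r_le)
  have hs := (divSeries p P e).hasFPowerSeriesOnBall hq
  refine ⟨(divSeries p P e).sum, hs.analyticAt, ?_⟩
  have hPc : Tendsto (fun w => P w) (𝓝 0) (𝓝 0) := by
    simpa using P.continuous.tendsto 0
  filter_upwards [hp.hasFPowerSeriesAt.eventually_hasSum, hs.hasFPowerSeriesAt.eventually_hasSum,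
    hPc.eventually hp.hasFPowerSeriesAt.eventually_hasSum] with w h1 h2 h3
  simp only [zero_add] at h1 h2 h3
  have h4 := (h2.mul_left (l w))
  simp only [divSeries_telescope p (hl w)] at h4
  have h5 := h1.sub h3
  have h6 := (hasSum_nat_add_iff' 1).mpr h5
  simp only [Finset.range_one, Finset.sum_singleton] at h6
  have h7 := h4.unique h6
  have h0 : (p 0 fun _ : Fin 0 => w) = p 0 (fun _ : Fin 0 => P w) := by
    congr 1; ext i; exact i.elim0
  rw [h0] at h7
  linarith

end Division

end OscDecay

namespace OscDecay

open Filter Topology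

/-- The germ of `u` at the origin is not zero. -/
def NZ {n : ℕ} (u : (Fin n → ℝ) → ℝ) : Prop := ¬ ∀ᶠ w in 𝓝 0, u w = 0

/-- The monomial with exponent `α`. -/
def mon {n : ℕ} (α : Fin n → ℕ) (w : Fin n → ℝ) : ℝ := ∏ i, w i ^ α i

/-- The germ of `u` at the origin is a monomial times an analytic unit. -/
def Mono {n : ℕ} (u : (Fin n → ℝ) → ℝ) : Prop :=
  ∃ (α : Fin n → ℕ) (U : (Fin n → ℝ) → ℝ), AnalyticAt ℝ U 0 ∧ U 0 ≠ 0 ∧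
    ∀ᶠ w in 𝓝 0, u w = mon α w * U w

section Basic

variable {n m : ℕ}

@[simp] theorem mon_zero (w : Fin n → ℝ) : mon 0 w = 1 := by simp [mon]

theorem mon_add (α β : Fin n → ℕ) (w : Fin n → ℝ) : mon (α + β) w = mon α w * mon β w := by
  simp [mon, pow_add, Finset.prod_mul_distrib]

theorem mon_smul (k : ℕ) (α : Fin n → ℕ) (w : Fin n → ℝ) : mon (k • α) w = mon α w ^ k := by
  simp [mon, ← Finset.prod_pow, ← pow_mul, mul_comm]

@[simp] theorem mon_single (i : Fin n) (w : Fin n → ℝ) : mon (Pi.single i 1) w = w i := by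
  classical
  rw [mon, Finset.prod_eq_single i]
  · simp
  · intro j _ hj; simp [hj]
  · simp

theorem mon_zero_eq_zero {α : Fin n → ℕ} (h : α ≠ 0) : mon α 0 = 0 := by
  obtain ⟨i, hi⟩ := Function.ne_iff.mp h
  exact Finset.prod_eq_zero (Finset.mem_univ i) (by simpa using hi)

theorem analyticAt_coord (i : Fin n) (x : Fin n → ℝ) : AnalyticAt ℝ (fun w : Fin n → ℝ => w i) x :=
  (ContinuousLinearMap.proj (R := ℝ) (φ := fun _ : Fin n => ℝ) i).analyticAt x

theorem analyticAt_mon (α : Fin n → ℕ) (x : Fin n → ℝ) : AnalyticAt ℝ (mon α) x := by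
  have : mon α = ∏ i, fun w : Fin n → ℝ => w i ^ α i := by
    ext w; simp [mon]
  rw [this]
  exact Finset.analyticAt_prod _ fun i _ => (analyticAt_coord i x).pow _

theorem continuous_mon (α : Fin n → ℕ) : Continuous (mon α) := by
  unfold mon; fun_prop

theorem exists_eq_add_single {α : Fin n → ℕ} (h : α ≠ 0) :
    ∃ (i : Fin n) (β : Fin n → ℕ), α = β + Pi.single i 1 ∧ ∑ j, β j < ∑ j, α j := by
  classical
  obtain ⟨i, hi⟩ := Function.ne_iff.mp h
  refine ⟨i, Function.update α i (α i - 1), ?_, ?_⟩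
  · ext j
    rcases eq_or_ne j i with rfl | hj
    · simp at hi ⊢; omega
    · simp [hj]
  · refine Finset.sum_lt_sum (fun j _ => ?_) ⟨i, Finset.mem_univ i, ?_⟩
    · rcases eq_or_ne j i with rfl | hj
      · simp
      · simp [hj]
    · simp at hi ⊢; omega

/-- Setting one coordinate to zero. -/
noncomputable def killCoord (i : Fin n) : (Fin n → ℝ) →L[ℝ] (Fin n → ℝ) :=
  ContinuousLinearMap.pi fun j => if j = i then 0 else ContinuousLinearMap.proj j

theorem killCoord_apply (i : Fin n) (w : Fin n → ℝ) : killCoord i w = Function.update w i 0 := by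
  ext j
  rcases eq_or_ne j i with rfl | hj
  · simp [killCoord]
  · simp [killCoord, hj]

theorem tendsto_update_zero (i : Fin n) :
    Tendsto (fun w : Fin n → ℝ => Function.update w i 0) (𝓝 0) (𝓝 0) := by
  have := (killCoord i).continuous.tendsto 0
  rw [map_zero] at this
  exact this.congr (killCoord_apply i)

theorem norm_killCoord_le (i : Fin n) : ‖killCoord i‖ ≤ 1 := by
  refine ContinuousLinearMap.opNorm_le_bound _ zero_le_one fun w => ?_
  rw [one_mul, killCoord_apply, pi_norm_le_iff_of_nonneg (norm_nonneg _)]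
  intro j
  rcases eq_or_ne j i with rfl | hj
  · simp
  · simpa [hj] using norm_le_pi_norm w j

theorem exists_div_coord {u : (Fin n → ℝ) → ℝ} (hu : AnalyticAt ℝ u 0) (i : Fin n) :
    ∃ v : (Fin n → ℝ) → ℝ, AnalyticAt ℝ v 0 ∧
      ∀ᶠ w in 𝓝 0, u w = u (Function.update w i 0) + w i * v w := by
  classical
  obtain ⟨v, hv, h⟩ := exists_analytic_div hu (norm_killCoord_le i) (e := Pi.single i 1)
    (l := fun w => w i) (fun w => by
      ext j
      rcases eq_or_ne j i with rfl | hj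
      · simp [killCoord_apply]
      · simp [killCoord_apply, hj])
  exact ⟨v, hv, by simpa only [killCoord_apply] using h⟩

theorem _root_.AnalyticAt.exists_ball {E : Type*} [NormedAddCommGroup E] [NormedSpace ℝ E]
    {u : E → ℝ} {x : E} (hu : AnalyticAt ℝ u x) :
    ∃ r > 0, AnalyticOnNhd ℝ u (Metric.ball x r) := by
  obtain ⟨r, hr, h⟩ := Metric.eventually_nhds_iff_ball.mp hu.eventually_analyticAt
  exact ⟨r, hr, fun y hy => h y hy⟩

theorem NZ.mul {a b : (Fin n → ℝ) → ℝ} (ha : AnalyticAt ℝ a 0) (hb : AnalyticAt ℝ b 0)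
    (na : NZ a) (nb : NZ b) : NZ (fun w => a w * b w) := by
  intro h
  obtain ⟨r, hr, har⟩ := ha.exists_ball
  obtain ⟨s, hs, hbs⟩ := hb.exists_ball
  obtain ⟨t, ht, hab⟩ := Metric.eventually_nhds_iff_ball.mp h
  set ρ := min r (min s t) with hρ
  have hρ0 : 0 < ρ := lt_min hr (lt_min hs ht)
  have hex : ∃ x ∈ Metric.ball (0 : Fin n → ℝ) ρ, a x ≠ 0 := by
    by_contra hcon
    push Not at hcon
    exact na (Filter.eventually_of_mem (Metric.ball_mem_nhds _ hρ0) hcon)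
  obtain ⟨x, hx, hax⟩ := hex
  have hsub1 : Metric.ball (0 : Fin n → ℝ) ρ ⊆ Metric.ball 0 r :=
    Metric.ball_subset_ball (min_le_left _ _)
  have hsub2 : Metric.ball (0 : Fin n → ℝ) ρ ⊆ Metric.ball 0 s :=
    Metric.ball_subset_ball ((min_le_right _ _).trans (min_le_left _ _))
  have hsub3 : Metric.ball (0 : Fin n → ℝ) ρ ⊆ Metric.ball 0 t :=
    Metric.ball_subset_ball ((min_le_right _ _).trans (min_le_right _ _))
  have hbx : b =ᶠ[𝓝 x] 0 := by
    filter_upwards [(har x (hsub1 hx)).continuousAt.eventually_ne hax,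
      Metric.isOpen_ball.mem_nhds hx] with y h1 h2
    have := hab y (hsub3 h2)
    exact (mul_eq_zero.mp this).resolve_left h1
  have := (hbs.mono hsub2).eqOn_zero_of_preconnected_of_eventuallyEq_zero
    (convex_ball _ _).isPreconnected hx hbx
  exact nb (Filter.eventually_of_mem (Metric.ball_mem_nhds _ hρ0) this)

theorem NZ.of_ne {a : (Fin n → ℝ) → ℝ} (ha : a 0 ≠ 0) : NZ a :=
  fun h => ha h.self_of_nhds

theorem NZ.cancel {a p q : (Fin n → ℝ) → ℝ} (na : NZ a) (ha : AnalyticAt ℝ a 0)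
    (hp : AnalyticAt ℝ p 0) (hq : AnalyticAt ℝ q 0) (h : ∀ᶠ w in 𝓝 0, a w * p w = a w * q w) :
    ∀ᶠ w in 𝓝 0, p w = q w := by
  by_contra hcon
  have : NZ (fun w => p w - q w) := fun h' => hcon (by
    filter_upwards [h'] with w hw; linarith)
  exact NZ.mul ha (hp.sub hq) na this (by
    filter_upwards [h] with w hw; simp only [Pi.sub_apply]; linarith)

theorem NZ.coord (i : Fin n) : NZ (fun w : Fin n → ℝ => w i) := by
  intro h
  obtain ⟨r, hr, h⟩ := Metric.eventually_nhds_iff_ball.mp h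
  have := h (fun _ => r / 2) (by
    rw [mem_ball_zero_iff]
    refine (pi_norm_const_le _).trans_lt ?_
    rw [Real.norm_eq_abs, abs_of_pos (by linarith)]; linarith)
  simp at this; linarith

theorem NZ.prod {ι : Type*} (s : Finset ι) {a : ι → (Fin n → ℝ) → ℝ}
    (ha : ∀ i ∈ s, AnalyticAt ℝ (a i) 0) (na : ∀ i ∈ s, NZ (a i)) :
    NZ (fun w => ∏ i ∈ s, a i w) := by
  classical
  induction s using Finset.induction_on with
  | empty => exact NZ.of_ne (by simp)
  | insert i s hi ih =>
    simp only [Finset.prod_insert hi]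
    refine NZ.mul (ha i (by simp)) ?_ (na i (by simp))
      (ih (fun j hj => ha j (by simp [hj])) fun j hj => na j (by simp [hj]))
    exact Finset.analyticAt_fun_prod s fun j hj => ha j (by simp [hj])

theorem NZ.pow {a : (Fin n → ℝ) → ℝ} (na : NZ a) (k : ℕ) : NZ (fun w => a w ^ k) := by
  intro h
  exact na (h.mono fun w hw => pow_eq_zero_iff_of_pos_aux hw)
where
  pow_eq_zero_iff_of_pos_aux {x : ℝ} {k : ℕ} (h : x ^ k = 0) : x = 0 := eq_zero_of_pow_eq_zero h

theorem NZ.of_mon (α : Fin n → ℕ) : NZ (mon α) :=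
  NZ.prod Finset.univ (fun i _ => (analyticAt_coord i 0).pow _) fun i _ => (NZ.coord i).pow _

theorem Mono.congr {u v : (Fin n → ℝ) → ℝ} (hu : Mono u) (h : ∀ᶠ w in 𝓝 0, v w = u w) :
    Mono v := by
  obtain ⟨α, U, h1, h2, h3⟩ := hu
  exact ⟨α, U, h1, h2, by filter_upwards [h, h3] with w a b; rw [a, b]⟩

theorem Mono.analyticAt {u : (Fin n → ℝ) → ℝ} (hu : Mono u) : AnalyticAt ℝ u 0 := by
  obtain ⟨α, U, h1, h2, h3⟩ := hu
  exact ((analyticAt_mon α 0).mul h1).congr (h3.mono fun w hw => hw.symm)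

theorem Mono.mul {u v : (Fin n → ℝ) → ℝ} (hu : Mono u) (hv : Mono v) :
    Mono (fun w => u w * v w) := by
  obtain ⟨α, U, h1, h2, h3⟩ := hu
  obtain ⟨β, V, k1, k2, k3⟩ := hv
  refine ⟨α + β, fun w => U w * V w, h1.mul k1, mul_ne_zero h2 k2, ?_⟩
  filter_upwards [h3, k3] with w a b
  rw [a, b, mon_add]; ring

theorem Mono.unit {u : (Fin n → ℝ) → ℝ} (hu : AnalyticAt ℝ u 0) (h0 : u 0 ≠ 0) : Mono u :=
  ⟨0, u, hu, h0, by simp⟩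

theorem Mono.const {c : ℝ} (hc : c ≠ 0) : Mono (fun _ : Fin n → ℝ => c) :=
  Mono.unit analyticAt_const hc

theorem Mono.of_mon (α : Fin n → ℕ) : Mono (mon α) :=
  ⟨α, fun _ => 1, analyticAt_const, one_ne_zero, by simp⟩

theorem Mono.coord (i : Fin n) : Mono (fun w : Fin n → ℝ => w i) := by
  simpa only [← mon_single] using Mono.of_mon (Pi.single i 1)

theorem Mono.pow {u : (Fin n → ℝ) → ℝ} (hu : Mono u) (k : ℕ) : Mono (fun w => u w ^ k) := by
  induction k with
  | zero => simpa using Mono.const (n := n) one_ne_zero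
  | succ k ih => simpa only [pow_succ] using ih.mul hu

theorem Mono.prod {ι : Type*} (s : Finset ι) {u : ι → (Fin n → ℝ) → ℝ}
    (hu : ∀ i ∈ s, Mono (u i)) : Mono (fun w => ∏ i ∈ s, u i w) := by
  classical
  induction s using Finset.induction_on with
  | empty => simpa using Mono.const (n := n) one_ne_zero
  | insert i s hi ih =>
    simp only [Finset.prod_insert hi]
    exact (hu i (by simp)).mul (ih fun j hj => hu j (by simp [hj]))

theorem analyticAt_of_coord {σ : (Fin m → ℝ) → (Fin n → ℝ)} {x : Fin m → ℝ}
    (h : ∀ i, AnalyticAt ℝ (fun w => σ w i) x) : AnalyticAt ℝ σ x :=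
  AnalyticAt.pi h

theorem Mono.comp {u : (Fin n → ℝ) → ℝ} (hu : Mono u) {σ : (Fin m → ℝ) → (Fin n → ℝ)}
    (hσ : ∀ i, Mono (fun w => σ w i)) (h0 : σ 0 = 0) : Mono (fun w => u (σ w)) := by
  obtain ⟨α, U, h1, h2, h3⟩ := hu
  have ha : AnalyticAt ℝ σ 0 := analyticAt_of_coord fun i => (hσ i).analyticAt
  have h1' : AnalyticAt ℝ (fun w => U (σ w)) 0 := AnalyticAt.fun_comp (by rwa [h0]) ha
  have hm : Mono (fun w => mon α (σ w)) := Mono.prod Finset.univ fun i _ => (hσ i).pow _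
  refine (hm.mul (Mono.unit h1' (by simpa [h0] using h2))).congr ?_
  have := ha.continuousAt.tendsto
  rw [h0] at this
  exact this.eventually h3

theorem exists_div_mon {α : Fin n → ℕ} {u : (Fin n → ℝ) → ℝ} (hu : AnalyticAt ℝ u 0) {C : ℝ}
    (h : ∀ᶠ w in 𝓝 0, |u w| ≤ C * |mon α w|) :
    ∃ v : (Fin n → ℝ) → ℝ, AnalyticAt ℝ v 0 ∧ ∀ᶠ w in 𝓝 0, u w = mon α w * v w := by
  classical
  induction hk : ∑ j, α j using Nat.strong_induction_on generalizing α u with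
  | _ k ih =>
  rcases eq_or_ne α 0 with rfl | hα
  · exact ⟨u, hu, by simp⟩
  obtain ⟨i, β, rfl, hlt⟩ := exists_eq_add_single hα
  obtain ⟨v, hv, huv⟩ := exists_div_coord hu i
  have hz : ∀ᶠ w in 𝓝 (0 : Fin n → ℝ), u (Function.update w i 0) = 0 := by
    have ht := tendsto_update_zero i
    filter_upwards [ht.eventually h] with w hw
    simpa [mon_add] using hw
  have huv' : ∀ᶠ w in 𝓝 0, u w = w i * v w := by
    filter_upwards [huv, hz] with w a b; rw [a, b, zero_add]
  have hb : ∀ᶠ w in 𝓝 0, |v w| ≤ C * |mon β w| := by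
    have hh : ∀ᶠ w in 𝓝 (0 : Fin n → ℝ), w i ≠ 0 → |v w| ≤ C * |mon β w| := by
      filter_upwards [huv', h] with w a b hwi
      rw [a, mon_add, mon_single, abs_mul, abs_mul] at b
      have : 0 < |w i| := abs_pos.mpr hwi
      nlinarith
    filter_upwards [hh.eventually_nhds, hv.eventually_analyticAt] with w h1 h2
    have hne : (𝓝[{w' : Fin n → ℝ | w' i ≠ 0}] w).NeBot := by
      rw [← mem_closure_iff_nhdsWithin_neBot]
      have hd : Dense {w' : Fin n → ℝ | w' i ≠ 0} := by
        have : {w' : Fin n → ℝ | w' i ≠ 0} = (fun w' => w' i) ⁻¹' {0}ᶜ := rfl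
        rw [this]
        exact (dense_compl_singleton (0 : ℝ)).preimage (isOpenMap_eval i)
      exact hd w
    refine le_of_tendsto_of_tendsto (h2.continuousAt.abs.tendsto.mono_left nhdsWithin_le_nhds)
      (((continuous_mon β).abs.const_mul C).continuousAt.tendsto.mono_left
        (nhdsWithin_le_nhds (s := {w' : Fin n → ℝ | w' i ≠ 0}))) ?_
    filter_upwards [nhdsWithin_le_nhds h1, self_mem_nhdsWithin] with w' a b
    exact a b
  obtain ⟨v', hv', hvv⟩ := ih _ (hk ▸ hlt) hv hb rfl
  refine ⟨v', hv', ?_⟩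
  filter_upwards [huv', hvv] with w a b
  rw [a, b, mon_add, mon_single]; ring

theorem Mono.of_mul_left {a b : (Fin n → ℝ) → ℝ} (ha : AnalyticAt ℝ a 0) (hb : AnalyticAt ℝ b 0)
    (h : Mono (fun w => a w * b w)) : Mono a := by
  classical
  obtain ⟨α, U, hU, hU0, he⟩ := h
  induction hk : ∑ j, α j using Nat.strong_induction_on generalizing α a b with
  | _ k ih =>
  rcases eq_or_ne α 0 with rfl | hα
  · refine Mono.unit ha fun h0 => hU0 ?_
    have := he.self_of_nhds
    simpa [h0] using this.symm
  obtain ⟨i, β, rfl, hlt⟩ := exists_eq_add_single hα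
  have ht := tendsto_update_zero i
  have hkill : ∀ {c : (Fin n → ℝ) → ℝ}, AnalyticAt ℝ c 0 →
      AnalyticAt ℝ (fun w => c (Function.update w i 0)) 0 := by
    intro c hc
    simp only [← killCoord_apply]
    exact AnalyticAt.fun_comp (by simpa using hc) ((killCoord i).analyticAt 0)
  have hz : ∀ᶠ w in 𝓝 (0 : Fin n → ℝ),
      a (Function.update w i 0) * b (Function.update w i 0) = 0 := by
    filter_upwards [ht.eventually he] with w hw
    simpa [mon_add] using hw
  have hcancel : ∀ {p : (Fin n → ℝ) → ℝ}, AnalyticAt ℝ p 0 →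
      (∀ᶠ w in 𝓝 0, w i * p w = mon (β + Pi.single i 1) w * U w) →
      ∀ᶠ w in 𝓝 0, p w = mon β w * U w := by
    intro p hp h
    refine (NZ.coord i).cancel (analyticAt_coord i 0) hp ((analyticAt_mon β 0).mul hU) ?_
    filter_upwards [h] with w hw
    rw [hw, mon_add, mon_single]; ring
  by_cases hza : ∀ᶠ w in 𝓝 (0 : Fin n → ℝ), a (Function.update w i 0) = 0
  · obtain ⟨a', ha', haa⟩ := exists_div_coord ha i
    have haa' : ∀ᶠ w in 𝓝 0, a w = w i * a' w := by
      filter_upwards [haa, hza] with w h1 h2; rw [h1, h2, zero_add]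
    have := ih _ (hk ▸ hlt) ha' hb β (hcancel (ha'.mul hb) (by
      filter_upwards [he, haa'] with w h1 h2
      rw [← h1, h2]; ring)) rfl
    exact ((Mono.coord i).mul this).congr haa'
  · have hzb : ∀ᶠ w in 𝓝 (0 : Fin n → ℝ), b (Function.update w i 0) = 0 := by
      by_contra hcon
      exact NZ.mul (hkill ha) (hkill hb) hza hcon hz
    obtain ⟨b', hb', hbb⟩ := exists_div_coord hb i
    have hbb' : ∀ᶠ w in 𝓝 0, b w = w i * b' w := by
      filter_upwards [hbb, hzb] with w h1 h2; rw [h1, h2, zero_add]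
    exact ih _ (hk ▸ hlt) ha hb' β (hcancel (ha.mul hb') (by
      filter_upwards [he, hbb'] with w h1 h2
      rw [← h1, h2]; ring)) rfl

end Basic

end OscDecay

namespace OscDecay

open Filter Topology MeasureTheory

/-- Translation of the `i`-th coordinate by `θ`. -/
def shear {n : ℕ} (i : Fin n) (θ : (Fin n → ℝ) → ℝ) (w : Fin n → ℝ) : Fin n → ℝ :=
  Function.update w i (w i + θ w)

/-- The chart of the blow-up of `w i = w j = 0` centred at slope `y`. -/
def blow {n : ℕ} (i j : Fin n) (y : ℝ) (w : Fin n → ℝ) : Fin n → ℝ :=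
  Function.update w j (w i * (y + w j))

/-- The ramified covering `w i ↦ s * w i ^ q`. -/
def powc {n : ℕ} (i : Fin n) (q : ℕ) (s : ℝ) (w : Fin n → ℝ) : Fin n → ℝ :=
  Function.update w i (s * w i ^ q)

/-- Admissible shear functions. -/
structure ShearFn {n : ℕ} (i : Fin n) (θ : (Fin n → ℝ) → ℝ) : Prop where
  indep : ∀ w t, θ (Function.update w i t) = θ w
  contDiff : ContDiff ℝ 1 θ
  analyticAt : AnalyticAt ℝ θ 0
  zero : θ 0 = 0

section Measures

variable {n : ℕ}

theorem lintegral_eq_of_update (i : Fin n) {f g : (Fin n → ℝ) → ENNReal} (hf : Measurable f)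
    (hg : Measurable g)
    (h : ∀ w, ∫⁻ t, f (Function.update w i t) = ∫⁻ t, g (Function.update w i t)) :
    ∫⁻ w, f w = ∫⁻ w, g w := by
  classical
  refine lintegral_eq_of_lmarginal_eq (μ := fun _ : Fin n => (volume : Measure ℝ)) {i} hf hg ?_
  ext w
  rw [lmarginal_singleton, lmarginal_singleton]
  exact h w

theorem contDiff_update {k : WithTop ℕ∞} (i : Fin n) {g : (Fin n → ℝ) → ℝ} (hg : ContDiff ℝ k g) :
    ContDiff ℝ k (fun w => Function.update w i (g w)) := by
  rw [contDiff_pi]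
  intro j
  rcases eq_or_ne j i with rfl | h
  · simpa using hg
  · simpa [h] using contDiff_apply ℝ ℝ j

theorem analyticAt_update (i : Fin n) {g : (Fin n → ℝ) → ℝ} {x : Fin n → ℝ}
    (hg : AnalyticAt ℝ g x) :
    AnalyticAt ℝ (fun w => Function.update w i (g w)) x := by
  refine AnalyticAt.pi fun j => ?_
  rcases eq_or_ne j i with rfl | h
  · simpa using hg
  · simpa [h] using analyticAt_coord j x

theorem contDiff_shear {i : Fin n} {θ : (Fin n → ℝ) → ℝ} (h : ContDiff ℝ 1 θ) :
    ContDiff ℝ 1 (shear i θ) :=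
  contDiff_update i ((contDiff_apply ℝ ℝ i).add h)

theorem contDiff_blow (i j : Fin n) (y : ℝ) : ContDiff ℝ 1 (blow i j y) :=
  contDiff_update j ((contDiff_apply ℝ ℝ i).mul (contDiff_const.add (contDiff_apply ℝ ℝ j)))

theorem contDiff_powc (i : Fin n) (q : ℕ) (s : ℝ) : ContDiff ℝ 1 (powc i q s) :=
  contDiff_update i (contDiff_const.mul ((contDiff_apply ℝ ℝ i).pow q))

theorem map_shear {i : Fin n} {θ : (Fin n → ℝ) → ℝ} (h : ShearFn i θ) :
    Measure.map (shear i θ) volume = volume := by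
  have hm : Measurable (shear i θ) := (contDiff_shear h.contDiff).continuous.measurable
  refine Measure.ext_of_lintegral _ fun f hf => ?_
  rw [lintegral_map hf hm]
  refine lintegral_eq_of_update i (hf.comp hm) hf fun w => ?_
  simp only [shear, h.indep, Function.update_idem, Function.update_self]
  exact lintegral_add_right_eq_self (fun t => f (Function.update w i t)) (θ w)

theorem volume_coord_eq_zero (i : Fin n) : volume {w : Fin n → ℝ | w i = 0} = 0 := by
  have hm : MeasurableSet {w : Fin n → ℝ | w i = 0} :=
    measurableSet_eq_fun (measurable_pi_apply i) measurable_const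
  rw [← lintegral_indicator_one hm, ← lintegral_zero]
  refine lintegral_eq_of_update i (measurable_one.indicator hm) measurable_const fun w => ?_
  rw [lintegral_zero]
  have : ∀ t : ℝ, ({w : Fin n → ℝ | w i = 0}.indicator (1 : (Fin n → ℝ) → ENNReal))
      (Function.update w i t) = ({0} : Set ℝ).indicator 1 t := by
    intro t
    by_cases h : t = 0 <;> simp [h, Set.indicator]
  simp only [this]
  rw [lintegral_indicator_one (measurableSet_singleton _)]
  simp

theorem ae_coord_ne_zero (i : Fin n) : ∀ᵐ w : Fin n → ℝ, w i ≠ 0 := by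
  rw [ae_iff]; simpa using volume_coord_eq_zero i

theorem lintegral_comp_affine (g : ℝ → ENNReal) (hg : Measurable g) {a : ℝ} (ha : a ≠ 0) (y : ℝ) :
    ∫⁻ t, g (a * (y + t)) * ENNReal.ofReal |a| = ∫⁻ t, g t := by
  rw [lintegral_mul_const _ (by fun_prop),
    lintegral_add_left_eq_self (fun t => g (a * t)) y,
    ← lintegral_map hg (by fun_prop), Real.map_volume_mul_left ha, lintegral_smul_measure,
    smul_eq_mul, mul_right_comm, ← ENNReal.ofReal_mul (abs_nonneg _), ← abs_mul,
    inv_mul_cancel₀ ha]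
  simp

theorem map_blow {i j : Fin n} (hij : i ≠ j) (y : ℝ) :
    Measure.map (blow i j y) (volume.withDensity fun w => ENNReal.ofReal |w i|) = volume := by
  have hm : Measurable (blow i j y) := (contDiff_blow i j y).continuous.measurable
  have hd : Measurable fun w : Fin n → ℝ => ENNReal.ofReal |w i| := by fun_prop
  refine Measure.ext_of_lintegral _ fun f hf => ?_
  have hs : MeasurableSet {w : Fin n → ℝ | w i ≠ 0} :=
    (measurableSet_eq_fun (measurable_pi_apply i) measurable_const).compl
  have h1 : ∫⁻ w, f w = ∫⁻ w, {w : Fin n → ℝ | w i ≠ 0}.indicator f w := by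
    refine lintegral_congr_ae ?_
    filter_upwards [ae_coord_ne_zero i] with w hw
    simp [Set.indicator, hw]
  rw [lintegral_map hf hm, h1, lintegral_withDensity_eq_lintegral_mul _ hd (g := fun w => f (blow i j y w)) (hf.comp hm)]
  refine lintegral_eq_of_update j (hd.mul (hf.comp hm)) (hf.indicator hs) fun w => ?_
  simp only [Pi.mul_apply, blow, Function.update_idem, Function.update_self,
    Function.update_of_ne hij]
  by_cases hw : w i = 0
  · simp [hw, Set.indicator, Function.update_of_ne hij]
  · have h2 : ∀ t, {w : Fin n → ℝ | w i ≠ 0}.indicator f (Function.update w j t) =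
        f (Function.update w j t) := fun t => by
      simp [Set.indicator, Function.update_of_ne hij, hw]
    simp only [h2]
    rw [← lintegral_comp_affine (fun t => f (Function.update w j t))
      (hf.comp (measurable_update w)) hw y]
    simp only [mul_comm]

theorem lintegral_eq_Iio_add_Ioi (F : ℝ → ENNReal) :
    ∫⁻ t, F t = (∫⁻ t in Set.Iio 0, F t) + ∫⁻ t in Set.Ioi 0, F t := by
  rw [← lintegral_add_compl F (measurableSet_Iio (a := (0 : ℝ))), Set.compl_Iio,
    setLIntegral_congr Ioi_ae_eq_Ici]

theorem lintegral_comp_pow {q : ℕ} (hq : Even q) (h2 : 2 ≤ q) (g : ℝ → ENNReal) :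
    ∫⁻ t, g (t ^ q) * ENNReal.ofReal (q * |t| ^ (q - 1)) = 2 * ∫⁻ t in Set.Ioi 0, g t := by
  have hpos : ∫⁻ t in Set.Ioi (0 : ℝ), g (t ^ q) * ENNReal.ofReal (q * |t| ^ (q - 1)) =
      ∫⁻ t in Set.Ioi 0, g t := by
    have himg : (fun t : ℝ => t ^ q) '' Set.Ioi 0 = Set.Ioi 0 := by
      ext x
      constructor
      · rintro ⟨t, ht, rfl⟩; exact pow_pos (Set.mem_Ioi.mp ht) q
      · intro hx
        refine ⟨x ^ (1 / (q : ℝ)), Real.rpow_pos_of_pos hx _, ?_⟩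
        simp only [← Real.rpow_natCast]
        rw [← Real.rpow_mul (le_of_lt hx), one_div, inv_mul_cancel₀ (by positivity), Real.rpow_one]
    conv_rhs => rw [← himg]
    rw [lintegral_image_eq_lintegral_abs_deriv_mul measurableSet_Ioi
      (fun t _ => (hasDerivAt_pow q t).hasDerivWithinAt)]
    · refine setLIntegral_congr_fun measurableSet_Ioi fun t ht => ?_
      rw [Set.mem_Ioi] at ht
      simp only [abs_mul, abs_pow, Nat.abs_cast]
      rw [mul_comm]
    · intro a ha b hb hab
      exact (pow_left_inj₀ (le_of_lt ha) (le_of_lt hb) (by omega)).mp hab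
  have hneg : ∫⁻ t in Set.Iio (0 : ℝ), g (t ^ q) * ENNReal.ofReal (q * |t| ^ (q - 1)) =
      ∫⁻ t in Set.Ioi (0 : ℝ), g (t ^ q) * ENNReal.ofReal (q * |t| ^ (q - 1)) := by
    rw [← lintegral_indicator measurableSet_Iio, ← lintegral_indicator measurableSet_Ioi,
      ← lintegral_neg_eq_self]
    congr 1; ext t
    by_cases h : 0 < t <;> simp [Set.indicator, h, hq.neg_pow]
  rw [lintegral_eq_Iio_add_Ioi, hneg, hpos, two_mul]

theorem map_powc {i : Fin n} {q : ℕ} (hq : Even q) (h2 : 2 ≤ q) :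
    Measure.map (powc i q 1) (volume.withDensity fun w => ENNReal.ofReal (q * |w i| ^ (q - 1))) +
      Measure.map (powc i q (-1))
        (volume.withDensity fun w => ENNReal.ofReal (q * |w i| ^ (q - 1))) =
    (2 : ENNReal) • volume := by
  have hm : ∀ s, Measurable (powc i q s) := fun s => (contDiff_powc i q s).continuous.measurable
  have hd : Measurable fun w : Fin n → ℝ => ENNReal.ofReal (q * |w i| ^ (q - 1)) := by fun_prop
  refine Measure.ext_of_lintegral _ fun f hf => ?_
  rw [lintegral_add_measure, lintegral_map hf (hm _), lintegral_map hf (hm _),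
    lintegral_withDensity_eq_lintegral_mul _ hd (g := fun w => f (powc i q 1 w)) (hf.comp (hm _)),
    lintegral_withDensity_eq_lintegral_mul _ hd (g := fun w => f (powc i q (-1) w))
      (hf.comp (hm _)), lintegral_smul_measure,
    ← lintegral_add_left (f := (fun w : Fin n → ℝ => ENNReal.ofReal (q * |w i| ^ (q - 1))) *
      fun w => f (powc i q 1 w)) (hd.mul (hf.comp (hm _))), smul_eq_mul,
    ← lintegral_const_mul _ hf]
  refine lintegral_eq_of_update i ((hd.mul (hf.comp (hm _))).add (hd.mul (hf.comp (hm _))))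
    (hf.const_mul _) fun w => ?_
  simp only [Pi.mul_apply, powc, Function.update_idem, Function.update_self]
  have hu : ∀ s : ℝ, Measurable fun t : ℝ => f (Function.update w i (s * t)) := fun s =>
    hf.comp ((measurable_update w).comp (measurable_const_mul s))
  rw [lintegral_add_left (by
    have := (hu 1).comp (measurable_id.pow_const q)
    simp only [Function.comp_def, id] at this
    fun_prop), lintegral_const_mul _ (by simpa using hu 1)]
  have h := fun s : ℝ => lintegral_comp_pow hq h2 (fun t => f (Function.update w i (s * t)))
  simp only [mul_comm (ENNReal.ofReal _)]
  rw [h 1, h (-1), ← mul_add, lintegral_eq_Iio_add_Ioi (fun t => f (Function.update w i t)),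
    add_comm]
  congr 2
  · rw [← lintegral_indicator measurableSet_Iio, ← lintegral_indicator measurableSet_Ioi,
      ← lintegral_neg_eq_self]
    congr 1; ext t
    by_cases h : t < 0 <;> simp [Set.indicator, h]
  · simp

end Measures

end OscDecay

namespace OscDecay

open Filter Topology MeasureTheory

/-- `Cov Q` says that a neighbourhood of the origin can be resolved by a finite-depth tree of
shears, blow-ups and ramified coverings such that the composite map `π` along each branch,
together with its Jacobian `J`, satisfies `Q π J`. -/
inductive Cov {n : ℕ} :
    (((Fin n → ℝ) → (Fin n → ℝ)) → ((Fin n → ℝ) → ℝ) → Prop) → Prop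
  | id {Q} : Q (fun w => w) (fun _ => 1) → Cov Q
  | shear {Q} (i : Fin n) (θ : (Fin n → ℝ) → ℝ) : ShearFn i θ →
      Cov (fun σ r => Q (fun w => shear i θ (σ w)) r) → Cov Q
  | blow {Q} (i j : Fin n) : i ≠ j →
      (∀ y, Cov (fun σ r => Q (fun w => blow i j y (σ w)) (fun w => σ w i * r w))) →
      Cov (fun σ r => Q (fun w => blow j i 0 (σ w)) (fun w => σ w j * r w)) → Cov Q
  | pow {Q} (i : Fin n) (q : ℕ) : Even q → 2 ≤ q →
      (∀ s : ℝ, s = 1 ∨ s = -1 →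
        Cov (fun σ r => Q (fun w => powc i q s (σ w)) (fun w => q * σ w i ^ (q - 1) * r w))) →
      Cov Q

/-- Regularity of the composite maps, with control on the pushforward of their Jacobian weight. -/
structure IsChart {n : ℕ} (π : (Fin n → ℝ) → (Fin n → ℝ)) (J : (Fin n → ℝ) → ℝ) : Prop where
  contDiff : ContDiff ℝ 1 π
  analyticAt : AnalyticAt ℝ π 0
  zero : π 0 = 0
  jac_contDiff : ContDiff ℝ 1 J
  jac_analyticAt : AnalyticAt ℝ J 0
  push : ∃ M : NNReal, ∀ G : (Fin n → ℝ) → ENNReal, Measurable G →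
    ∫⁻ w, ENNReal.ofReal |J w| * G (π w) ≤ M * ∫⁻ w, G w

section

variable {n : ℕ}

theorem Cov.mono {Q : ((Fin n → ℝ) → (Fin n → ℝ)) → ((Fin n → ℝ) → ℝ) → Prop} (h : Cov Q) :
    ∀ {Q' : ((Fin n → ℝ) → (Fin n → ℝ)) → ((Fin n → ℝ) → ℝ) → Prop},
      (∀ π J, Q π J → Q' π J) → Cov Q' := by
  induction h with
  | id h => intro Q' hQ; exact Cov.id (hQ _ _ h)
  | shear i θ hθ _ ih => intro Q' hQ; exact Cov.shear i θ hθ (ih fun π J => hQ _ _)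
  | blow i j hij _ _ ih1 ih2 =>
    intro Q' hQ
    exact Cov.blow i j hij (fun y => ih1 y fun π J => hQ _ _) (ih2 fun π J => hQ _ _)
  | pow i q hq h2 _ ih =>
    intro Q' hQ
    exact Cov.pow i q hq h2 fun s hs => ih s hs fun π J => hQ _ _

theorem Cov.bind_aux {Q : ((Fin n → ℝ) → (Fin n → ℝ)) → ((Fin n → ℝ) → ℝ) → Prop} (h : Cov Q) :
    ∀ {Q' : ((Fin n → ℝ) → (Fin n → ℝ)) → ((Fin n → ℝ) → ℝ) → Prop},
      (∀ π J, Q π J → Cov (fun σ r => Q' (fun w => π (σ w)) (fun w => J (σ w) * r w))) →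
      Cov Q' := by
  induction h with
  | id h => intro Q' hQ; simpa using hQ _ _ h
  | shear i θ hθ _ ih => intro Q' hQ; exact Cov.shear i θ hθ (ih fun π J h => hQ _ _ h)
  | blow i j hij _ _ ih1 ih2 =>
    intro Q' hQ
    refine Cov.blow i j hij (fun y => ih1 y fun π J h => ?_) (ih2 fun π J h => ?_)
    · simpa only [mul_assoc] using hQ _ _ h
    · simpa only [mul_assoc] using hQ _ _ h
  | pow i q hq h2 _ ih =>
    intro Q' hQ
    refine Cov.pow i q hq h2 fun s hs => ih s hs fun π J h => ?_
    simpa only [mul_assoc] using hQ _ _ h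

theorem IsChart.id : IsChart (fun w : Fin n → ℝ => w) (fun _ => 1) where
  contDiff := contDiff_id
  analyticAt := analyticAt_id
  zero := rfl
  jac_contDiff := contDiff_const
  jac_analyticAt := analyticAt_const
  push := ⟨1, fun G _ => by simp⟩

theorem IsChart.precomp {π c : (Fin n → ℝ) → (Fin n → ℝ)} {J d : (Fin n → ℝ) → ℝ}
    (h : IsChart π J) (hc : ContDiff ℝ 1 c) (ha : AnalyticAt ℝ c 0) (h0 : c 0 = 0)
    (hd : ContDiff ℝ 1 d) (hda : AnalyticAt ℝ d 0)
    (hp : ∃ M : NNReal, ∀ G : (Fin n → ℝ) → ENNReal, Measurable G →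
      ∫⁻ w, ENNReal.ofReal |d w| * G (c w) ≤ M * ∫⁻ w, G w) :
    IsChart (fun w => c (π w)) (fun w => d (π w) * J w) where
  contDiff := hc.comp h.contDiff
  analyticAt := AnalyticAt.fun_comp (by rwa [h.zero]) h.analyticAt
  zero := by rw [h.zero, h0]
  jac_contDiff := (hd.comp h.contDiff).mul h.jac_contDiff
  jac_analyticAt := (AnalyticAt.fun_comp (by rwa [h.zero]) h.analyticAt).mul h.jac_analyticAt
  push := by
    obtain ⟨M, hM⟩ := h.push
    obtain ⟨K, hK⟩ := hp
    refine ⟨M * K, fun G hG => ?_⟩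
    have hm : Measurable fun w => ENNReal.ofReal |d w| * G (c w) := by
      have := hd.continuous.measurable
      have := hc.continuous.measurable
      fun_prop
    calc ∫⁻ w, ENNReal.ofReal |d (π w) * J w| * G (c (π w))
        = ∫⁻ w, ENNReal.ofReal |J w| * (ENNReal.ofReal |d (π w)| * G (c (π w))) := by
          congr 1; ext w; rw [abs_mul, ENNReal.ofReal_mul (abs_nonneg _)]; ring
      _ ≤ M * ∫⁻ w, ENNReal.ofReal |d w| * G (c w) := hM _ hm
      _ ≤ M * (K * ∫⁻ w, G w) := by gcongr; exact hK G hG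
      _ = _ := by push_cast; ring

theorem push_shear {i : Fin n} {θ : (Fin n → ℝ) → ℝ} (h : ShearFn i θ)
    {G : (Fin n → ℝ) → ENNReal} (hG : Measurable G) :
    ∫⁻ w, G (shear i θ w) = ∫⁻ w, G w := by
  rw [← lintegral_map hG (contDiff_shear h.contDiff).continuous.measurable, map_shear h]

theorem push_blow {i j : Fin n} (hij : i ≠ j) (y : ℝ)
    {G : (Fin n → ℝ) → ENNReal} (hG : Measurable G) :
    ∫⁻ w, ENNReal.ofReal |w i| * G (blow i j y w) = ∫⁻ w, G w := by
  have hm := (contDiff_blow i j y).continuous.measurable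
  conv_rhs => rw [← map_blow hij y]
  rw [lintegral_map hG hm, lintegral_withDensity_eq_lintegral_mul _ (by fun_prop)
    (g := fun w => G (blow i j y w)) (hG.comp hm)]
  rfl

theorem push_powc {i : Fin n} {q : ℕ} (hq : Even q) (h2 : 2 ≤ q) {s : ℝ} (hs : s = 1 ∨ s = -1)
    {G : (Fin n → ℝ) → ENNReal} (hG : Measurable G) :
    ∫⁻ w, ENNReal.ofReal |q * w i ^ (q - 1)| * G (powc i q s w) ≤ 2 * ∫⁻ w, G w := by
  have h := congrArg (fun μ => ∫⁻ w, G w ∂μ) (map_powc (i := i) hq h2)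
  have hm := fun s => (contDiff_powc i q s).continuous.measurable
  simp only [lintegral_add_measure, lintegral_map hG (hm _), lintegral_smul_measure,
    smul_eq_mul] at h
  have hd : Measurable fun w : Fin n → ℝ => ENNReal.ofReal (q * |w i| ^ (q - 1)) := by fun_prop
  have e : ∀ s, ∫⁻ w, ENNReal.ofReal |q * w i ^ (q - 1)| * G (powc i q s w) =
      ∫⁻ w, G (powc i q s w) ∂(volume.withDensity fun w =>
        ENNReal.ofReal (q * |w i| ^ (q - 1))) := by
    intro s
    rw [lintegral_withDensity_eq_lintegral_mul _ hd
      (g := fun w => G (powc i q s w)) (hG.comp (hm s))]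
    simp [abs_mul, abs_pow]
  rw [e, ← h]
  rcases hs with rfl | rfl
  · exact le_self_add
  · exact le_add_self

theorem shear_zero {i : Fin n} {θ : (Fin n → ℝ) → ℝ} (h : ShearFn i θ) : shear i θ 0 = 0 := by
  simp [shear, h.zero]

theorem blow_zero (i j : Fin n) (y : ℝ) : blow i j y 0 = 0 := by
  simp [blow]

theorem powc_zero (i : Fin n) {q : ℕ} (h : 2 ≤ q) (s : ℝ) : powc i q s 0 = 0 := by
  have : q ≠ 0 := by omega
  simp [powc, this]

theorem analyticAt_blow (i j : Fin n) (y : ℝ) (x : Fin n → ℝ) : AnalyticAt ℝ (blow i j y) x :=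
  analyticAt_update j ((analyticAt_coord i x).mul (analyticAt_const.add (analyticAt_coord j x)))

theorem analyticAt_powc (i : Fin n) (q : ℕ) (s : ℝ) (x : Fin n → ℝ) :
    AnalyticAt ℝ (powc i q s) x :=
  analyticAt_update i (analyticAt_const.mul ((analyticAt_coord i x).pow q))

theorem analyticAt_shear {i : Fin n} {θ : (Fin n → ℝ) → ℝ} {x : Fin n → ℝ}
    (h : AnalyticAt ℝ θ x) : AnalyticAt ℝ (shear i θ) x :=
  analyticAt_update i ((analyticAt_coord i x).add h)

theorem IsChart.shear {i : Fin n} {θ : (Fin n → ℝ) → ℝ} (h : ShearFn i θ)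
    {π : (Fin n → ℝ) → (Fin n → ℝ)} {J : (Fin n → ℝ) → ℝ} (hπ : IsChart π J) :
    IsChart (fun w => shear i θ (π w)) J := by
  simpa using hπ.precomp (contDiff_shear h.contDiff) (analyticAt_shear h.analyticAt)
    (shear_zero h) (d := fun _ => 1) contDiff_const analyticAt_const
    ⟨1, fun G hG => by simp [push_shear h hG]⟩

theorem IsChart.blow {i j : Fin n} (hij : i ≠ j) (y : ℝ)
    {π : (Fin n → ℝ) → (Fin n → ℝ)} {J : (Fin n → ℝ) → ℝ} (hπ : IsChart π J) :
    IsChart (fun w => blow i j y (π w)) (fun w => π w i * J w) :=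
  hπ.precomp (contDiff_blow i j y) (analyticAt_blow i j y 0) (blow_zero i j y)
    (contDiff_apply ℝ ℝ i) (analyticAt_coord i 0) ⟨1, fun G hG => by simp [push_blow hij y hG]⟩

theorem IsChart.pow (i : Fin n) {q : ℕ} (hq : Even q) (h2 : 2 ≤ q) {s : ℝ} (hs : s = 1 ∨ s = -1)
    {π : (Fin n → ℝ) → (Fin n → ℝ)} {J : (Fin n → ℝ) → ℝ} (hπ : IsChart π J) :
    IsChart (fun w => powc i q s (π w)) (fun w => q * π w i ^ (q - 1) * J w) :=
  hπ.precomp (contDiff_powc i q s) (analyticAt_powc i q s 0) (powc_zero i h2 s)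
    (contDiff_const.mul ((contDiff_apply ℝ ℝ i).pow _))
    (analyticAt_const.mul ((analyticAt_coord i 0).pow _)) ⟨2, fun G hG => push_powc hq h2 hs hG⟩

theorem Cov.chart {Q : ((Fin n → ℝ) → (Fin n → ℝ)) → ((Fin n → ℝ) → ℝ) → Prop} (h : Cov Q) :
    Cov (fun π J => Q π J ∧ IsChart π J) := by
  induction h with
  | id h => exact Cov.id ⟨h, IsChart.id⟩
  | shear i θ hθ _ ih => exact Cov.shear i θ hθ (ih.mono fun π J h => ⟨h.1, h.2.shear hθ⟩)
  | blow i j hij _ _ ih1 ih2 =>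
    exact Cov.blow i j hij (fun y => (ih1 y).mono fun π J h => ⟨h.1, h.2.blow hij y⟩)
      (ih2.mono fun π J h => ⟨h.1, h.2.blow hij.symm 0⟩)
  | pow i q hq h2 _ ih =>
    exact Cov.pow i q hq h2 fun s hs => (ih s hs).mono fun π J h => ⟨h.1, h.2.pow i hq h2 hs⟩

theorem Cov.bind {Q Q' : ((Fin n → ℝ) → (Fin n → ℝ)) → ((Fin n → ℝ) → ℝ) → Prop} (h : Cov Q)
    (hQ : ∀ π J, Q π J → IsChart π J →
      Cov (fun σ r => Q' (fun w => π (σ w)) (fun w => J (σ w) * r w))) : Cov Q' :=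
  h.chart.bind_aux fun π J h => hQ π J h.1 h.2

theorem cons_shear (i : Fin n) (θ : (Fin n → ℝ) → ℝ) (t : ℝ) (v : Fin n → ℝ) :
    shear i.succ (fun w => θ (Fin.tail w)) (Fin.cons t v : Fin (n + 1) → ℝ) =
      (Fin.cons t (shear i θ v) : Fin (n + 1) → ℝ) := by
  simp [shear, Fin.cons_update]

theorem cons_blow (i j : Fin n) (y t : ℝ) (v : Fin n → ℝ) :
    blow i.succ j.succ y (Fin.cons t v : Fin (n + 1) → ℝ) =
      (Fin.cons t (blow i j y v) : Fin (n + 1) → ℝ) := by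
  simp [blow, Fin.cons_update]

theorem cons_powc (i : Fin n) (q : ℕ) (s t : ℝ) (v : Fin n → ℝ) :
    powc i.succ q s (Fin.cons t v : Fin (n + 1) → ℝ) =
      (Fin.cons t (powc i q s v) : Fin (n + 1) → ℝ) := by
  simp [powc, Fin.cons_update]

/-- The projection forgetting coordinate `0`. -/
noncomputable def tailL (n : ℕ) : (Fin (n + 1) → ℝ) →L[ℝ] (Fin n → ℝ) :=
  ContinuousLinearMap.pi fun j => ContinuousLinearMap.proj j.succ

theorem analyticAt_comp_tail {θ : (Fin n → ℝ) → ℝ} {x : Fin (n + 1) → ℝ}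
    (h : AnalyticAt ℝ θ (Fin.tail x)) :
    AnalyticAt ℝ (fun w : Fin (n + 1) → ℝ => θ (Fin.tail w)) x :=
  AnalyticAt.fun_comp (f := fun w => tailL n w) h ((tailL n).analyticAt x)

theorem ShearFn.lift {i : Fin n} {θ : (Fin n → ℝ) → ℝ} (h : ShearFn i θ) :
    ShearFn i.succ (fun w : Fin (n + 1) → ℝ => θ (Fin.tail w)) where
  indep w t := by rw [Fin.tail_update_succ, h.indep]
  contDiff := h.contDiff.comp (tailL n).contDiff
  analyticAt := analyticAt_comp_tail h.analyticAt
  zero := h.zero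

theorem Cov.lift {Q : ((Fin n → ℝ) → (Fin n → ℝ)) → ((Fin n → ℝ) → ℝ) → Prop} (h : Cov Q) :
    ∀ {Q' : ((Fin (n + 1) → ℝ) → (Fin (n + 1) → ℝ)) → ((Fin (n + 1) → ℝ) → ℝ) → Prop},
      (∀ τ r, Q τ r → Q' (fun w => Fin.cons (w 0) (τ (Fin.tail w))) (fun w => r (Fin.tail w))) →
      Cov Q' := by
  induction h with
  | id h => intro Q' hQ; exact Cov.id (by simpa using hQ _ _ h)
  | shear i θ hθ _ ih =>
    intro Q' hQ
    exact Cov.shear i.succ _ hθ.lift (ih fun τ r h => by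
      simp only [cons_shear]; exact hQ _ _ h)
  | blow i j hij _ _ ih1 ih2 =>
    intro Q' hQ
    refine Cov.blow i.succ j.succ (by simpa using hij) (fun y => ih1 y fun τ r h => ?_)
      (ih2 fun τ r h => ?_)
    · simp only [cons_blow, Fin.cons_succ]; exact hQ _ _ h
    · simp only [cons_blow, Fin.cons_succ]; exact hQ _ _ h
  | pow i q hq h2 _ ih =>
    intro Q' hQ
    refine Cov.pow i.succ q hq h2 fun s hs => ih s hs fun τ r h => ?_
    simp only [cons_powc, Fin.cons_succ]; exact hQ _ _ h

/-- The linear shears along coordinate `0`. -/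
def linShear (c : Fin n → ℝ) (w : Fin (n + 1) → ℝ) : Fin (n + 1) → ℝ :=
  Fin.cons (w 0) fun j => w j.succ + c j * w 0

theorem Cov.linShear_aux (s : Finset (Fin n)) (c : Fin n → ℝ) :
    ∀ {Q : ((Fin (n + 1) → ℝ) → (Fin (n + 1) → ℝ)) → ((Fin (n + 1) → ℝ) → ℝ) → Prop},
    Cov (fun σ r => Q (fun w => linShear (fun j => if j ∈ s then c j else 0) (σ w)) r) → Cov Q := by
  classical
  induction s using Finset.induction_on with
  | empty => intro Q h; simpa [linShear, ← Fin.tail_def, Fin.cons_self_tail] using h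
  | insert j s hj ih =>
    intro Q h
    refine Cov.shear j.succ (fun w => c j * w 0) ⟨fun w t => ?_, ?_, ?_, by simp⟩ (ih ?_)
    · rw [Function.update_of_ne (Fin.succ_ne_zero j).symm]
    · exact contDiff_const.mul (contDiff_apply ℝ ℝ 0)
    · exact analyticAt_const.mul (analyticAt_coord 0 0)
    · convert h using 5 with σ r w
      ext k
      refine Fin.cases ?_ (fun k => ?_) k
      · simp [OscDecay.shear, linShear, Function.update_of_ne (Fin.succ_ne_zero j).symm]
      · rcases eq_or_ne k j with rfl | hk
        · simp [OscDecay.shear, linShear, hj]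
        · simp [OscDecay.shear, linShear, hk]

theorem Cov.linShear {Q : ((Fin (n + 1) → ℝ) → (Fin (n + 1) → ℝ)) → ((Fin (n + 1) → ℝ) → ℝ) → Prop}
    (c : Fin n → ℝ) (h : Cov (fun σ r => Q (fun w => linShear c (σ w)) r)) : Cov Q :=
  Cov.linShear_aux Finset.univ c (by simpa using h)

theorem cov_pow_all {q : ℕ} (hq : Even q) (h2 : 2 ≤ q) :
    Cov (fun (σ : (Fin n → ℝ) → (Fin n → ℝ)) r =>
      (∀ i, ∃ s : ℝ, s ≠ 0 ∧ ∀ w, σ w i = s * w i ^ q) ∧ Mono r) := by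
  classical
  suffices h : ∀ t : Finset (Fin n), Cov (fun (σ : (Fin n → ℝ) → (Fin n → ℝ)) r =>
      (∀ i, ∃ s : ℝ, s ≠ 0 ∧ ∀ w, σ w i = s * w i ^ (if i ∈ t then q else 1)) ∧ Mono r) by
    simpa using h Finset.univ
  intro t
  induction t using Finset.induction_on with
  | empty => exact Cov.id ⟨fun i => ⟨1, one_ne_zero, by simp⟩, Mono.const one_ne_zero⟩
  | insert j t hj ih =>
    refine ih.bind fun π J hQ _ => Cov.pow j q hq h2 fun s hs => Cov.id ?_
    have hs0 : s ≠ 0 := by rcases hs with rfl | rfl <;> norm_num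
    have hq0 : (q : ℝ) ≠ 0 := by positivity
    refine ⟨fun i => ?_, ?_⟩
    · obtain ⟨c, hc, h⟩ := hQ.1 i
      rcases eq_or_ne i j with rfl | hi
      · refine ⟨c * s, mul_ne_zero hc hs0, fun w => ?_⟩
        simp [h, powc, hj, mul_assoc]
      · exact ⟨c, hc, fun w => by simp [h, powc, hi]⟩
    · have h1 : Mono (fun w => J (powc j q s w)) := by
        refine hQ.2.comp (fun i => ?_) (powc_zero j h2 s)
        rcases eq_or_ne i j with rfl | hi
        · simpa [powc] using (Mono.const hs0).mul ((Mono.coord i).pow q)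
        · simpa [powc, hi] using Mono.coord i
      refine h1.mul ?_
      simpa using (Mono.const hq0).mul ((Mono.coord j).pow (q - 1))

end

end OscDecay

namespace OscDecay

open Filter Topology MeasureTheory

theorem taylor_unique {d : ℕ} {c : ℕ → ℝ} {V : ℝ → ℝ} (hV : ContinuousAt V 0)
    (h : ∀ᶠ t in 𝓝 (0 : ℝ), ∑ i ∈ Finset.range d, c i * t ^ i + t ^ d * V t = 0) :
    (∀ i < d, c i = 0) ∧ V 0 = 0 := by
  induction d generalizing c with
  | zero => simpa using h.self_of_nhds
  | succ d ih =>
    have h0 : c 0 = 0 := by simpa [Finset.sum_range_succ'] using h.self_of_nhds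
    have hW : ContinuousAt
        (fun t => ∑ i ∈ Finset.range d, c (i + 1) * t ^ i + t ^ d * V t) 0 := by
      fun_prop
    have h1 : ∀ᶠ t in 𝓝[≠] (0 : ℝ),
        ∑ i ∈ Finset.range d, c (i + 1) * t ^ i + t ^ d * V t = 0 := by
      filter_upwards [h.filter_mono nhdsWithin_le_nhds, self_mem_nhdsWithin] with t ht hne
      refine (mul_eq_zero.mp (?_ : t * _ = 0)).resolve_left hne
      rw [← ht, Finset.sum_range_succ', h0, mul_add, Finset.mul_sum]
      simp only [pow_succ, zero_mul, add_zero]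
      congr 1
      · exact Finset.sum_congr rfl fun i _ => by ring
      · ring
    have h2 := hW.eventuallyEq_nhds_iff_eventuallyEq_nhdsNE continuousAt_const |>.mp h1
    obtain ⟨h3, h4⟩ := ih h2
    refine ⟨fun i hi => ?_, h4⟩
    cases i with
    | zero => exact h0
    | succ i => exact h3 i (by omega)

section

variable {n : ℕ}

/-- The embedding of the hyperplane where coordinate `0` vanishes. -/
noncomputable def consL (n : ℕ) : (Fin n → ℝ) →L[ℝ] (Fin (n + 1) → ℝ) :=
  ContinuousLinearMap.pi fun j => Fin.cases 0 (fun i => ContinuousLinearMap.proj i) j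

theorem consL_apply (v : Fin n → ℝ) : consL n v = Fin.cons 0 v := by
  ext j
  refine Fin.cases ?_ (fun i => ?_) j <;> simp [consL]

theorem analyticAt_cons {E : Type*} [NormedAddCommGroup E] [NormedSpace ℝ E] {a : E → ℝ}
    {b : E → (Fin n → ℝ)} {x : E} (ha : AnalyticAt ℝ a x) (hb : AnalyticAt ℝ b x) :
    AnalyticAt ℝ (fun e => (Fin.cons (a e) (b e) : Fin (n + 1) → ℝ)) x := by
  refine AnalyticAt.pi fun j => ?_
  refine Fin.cases ?_ (fun i => ?_) j
  · simpa using ha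
  · simpa using AnalyticAt.fun_comp (analyticAt_coord i _) hb

theorem cons_zero_zero : (Fin.cons (0 : ℝ) (0 : Fin n → ℝ) : Fin (n + 1) → ℝ) = 0 := by
  rw [← consL_apply, map_zero]

theorem analyticAt_tail (x : Fin (n + 1) → ℝ) :
    AnalyticAt ℝ (fun w : Fin (n + 1) → ℝ => (Fin.tail w : Fin n → ℝ)) x :=
  (tailL n).analyticAt x

theorem tail_zero : Fin.tail (0 : Fin (n + 1) → ℝ) = 0 := rfl

theorem tendsto_tail : Tendsto (fun w : Fin (n + 1) → ℝ => (Fin.tail w : Fin n → ℝ)) (𝓝 0) (𝓝 0) := by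
  exact (analyticAt_tail (0 : Fin (n + 1) → ℝ)).continuousAt.tendsto

theorem exists_taylor {h : (Fin (n + 1) → ℝ) → ℝ} (hh : AnalyticAt ℝ h 0) (d : ℕ) :
    ∃ (a : ℕ → (Fin n → ℝ) → ℝ) (U : (Fin (n + 1) → ℝ) → ℝ),
      (∀ i, AnalyticAt ℝ (a i) 0) ∧ AnalyticAt ℝ U 0 ∧
      ∀ᶠ w in 𝓝 0, h w = ∑ i ∈ Finset.range d, a i (Fin.tail w) * w 0 ^ i + w 0 ^ d * U w := by
  induction d with
  | zero => exact ⟨fun _ _ => 0, h, fun _ => analyticAt_const, hh, by simp⟩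
  | succ d ih =>
    obtain ⟨a, U, ha, hU, he⟩ := ih
    obtain ⟨V, hV, hUV⟩ := exists_div_coord hU 0
    refine ⟨fun i => if i < d then a i else fun v => U (Fin.cons 0 v), V, fun i => ?_, hV, ?_⟩
    · dsimp only
      split_ifs
      · exact ha i
      · exact AnalyticAt.fun_comp (by rwa [cons_zero_zero])
          (analyticAt_cons analyticAt_const analyticAt_id)
    · filter_upwards [he, hUV] with w h1 h2
      rw [h1, h2, Finset.sum_range_succ]
      have hs : Function.update w 0 0 = Fin.cons 0 (Fin.tail w) := by
        conv_lhs => rw [← Fin.cons_self_tail w, Fin.update_cons_zero]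
      have hsum : ∑ i ∈ Finset.range d,
          (if i < d then a i else fun v => U (Fin.cons 0 v)) (Fin.tail w) * w 0 ^ i =
          ∑ i ∈ Finset.range d, a i (Fin.tail w) * w 0 ^ i :=
        Finset.sum_congr rfl fun i hi => by rw [if_pos (Finset.mem_range.mp hi)]
      rw [hs, hsum]
      simp only [lt_irrefl, if_false]
      ring

/-- `h` is regular of order `d` in coordinate `0`. -/
def Reg (d : ℕ) (h : (Fin (n + 1) → ℝ) → ℝ) : Prop :=
  AnalyticAt ℝ h 0 ∧ ∃ g : ℝ → ℝ, AnalyticAt ℝ g 0 ∧ g 0 ≠ 0 ∧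
    ∀ᶠ t in 𝓝 (0 : ℝ), h (Fin.cons t 0) = t ^ d * g t

theorem tendsto_axis : Tendsto (fun t : ℝ => (Fin.cons t 0 : Fin (n + 1) → ℝ)) (𝓝 0) (𝓝 0) := by
  have := (analyticAt_cons (n := n) (analyticAt_id (𝕜 := ℝ) (z := (0 : ℝ)))
    (analyticAt_const (v := 0))).continuousAt.tendsto
  simpa [cons_zero_zero] using this

theorem analyticAt_axis {u : (Fin (n + 1) → ℝ) → ℝ} (hu : AnalyticAt ℝ u 0) :
    AnalyticAt ℝ (fun t : ℝ => u (Fin.cons t 0)) 0 :=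
  AnalyticAt.fun_comp (by rwa [cons_zero_zero]) (analyticAt_cons analyticAt_id analyticAt_const)

theorem Reg.coeff {d : ℕ} {h : (Fin (n + 1) → ℝ) → ℝ} (hr : Reg d h)
    {a : ℕ → (Fin n → ℝ) → ℝ} {U : (Fin (n + 1) → ℝ) → ℝ} (hU : AnalyticAt ℝ U 0)
    (he : ∀ᶠ w in 𝓝 0,
      h w = ∑ i ∈ Finset.range d, a i (Fin.tail w) * w 0 ^ i + w 0 ^ d * U w) :
    (∀ i < d, a i 0 = 0) ∧ U 0 ≠ 0 := by
  obtain ⟨_, g, hg, hg0, hgt⟩ := hr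
  have := taylor_unique (d := d) (c := fun i => a i 0) (V := fun t => U (Fin.cons t 0) - g t)
    ((analyticAt_axis hU).continuousAt.sub hg.continuousAt) (by
      filter_upwards [hgt, tendsto_axis.eventually he] with t h1 h2
      simp only [Fin.tail_cons, Fin.cons_zero] at h2
      rw [mul_sub, ← h1, h2]; ring)
  refine ⟨this.1, ?_⟩
  have h2 := this.2
  simp only [cons_zero_zero] at h2
  rwa [sub_eq_zero.mp h2]

end

theorem exists_contDiff_extension {E : Type*} [NormedAddCommGroup E] [NormedSpace ℝ E]
    [FiniteDimensional ℝ E] {θ : E → ℝ} {x : E} (h : AnalyticAt ℝ θ x) :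
    ∃ ψ : E → ℝ, ContDiff ℝ 1 ψ ∧ ∀ᶠ w in 𝓝 x, ψ w = θ w := by
  obtain ⟨r, hr, ha⟩ := h.exists_ball
  let b : ContDiffBump x := ⟨r / 4, r / 2, by positivity, by linarith⟩
  refine ⟨fun w => b w * θ w, ?_, ?_⟩
  · rw [contDiff_iff_contDiffAt]
    intro w
    by_cases hw : w ∈ Metric.ball x r
    · exact b.contDiff.contDiffAt.mul (ha w hw).contDiffAt
    · have hw' : w ∉ tsupport b := by
        rw [b.tsupport_eq, Metric.mem_closedBall]
        rw [Metric.mem_ball] at hw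
        simp only [b]; push Not at hw ⊢; linarith
      have : (fun w => b w * θ w) =ᶠ[𝓝 w] fun _ => 0 := by
        filter_upwards [(isClosed_tsupport b).isOpen_compl.mem_nhds hw'] with y hy
        rw [image_eq_zero_of_notMem_tsupport hy, zero_mul]
      exact contDiffAt_const.congr_of_eventuallyEq this
  · filter_upwards [b.eventuallyEq_one] with w hw
    rw [hw]; simp

end OscDecay

namespace OscDecay

open Filter Topology MeasureTheory

variable {n : ℕ}

theorem exists_implicit {g : (Fin (n + 1) → ℝ) → ℝ} (hg : AnalyticAt ℝ g 0) (hg0 : g 0 = 0)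
    (hp : fderiv ℝ g 0 (Pi.single 0 1) ≠ 0) :
    ∃ θ : (Fin n → ℝ) → ℝ, AnalyticAt ℝ θ 0 ∧ θ 0 = 0 ∧
      ∀ᶠ v in 𝓝 0, g (Fin.cons (θ v) v) = 0 := by
  set L := fderiv ℝ g 0 with hL
  set p := L (Pi.single 0 1) with hpdef
  have hdecomp : ∀ v : Fin (n + 1) → ℝ, L v = v 0 * p + L (Fin.cons 0 (Fin.tail v)) := by
    intro v
    have : v = v 0 • (Pi.single 0 1 : Fin (n + 1) → ℝ) + Fin.cons 0 (Fin.tail v) := by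
      ext j
      refine Fin.cases ?_ (fun i => ?_) j
      · simp
      · simp [Fin.tail]
    conv_lhs => rw [this]
    rw [map_add, map_smul, smul_eq_mul]
  let F : (Fin (n + 1) → ℝ) →ₗ[ℝ] (Fin (n + 1) → ℝ) :=
    { toFun := fun v => Fin.cons (L v) (Fin.tail v)
      map_add' := fun v w => by
        ext j; refine Fin.cases ?_ (fun i => ?_) j <;> simp [Fin.tail]
      map_smul' := fun c v => by
        ext j; refine Fin.cases ?_ (fun i => ?_) j <;> simp [Fin.tail] }
  have hinj : Function.Injective F := by
    rw [← LinearMap.ker_eq_bot, LinearMap.ker_eq_bot']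
    intro v hv
    have h0 : L v = 0 := by simpa [F] using congrFun hv 0
    have ht : Fin.tail v = 0 := by
      ext i; simpa [F] using congrFun hv i.succ
    rw [hdecomp, ht, cons_zero_zero, map_zero, add_zero] at h0
    have hv0 := (mul_eq_zero.mp h0).resolve_right hp
    rw [← Fin.cons_self_tail v, hv0, ht, cons_zero_zero]
  let e : (Fin (n + 1) → ℝ) ≃L[ℝ] (Fin (n + 1) → ℝ) :=
    (LinearEquiv.ofInjectiveEndo F hinj).toContinuousLinearEquiv
  have he : ∀ v, e v = Fin.cons (L v) (Fin.tail v) := fun v => rfl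
  let Φ : (Fin (n + 1) → ℝ) → (Fin (n + 1) → ℝ) := fun w => Fin.cons (g w) (Fin.tail w)
  have hΦ0 : Φ 0 = 0 := by simp only [Φ, hg0, tail_zero, cons_zero_zero]
  have hΦa : AnalyticAt ℝ Φ 0 := analyticAt_cons hg (analyticAt_tail 0)
  have hder : HasFDerivAt Φ (e : (Fin (n + 1) → ℝ) →L[ℝ] (Fin (n + 1) → ℝ)) 0 := by
    rw [hasFDerivAt_pi']
    intro j
    refine Fin.cases ?_ (fun i => ?_) j
    · have := hg.differentiableAt.hasFDerivAt
      simp only [Φ, Fin.cons_zero]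
      exact this.congr_fderiv (ContinuousLinearMap.ext fun v => rfl)
    · simp only [Φ, Fin.cons_succ]
      have := (ContinuousLinearMap.proj (R := ℝ) (φ := fun _ : Fin (n + 1) => ℝ) i.succ).hasFDerivAt
        (x := 0)
      exact this
  have hs : HasStrictFDerivAt Φ (e : (Fin (n + 1) → ℝ) →L[ℝ] (Fin (n + 1) → ℝ)) 0 := by
    have := hΦa.hasStrictFDerivAt
    rwa [hder.fderiv] at this
  let Ψ := hs.toOpenPartialHomeomorph Φ
  have hsymm : AnalyticAt ℝ Ψ.symm 0 := by
    have := Ψ.analyticAt_symm' (i := e) hs.mem_toOpenPartialHomeomorph_source hΦa hder.fderiv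
    rwa [hs.toOpenPartialHomeomorph_coe, hΦ0] at this
  have hmem : (0 : Fin (n + 1) → ℝ) ∈ Ψ.target := by
    have := hs.image_mem_toOpenPartialHomeomorph_target
    rwa [hΦ0] at this
  have hs0 : Ψ.symm 0 = 0 := by
    have := Ψ.left_inv hs.mem_toOpenPartialHomeomorph_source
    rwa [hs.toOpenPartialHomeomorph_coe, hΦ0] at this
  have hc : AnalyticAt ℝ (fun v : Fin n → ℝ => (Fin.cons 0 v : Fin (n + 1) → ℝ)) 0 :=
    analyticAt_cons analyticAt_const analyticAt_id
  refine ⟨fun v => Ψ.symm (Fin.cons 0 v) 0, ?_, ?_, ?_⟩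
  · refine AnalyticAt.fun_comp (analyticAt_coord 0 _) (AnalyticAt.fun_comp ?_ hc)
    rwa [cons_zero_zero]
  · simp only [cons_zero_zero, hs0, Pi.zero_apply]
  · have ht : Tendsto (fun v : Fin n → ℝ => (Fin.cons 0 v : Fin (n + 1) → ℝ)) (𝓝 0) (𝓝 0) := by
      have := hc.continuousAt.tendsto
      rwa [cons_zero_zero] at this
    filter_upwards [ht.eventually (Ψ.open_target.mem_nhds hmem)] with v hv
    have h1 : Φ (Ψ.symm (Fin.cons 0 v)) = Fin.cons 0 v := Ψ.right_inv hv
    have h2 : Fin.tail (Ψ.symm (Fin.cons 0 v)) = v := by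
      simpa [Φ] using congrArg Fin.tail h1
    have h3 : g (Ψ.symm (Fin.cons 0 v)) = 0 := by
      simpa [Φ] using congrFun h1 0
    have h4 : (Fin.cons (Ψ.symm (Fin.cons 0 v) 0) v : Fin (n + 1) → ℝ) =
        Ψ.symm (Fin.cons 0 v) := by
      conv_rhs => rw [← Fin.cons_self_tail (Ψ.symm (Fin.cons 0 v)), h2]
    rw [h4, h3]

/-- The derivative at the origin of the coefficient of order `d - 1`. -/
theorem coeff_deriv_ne_zero {d : ℕ} {F g : ℝ → ℝ} (hg : AnalyticAt ℝ g 0) (hg0 : g 0 ≠ 0)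
    (hF : ∀ᶠ t in 𝓝 (0 : ℝ), F t = t ^ (d + 1) * g t)
    {A : ℕ → ℝ → ℝ} (hA : ∀ i, AnalyticAt ℝ (A i) 0)
    {V : (Fin 2 → ℝ) → ℝ} (hV : AnalyticAt ℝ V 0)
    (h : ∀ᶠ w in 𝓝 (0 : Fin 2 → ℝ), F (w 0 + w 1) =
      ∑ i ∈ Finset.range (d + 1), A i (w 1) * w 0 ^ i + w 0 ^ (d + 1) * V w) :
    deriv (A d) 0 ≠ 0 := by
  have hpair : Continuous fun p : ℝ × ℝ => (![p.1, p.2] : Fin 2 → ℝ) := by fun_prop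
  have hp0 : (![0, 0] : Fin 2 → ℝ) = 0 := by ext j; fin_cases j <;> rfl
  have hax : Tendsto (fun t : ℝ => (![t, 0] : Fin 2 → ℝ)) (𝓝 0) (𝓝 0) := by
    have : Continuous fun t : ℝ => (![t, 0] : Fin 2 → ℝ) := by fun_prop
    simpa [hp0] using this.tendsto 0
  have h1 : ∀ᶠ t in 𝓝 (0 : ℝ), ∀ᶠ y in 𝓝 (0 : ℝ), F (t + y) =
      ∑ i ∈ Finset.range (d + 1), A i y * t ^ i + t ^ (d + 1) * V ![t, y] := by
    have ht : Tendsto (fun p : ℝ × ℝ => (![p.1, p.2] : Fin 2 → ℝ)) (𝓝 (0, 0)) (𝓝 0) := by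
      simpa [hp0] using hpair.tendsto ((0 : ℝ), (0 : ℝ))
    have := (ht.eventually h).curry_nhds
    simpa using this
  let β : ℝ → ℝ := fun t => fderiv ℝ V ![t, 0] (Pi.single 1 1)
  have hder : ∀ᶠ t in 𝓝 (0 : ℝ), (d + 1 : ℕ) * t ^ d * g t + t ^ (d + 1) * deriv g t =
      ∑ i ∈ Finset.range (d + 1), deriv (A i) 0 * t ^ i + t ^ (d + 1) * β t := by
    filter_upwards [h1, hF.eventually_nhds, hg.eventually_analyticAt,
      hax.eventually hV.eventually_analyticAt] with t e1 e2 e3 e4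
    have L1 : HasDerivAt (fun y => F (t + y))
        ((d + 1 : ℕ) * t ^ d * g t + t ^ (d + 1) * deriv g t) 0 := by
      have hFt : HasDerivAt F ((d + 1 : ℕ) * t ^ d * g t + t ^ (d + 1) * deriv g t) (t + 0) := by
        rw [add_zero]
        have := (hasDerivAt_pow (d + 1) t).mul e3.differentiableAt.hasDerivAt
        exact this.congr_of_eventuallyEq e2
      exact hFt.comp_const_add t 0
    have L2 : HasDerivAt (fun y : ℝ => V ![t, y]) (β t) 0 := by
      have hl : HasDerivAt (fun y : ℝ => (![t, y] : Fin 2 → ℝ)) (Pi.single 1 1) 0 := by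
        rw [hasDerivAt_pi]
        intro j
        fin_cases j
        · simpa using hasDerivAt_const (0 : ℝ) t
        · simpa using hasDerivAt_id' (0 : ℝ)
      exact e4.differentiableAt.hasFDerivAt.comp_hasDerivAt (0 : ℝ) hl
    have L3 : HasDerivAt (fun y => ∑ i ∈ Finset.range (d + 1), A i y * t ^ i +
        t ^ (d + 1) * V ![t, y])
        (∑ i ∈ Finset.range (d + 1), deriv (A i) 0 * t ^ i + t ^ (d + 1) * β t) 0 :=
      (HasDerivAt.fun_sum fun i _ => ((hA i).differentiableAt.hasDerivAt.mul_const _)).add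
        (L2.const_mul _)
    exact L1.unique (L3.congr_of_eventuallyEq e1)
  have hβ : ContinuousAt β 0 := by
    have h2 : ContinuousAt (fderiv ℝ V) 0 := hV.fderiv.continuousAt
    have h3 : ContinuousAt (fun t : ℝ => fderiv ℝ V ![t, 0]) 0 := by
      have h2' : Tendsto (fderiv ℝ V) (𝓝 0) (𝓝 (fderiv ℝ V ![0, 0])) := by rw [hp0]; exact h2
      exact h2'.comp hax
    exact h3.clm_apply continuousAt_const
  have huniq := taylor_unique (d := d + 1)
    (c := fun i => deriv (A i) 0 - if i = d then (d + 1 : ℕ) * g 0 else 0)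
    (V := fun t => β t - deriv g t - (d + 1 : ℕ) * dslope g 0 t)
    ((hβ.sub hg.deriv.continuousAt).sub
      (continuousAt_const.mul (continuousAt_dslope_same.mpr hg.differentiableAt))) (by
      filter_upwards [hder] with t ht
      have hs : g t = g 0 + t * dslope g 0 t := by
        have := sub_smul_dslope g 0 t
        simp only [sub_zero, smul_eq_mul] at this
        linarith
      simp only [sub_mul, Finset.sum_sub_distrib, ite_mul, zero_mul]
      rw [Finset.sum_ite_eq' (Finset.range (d + 1)) d, if_pos (by simp)]
      rw [hs] at ht
      rw [mul_sub, mul_sub, pow_succ] at *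
      linear_combination -ht)
  have := huniq.1 d (by omega)
  simp only [if_true] at this
  rw [sub_eq_zero.mp this]
  exact mul_ne_zero (by positivity) hg0

/-- Removal of the subleading coefficient by a shear. -/
theorem exists_tschirnhaus {d : ℕ} {h : (Fin (n + 1) → ℝ) → ℝ} (hr : Reg (d + 1) h) :
    ∃ (θ : (Fin (n + 1) → ℝ) → ℝ) (a : ℕ → (Fin n → ℝ) → ℝ) (U : (Fin (n + 1) → ℝ) → ℝ),
      ShearFn 0 θ ∧ (∀ i, AnalyticAt ℝ (a i) 0) ∧ AnalyticAt ℝ U 0 ∧ (∀ i < d + 1, a i 0 = 0) ∧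
      (∀ᶠ v in 𝓝 0, a d v = 0) ∧ U 0 ≠ 0 ∧
      ∀ᶠ w in 𝓝 0, h (shear 0 θ w) =
        ∑ i ∈ Finset.range (d + 1), a i (Fin.tail w) * w 0 ^ i + w 0 ^ (d + 1) * U w := by
  have hh := hr.1
  -- the two-variable family `h (t + v 0, tail v)`
  let add0 : (Fin (n + 2) → ℝ) → (Fin (n + 1) → ℝ) := fun w =>
    Fin.cons (w 0 + w 1) (Fin.tail (Fin.tail w))
  have hadd : AnalyticAt ℝ add0 0 :=
    analyticAt_cons ((analyticAt_coord 0 0).add (analyticAt_coord 1 0))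
      (AnalyticAt.fun_comp (f := fun w : Fin (n + 2) → ℝ => (Fin.tail w : Fin (n + 1) → ℝ))
        (analyticAt_tail _) (analyticAt_tail _))
  have hadd0 : add0 0 = 0 := by
    simp only [add0, tail_zero, Pi.zero_apply, add_zero, cons_zero_zero]
  obtain ⟨A, V, hA, hV, hAV⟩ := exists_taylor (h := fun w => h (add0 w))
    (AnalyticAt.fun_comp (by rwa [hadd0]) hadd) (d + 1)
  obtain ⟨_, g, hg, hg0, hgt⟩ := hr
  have hA0 : AnalyticAt ℝ (A d) 0 := hA d
  let ι : (Fin 2 → ℝ) → (Fin (n + 2) → ℝ) := fun w => Fin.cons (w 0) (Fin.cons (w 1) 0)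
  have hι : AnalyticAt ℝ ι 0 :=
    analyticAt_cons (analyticAt_coord 0 0) (analyticAt_cons (analyticAt_coord 1 0) analyticAt_const)
  have hι0 : ι 0 = 0 := by simp only [ι, Pi.zero_apply, cons_zero_zero]
  have hιt : Tendsto ι (𝓝 0) (𝓝 0) := by simpa [hι0] using hι.continuousAt.tendsto
  have hdne := coeff_deriv_ne_zero (d := d) (F := fun s => h (Fin.cons s 0)) hg hg0 hgt
    (A := fun i y => A i (Fin.cons y 0)) (fun i => analyticAt_axis (hA i))
    (V := fun w => V (ι w)) (AnalyticAt.fun_comp (by rwa [hι0]) hι) (by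
      filter_upwards [hιt.eventually hAV] with w hw
      simpa [ι, add0] using hw)
  have hA00 : A d 0 = 0 := by
    have := taylor_unique (d := d + 1) (c := fun i => A i 0)
      (V := fun t => V (Fin.cons t 0) - g t)
      ((analyticAt_axis hV).continuousAt.sub hg.continuousAt) (by
        filter_upwards [hgt, tendsto_axis.eventually hAV] with t h1 h2
        have h3 : add0 (Fin.cons t 0) = Fin.cons t 0 := by
          simp only [add0, Fin.tail_cons, Fin.cons_zero, tail_zero]
          congr 1
          have : (Fin.cons t 0 : Fin (n + 2) → ℝ) 1 = 0 := rfl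
          rw [this, add_zero]
        simp only [Fin.tail_cons, Fin.cons_zero, h3] at h2
        rw [mul_sub, ← h1, h2]; ring)
    exact this.1 d (by omega)
  have hp : fderiv ℝ (A d) 0 (Pi.single 0 1) ≠ 0 := by
    have hl : HasDerivAt (fun y : ℝ => (Fin.cons y 0 : Fin (n + 1) → ℝ)) (Pi.single 0 1) 0 := by
      rw [hasDerivAt_pi]
      intro j
      refine Fin.cases ?_ (fun i => ?_) j
      · simpa using hasDerivAt_id' (0 : ℝ)
      · simpa using hasDerivAt_const (0 : ℝ) (0 : ℝ)
    have h2 : HasFDerivAt (A d) (fderiv ℝ (A d) 0) (Fin.cons (0 : ℝ) (0 : Fin n → ℝ)) := by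
      rw [cons_zero_zero]; exact hA0.differentiableAt.hasFDerivAt
    have h3 : deriv (fun y : ℝ => A d (Fin.cons y 0)) 0 = fderiv ℝ (A d) 0 (Pi.single 0 1) :=
      (h2.comp_hasDerivAt (0 : ℝ) hl).deriv
    rwa [← h3]
  obtain ⟨θ, hθ, hθ0, hθg⟩ := exists_implicit hA0 hA00 hp
  obtain ⟨ψ, hψ, hψθ⟩ := exists_contDiff_extension hθ
  have hψa : AnalyticAt ℝ ψ 0 := hθ.congr (hψθ.mono fun w hw => hw.symm)
  have hψ0 : ψ 0 = 0 := by rw [hψθ.self_of_nhds, hθ0]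
  have hemb : AnalyticAt ℝ (fun v : Fin n → ℝ => (Fin.cons (ψ v) v : Fin (n + 1) → ℝ)) 0 :=
    analyticAt_cons hψa analyticAt_id
  have hemb2 : AnalyticAt ℝ (fun w : Fin (n + 1) → ℝ =>
      (Fin.cons (w 0) (Fin.cons (ψ (Fin.tail w)) (Fin.tail w)) : Fin (n + 2) → ℝ)) 0 :=
    analyticAt_cons (analyticAt_coord 0 0)
      (AnalyticAt.fun_comp (g := fun v : Fin n → ℝ => (Fin.cons (ψ v) v : Fin (n + 1) → ℝ))
        (f := fun w : Fin (n + 1) → ℝ => (Fin.tail w : Fin n → ℝ)) hemb (analyticAt_tail _))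
  have he0 : (Fin.cons ((0 : Fin (n + 1) → ℝ) 0) (Fin.cons (ψ (Fin.tail (0 : Fin (n + 1) → ℝ)))
      (Fin.tail (0 : Fin (n + 1) → ℝ))) : Fin (n + 2) → ℝ) = 0 := by
    simp only [tail_zero, hψ0, cons_zero_zero, Pi.zero_apply]
  have hUa : AnalyticAt ℝ (fun w : Fin (n + 1) → ℝ =>
      V (Fin.cons (w 0) (Fin.cons (ψ (Fin.tail w)) (Fin.tail w)))) 0 :=
    AnalyticAt.fun_comp (by rwa [he0]) hemb2
  have haa : ∀ i, AnalyticAt ℝ (fun v : Fin n → ℝ => A i (Fin.cons (ψ v) v)) 0 := fun i =>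
    AnalyticAt.fun_comp (by rw [hψ0, cons_zero_zero]; exact hA i) hemb
  have hS : ShearFn (0 : Fin (n + 1)) (fun w => ψ (Fin.tail w)) :=
    { indep := fun w t => by
        congr 1
      contDiff := hψ.comp (tailL n).contDiff
      analyticAt := analyticAt_comp_tail hψa
      zero := hψ0 }
  have hexp : ∀ᶠ w in 𝓝 0, h (shear 0 (fun w => ψ (Fin.tail w)) w) =
      ∑ i ∈ Finset.range (d + 1), A i (Fin.cons (ψ (Fin.tail w)) (Fin.tail w)) * w 0 ^ i +
        w 0 ^ (d + 1) * V (Fin.cons (w 0) (Fin.cons (ψ (Fin.tail w)) (Fin.tail w))) := by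
    have ht := hemb2.continuousAt.tendsto
    rw [he0] at ht
    filter_upwards [ht.eventually hAV] with w hw
    simp only [Fin.tail_cons, Fin.cons_zero] at hw
    rw [← hw]
    congr 1
    have h1 : (Fin.cons (w 0) (Fin.cons (ψ (Fin.tail w)) (Fin.tail w)) : Fin (n + 2) → ℝ) 1 =
      ψ (Fin.tail w) := rfl
    simp only [add0, Fin.tail_cons, Fin.cons_zero, h1, shear]
    conv_lhs => rw [← Fin.cons_self_tail w, Fin.update_cons_zero]
    simp
  have hr' : Reg (d + 1) (fun w => h (shear 0 (fun w => ψ (Fin.tail w)) w)) := by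
    refine ⟨AnalyticAt.fun_comp (by rwa [shear_zero hS]) (analyticAt_shear hS.analyticAt),
      g, hg, hg0, ?_⟩
    filter_upwards [hgt] with t ht
    rw [← ht]
    congr 1
    simp [shear, hψ0]
  obtain ⟨hc, hU0⟩ := hr'.coeff (a := fun i v => A i (Fin.cons (ψ v) v)) hUa hexp
  refine ⟨_, _, _, hS, haa, hUa, hc, ?_, hU0, hexp⟩
  filter_upwards [hψθ, hθg] with v h1 h2
  rw [h1, h2]

end OscDecay

namespace OscDecay

open Filter Topology MeasureTheory

variable {n : ℕ}

/-- Chart of the toric resolution in which coordinate `0` is divisible by the monomial. -/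
def ToricDiv (γ : Fin n → ℕ) (π : (Fin (n + 1) → ℝ) → (Fin (n + 1) → ℝ))
    (J : (Fin (n + 1) → ℝ) → ℝ) : Prop :=
  ∃ y : ℝ, ∀ w, π w = Fin.cons (mon γ (Fin.tail w) * (y + w 0)) (Fin.tail w) ∧
    J w = mon γ (Fin.tail w)

/-- Chart of the toric resolution in which the monomial is divisible by coordinate `0`. -/
def ToricMul (γ : Fin n → ℕ) (π : (Fin (n + 1) → ℝ) → (Fin (n + 1) → ℝ))
    (J : (Fin (n + 1) → ℝ) → ℝ) : Prop :=
  Mono J ∧ (∀ i, Mono fun w => π w i) ∧ ∃ c : (Fin (n + 1) → ℝ) → ℝ, AnalyticAt ℝ c 0 ∧ c 0 = 0 ∧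
    ∀ᶠ w in 𝓝 0, mon γ (Fin.tail (π w)) = π w 0 * c w

theorem tail_blow_zero (k : Fin n) (y : ℝ) (w : Fin (n + 1) → ℝ) :
    Fin.tail (blow k.succ 0 y w) = Fin.tail w := by
  ext i; simp [blow, Fin.tail]

theorem blow_zero_eq (k : Fin n) (y : ℝ) (w : Fin (n + 1) → ℝ) :
    blow k.succ 0 y w 0 = w k.succ * (y + w 0) := by simp [blow]

theorem cov_toric (γ : Fin n → ℕ) : Cov (fun π J => ToricDiv γ π J ∨ ToricMul γ π J) := by
  induction hm : ∑ j, γ j using Nat.strong_induction_on generalizing γ with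
  | _ N ih =>
  rcases eq_or_ne γ 0 with rfl | hγ
  · refine Cov.id (Or.inl ⟨0, fun w => ⟨?_, by simp⟩⟩)
    rw [mon_zero, one_mul, zero_add, Fin.cons_self_tail]
  obtain ⟨k, γ', rfl, hlt⟩ := exists_eq_add_single hγ
  rw [hm] at hlt
  have hne : k.succ ≠ (0 : Fin (n + 1)) := Fin.succ_ne_zero k
  refine Cov.blow k.succ 0 hne (fun y => ?_) ?_
  · rcases eq_or_ne y 0 with rfl | hy
    · refine (ih _ hlt γ' rfl).mono fun σ r h => ?_
      rcases h with ⟨y0, h⟩ | ⟨hr, hσ, c, hc, hc0, he⟩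
      · left
        refine ⟨y0, fun w => ?_⟩
        obtain ⟨h1, h2⟩ := h w
        have hk : σ w k.succ = Fin.tail w k := by rw [h1, Fin.cons_succ]
        constructor
        · beta_reduce
          rw [← Fin.cons_self_tail (blow _ _ _ _), tail_blow_zero, blow_zero_eq, hk, h1]
          simp only [Fin.tail_cons, Fin.cons_zero, mon_add, mon_single, zero_add]
          congr 1; ring
        · beta_reduce
          rw [h2, hk, mon_add, mon_single, mul_comm]
      · right
        refine ⟨(hσ _).mul hr, fun i => ?_, c, hc, hc0, ?_⟩
        · refine Fin.cases ?_ (fun i => ?_) i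
          · simpa only [blow_zero_eq, zero_add] using (hσ k.succ).mul (hσ 0)
          · have := hσ i.succ
            simpa [blow] using this
        · filter_upwards [he] with w hw
          rw [tail_blow_zero, blow_zero_eq, mon_add, mon_single, hw, zero_add]
          simp only [Fin.tail]; ring
    · refine Cov.id ?_
      have hy0 : Mono fun w : Fin (n + 1) → ℝ => y + w 0 :=
        Mono.unit (analyticAt_const.add (analyticAt_coord 0 0)) (by simpa using hy)
      rcases eq_or_ne γ' 0 with rfl | hγ'
      · left
        refine ⟨y, fun w => ⟨?_, by simp [Fin.tail]⟩⟩
        beta_reduce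
        rw [← Fin.cons_self_tail (blow _ _ _ _), tail_blow_zero, blow_zero_eq, zero_add, mon_single]
        rfl
      · right
        have hna : AnalyticAt ℝ (fun w : Fin (n + 1) → ℝ => mon γ' (Fin.tail w) / (y + w 0)) 0 :=
          (analyticAt_comp_tail (analyticAt_mon _ _)).div
            (analyticAt_const.add (analyticAt_coord 0 0)) (by simpa using hy)
        refine ⟨by simpa using Mono.coord k.succ, fun i => ?_,
          fun w => mon γ' (Fin.tail w) / (y + w 0), hna, ?_, ?_⟩
        · refine Fin.cases ?_ (fun i => ?_) i
          · simpa only [blow_zero_eq] using (Mono.coord k.succ).mul hy0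
          · simpa [blow] using Mono.coord i.succ
        · simp [tail_zero, mon_zero_eq_zero hγ']
        · have h0 : ∀ᶠ w in 𝓝 (0 : Fin (n + 1) → ℝ), y + w 0 ≠ 0 :=
            hy0.analyticAt.continuousAt.eventually_ne (by simpa using hy)
          filter_upwards [h0] with w hw
          rw [tail_blow_zero, blow_zero_eq, mon_add, mon_single]
          simp only [Fin.tail]
          field_simp
  · refine Cov.id (Or.inr ?_)
    have h0 : ∀ w : Fin (n + 1) → ℝ, blow 0 k.succ 0 w 0 = w 0 := fun w => by
      simp [blow, hne.symm]
    have hk : ∀ w : Fin (n + 1) → ℝ, blow 0 k.succ 0 w k.succ = w 0 * w k.succ := fun w => by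
      simp [blow]
    have hb : AnalyticAt ℝ (fun w : Fin (n + 1) → ℝ => mon γ' (Fin.tail (blow 0 k.succ 0 w))) 0 :=
      AnalyticAt.fun_comp (g := fun v : Fin (n + 1) → ℝ => mon γ' (Fin.tail v))
        (analyticAt_comp_tail (analyticAt_mon _ _)) (analyticAt_blow _ _ _ _)
    refine ⟨by simpa using Mono.coord 0, fun i => ?_,
      fun w => w k.succ * mon γ' (Fin.tail (blow 0 k.succ 0 w)),
      (analyticAt_coord _ _).mul hb, by simp, ?_⟩
    · by_cases hi : i = k.succ
      · subst hi
        simpa only [hk] using (Mono.coord 0).mul (Mono.coord k.succ)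
      · simpa [blow, hi] using Mono.coord i
    · refine Filter.Eventually.of_forall fun w => ?_
      beta_reduce
      rw [mon_add, mon_single, h0]
      have : Fin.tail (blow 0 k.succ 0 w) k = w 0 * w k.succ := hk w
      rw [this]; ring

end OscDecay

namespace OscDecay

open Filter Topology MeasureTheory

/-- Every nonzero analytic germ in `n` variables can be monomialized. -/
def MonoCov (n : ℕ) : Prop := ∀ u : (Fin n → ℝ) → ℝ, AnalyticAt ℝ u 0 → NZ u →
  Cov fun π J => Mono (fun w => u (π w)) ∧ Mono J

variable {n : ℕ}

theorem IsChart.comp_analyticAt {π : (Fin n → ℝ) → (Fin n → ℝ)} {J : (Fin n → ℝ) → ℝ}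
    (h : IsChart π J) {u : (Fin n → ℝ) → ℝ} (hu : AnalyticAt ℝ u 0) :
    AnalyticAt ℝ (fun w => u (π w)) 0 :=
  AnalyticAt.fun_comp (by rwa [h.zero]) h.analyticAt

theorem IsChart.tendsto {π : (Fin n → ℝ) → (Fin n → ℝ)} {J : (Fin n → ℝ) → ℝ}
    (h : IsChart π J) : Tendsto π (𝓝 0) (𝓝 0) := by
  simpa [h.zero] using h.analyticAt.continuousAt.tendsto

theorem MonoCov.coords (hM : MonoCov n) {u : (Fin n → ℝ) → ℝ} (hu : AnalyticAt ℝ u 0) (nu : NZ u) :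
    Cov fun π J => Mono (fun w => u (π w)) ∧ Mono J ∧ ∀ i, Mono fun w => π w i := by
  classical
  have ha : AnalyticAt ℝ (fun w : Fin n → ℝ => ∏ i, w i) 0 :=
    Finset.analyticAt_fun_prod _ fun i _ => analyticAt_coord i 0
  have hz : NZ (fun w : Fin n → ℝ => ∏ i, w i) :=
    NZ.prod _ (fun i _ => analyticAt_coord i 0) fun i _ => NZ.coord i
  refine (hM (fun w => u w * ∏ i, w i) (hu.mul ha) (NZ.mul hu ha nu hz)).chart.mono ?_
  rintro π J ⟨⟨h1, h2⟩, hc⟩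
  refine ⟨Mono.of_mul_left (hc.comp_analyticAt hu) (hc.comp_analyticAt ha) h1, h2, fun i => ?_⟩
  refine Mono.of_mul_left (b := fun w => u (π w) * ∏ j ∈ Finset.univ.erase i, π w j)
    (hc.comp_analyticAt (analyticAt_coord i 0)) ?_ ?_
  · exact (hc.comp_analyticAt hu).mul (Finset.analyticAt_fun_prod _ fun j _ =>
      hc.comp_analyticAt (analyticAt_coord j 0))
  · refine h1.congr (Filter.Eventually.of_forall fun w => ?_)
    rw [← Finset.mul_prod_erase _ _ (Finset.mem_univ i)]
    ring

theorem poly_order {D : ℕ} {b : ℕ → ℝ} {U : ℝ} (hb : b D = 0) {i₀ : ℕ}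
    (hi : i₀ < D + 1) (hb0 : b i₀ ≠ 0) (y : ℝ) :
    ∃ e < D + 1, ∃ g : ℝ → ℝ, AnalyticAt ℝ g 0 ∧ g 0 ≠ 0 ∧
      ∀ t, ∑ i ∈ Finset.range (D + 1), b i * (y + t) ^ i + U * (y + t) ^ (D + 1) = t ^ e * g t := by
  open Polynomial in
  let p : ℝ[X] := ∑ i ∈ Finset.range (D + 1), C (b i) * X ^ i + C U * X ^ (D + 1)
  have hcoeff : ∀ j < D + 1, p.coeff j = b j := by
    intro j hj
    simp only [p, Polynomial.coeff_add, Polynomial.finsetSum_coeff, Polynomial.coeff_C_mul_X_pow]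
    rw [Finset.sum_ite_eq, if_pos (Finset.mem_range.mpr hj), if_neg (by omega), add_zero]
  have hp0 : p ≠ 0 := fun h => hb0 (by rw [← hcoeff i₀ hi, h, Polynomial.coeff_zero])
  have hdeg : p.natDegree ≤ D + 1 := by
    rw [Polynomial.natDegree_le_iff_coeff_eq_zero]
    intro N hN
    simp only [p, Polynomial.coeff_add, Polynomial.finsetSum_coeff, Polynomial.coeff_C_mul_X_pow]
    rw [if_neg (by omega), add_zero]
    exact Finset.sum_eq_zero fun i hi => if_neg (by have := Finset.mem_range.mp hi; omega)
  obtain ⟨q, hq, hnd⟩ := Polynomial.exists_eq_pow_rootMultiplicity_mul_and_not_dvd p hp0 y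
  set e := p.rootMultiplicity y with he
  have heval : ∀ s, ∑ i ∈ Finset.range (D + 1), b i * s ^ i + U * s ^ (D + 1) = p.eval s := by
    intro s; simp [p, Polynomial.eval_finsetSum]
  have hq0 : q ≠ 0 := by rintro rfl; simp at hnd
  refine ⟨e, ?_, fun t => q.eval (y + t), ?_, ?_, fun t => ?_⟩
  · by_contra hcon
    have hd : p.natDegree = e + q.natDegree := by
      conv_lhs => rw [hq]
      rw [Polynomial.natDegree_mul (pow_ne_zero _ (Polynomial.X_sub_C_ne_zero y)) hq0,
        Polynomial.natDegree_pow, Polynomial.natDegree_X_sub_C, mul_one]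
    have he1 : e = D + 1 := by omega
    have hqd : q.natDegree = 0 := by omega
    obtain ⟨a, rfl⟩ := Polynomial.natDegree_eq_zero.mp hqd
    have ha : a ≠ 0 := by rintro rfl; simp at hq0
    have hc : ∀ j, p.coeff j = (-y) ^ (D + 1 - j) * (D + 1).choose j * a := by
      intro j
      conv_lhs => rw [hq, he1]
      rw [Polynomial.coeff_mul_C, sub_eq_add_neg, ← Polynomial.C_neg, Polynomial.coeff_X_add_C_pow]
    have h1 := hc D
    rw [hcoeff D (by omega), hb] at h1
    have hy : y = 0 := by
      have h2 : (-y) ^ (D + 1 - D) * ((D + 1).choose D : ℝ) * a = 0 := h1.symm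
      rw [Nat.add_sub_cancel_left, pow_one] at h2
      have h3 : ((D + 1).choose D : ℝ) ≠ 0 := by
        have : 0 < (D + 1).choose D := Nat.choose_pos (by omega)
        positivity
      exact neg_eq_zero.mp ((mul_eq_zero.mp ((mul_eq_zero.mp h2).resolve_right ha)).resolve_right h3)
    have h4 := hc i₀
    rw [hcoeff i₀ hi, hy, neg_zero, zero_pow (by omega)] at h4
    exact hb0 (by simpa using h4)
  · have hy : AnalyticAt ℝ (fun t : ℝ => y + t) 0 := analyticAt_const.add analyticAt_id
    simpa using hy.aeval_polynomial q
  · beta_reduce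
    rw [add_zero]
    intro h
    exact hnd (Polynomial.dvd_iff_isRoot.mpr h)
  · rw [heval]
    conv_lhs => rw [hq]
    simp

end OscDecay

namespace OscDecay

open Filter Topology MeasureTheory

variable {n : ℕ}

/-- After a further ramified covering, monomial exponents become divisible by `q`. -/
theorem MonoCov.ramified (hM : MonoCov n) {u : (Fin n → ℝ) → ℝ} (hu : AnalyticAt ℝ u 0) (nu : NZ u)
    {q : ℕ} (hq : Even q) (h2 : 2 ≤ q) :
    Cov fun π J => Mono J ∧ (∀ i, Mono fun w => π w i) ∧ ∃ (γ : Fin n → ℕ) (W : (Fin n → ℝ) → ℝ),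
      AnalyticAt ℝ W 0 ∧ W 0 ≠ 0 ∧ ∀ᶠ w in 𝓝 0, u (π w) = mon (q • γ) w * W w := by
  refine (hM.coords hu nu).bind fun π J ⟨h1, h3, h4⟩ hc => ?_
  refine (cov_pow_all hq h2).chart.mono fun σ r ⟨⟨hσ, hr⟩, hcσ⟩ => ?_
  choose s hs hσs using hσ
  have hco : ∀ i, Mono fun w => σ w i := fun i =>
    ((Mono.const (hs i)).mul ((Mono.coord i).pow q)).congr (Eventually.of_forall fun w => hσs i w)
  obtain ⟨γ, W, hW, hW0, he⟩ := h1
  refine ⟨(h3.comp hco hcσ.zero).mul hr, fun i => (h4 i).comp hco hcσ.zero, γ,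
    fun w => (∏ i, s i ^ γ i) * W (σ w), analyticAt_const.mul (hcσ.comp_analyticAt hW), ?_, ?_⟩
  · beta_reduce
    rw [hcσ.zero]
    exact mul_ne_zero (Finset.prod_ne_zero_iff.mpr fun i _ => pow_ne_zero _ (hs i)) hW0
  · filter_upwards [hcσ.tendsto.eventually he] with w hw
    rw [hw, mon_smul, ← mul_assoc]
    congr 1
    simp only [mon, hσs, mul_pow, Finset.prod_mul_distrib, ← Finset.prod_pow]
    rw [mul_comm]
    congr 1
    exact Finset.prod_congr rfl fun i _ => by rw [← pow_mul, ← pow_mul, mul_comm]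

theorem exists_quotients {D : ℕ} {a : ℕ → (Fin n → ℝ) → ℝ} (ha : ∀ i, AnalyticAt ℝ (a i) 0)
    {p : ℕ → ℕ} {q : ℕ} (hp : ∀ i < D, 0 < p i) (hpq : ∀ i < D, (D - i) * (2 * p i) = q)
    {γ : Fin n → ℕ} {W : (Fin n → ℝ) → ℝ} (hW : AnalyticAt ℝ W 0) (hW0 : W 0 ≠ 0)
    (h : ∀ᶠ w in 𝓝 0, ∑ i ∈ Finset.range D, a i w ^ (2 * p i) = mon (q • γ) w * W w) :
    ∃ b : ℕ → (Fin n → ℝ) → ℝ, (∀ i, AnalyticAt ℝ (b i) 0) ∧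
      (∀ i < D, ∀ᶠ w in 𝓝 0, a i w = mon γ w ^ (D - i) * b i w) ∧ ∃ i < D, b i 0 ≠ 0 := by
  set C := |W 0| + 1
  have hC : 1 ≤ C := by simp [C]
  have hWC : ∀ᶠ w in 𝓝 0, |W w| < C :=
    hW.continuousAt.abs.tendsto.eventually (gt_mem_nhds (by simp [C]))
  have key : ∀ i, ∃ b : (Fin n → ℝ) → ℝ, AnalyticAt ℝ b 0 ∧
      (i < D → ∀ᶠ w in 𝓝 0, a i w = mon γ w ^ (D - i) * b w) := by
    intro i
    by_cases hi : i < D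
    · obtain ⟨b, hb, he⟩ := exists_div_mon (α := (D - i) • γ) (ha i) (C := C) (by
        filter_upwards [h, hWC] with w h1 h2
        have hpi := hp i hi
        refine le_of_pow_le_pow_left₀ (n := 2 * p i) (by omega) (by positivity) ?_
        calc |a i w| ^ (2 * p i) = a i w ^ (2 * p i) := (even_two_mul _).pow_abs _
          _ ≤ ∑ i ∈ Finset.range D, a i w ^ (2 * p i) :=
            Finset.single_le_sum (f := fun i => a i w ^ (2 * p i))
              (fun j _ => (even_two_mul _).pow_nonneg _) (Finset.mem_range.mpr hi)
          _ ≤ |mon (q • γ) w * W w| := h1 ▸ le_abs_self _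
          _ = |mon ((D - i) • γ) w| ^ (2 * p i) * |W w| := by
            rw [abs_mul, ← hpq i hi, mon_smul, mon_smul, pow_mul, abs_pow]
          _ ≤ |mon ((D - i) • γ) w| ^ (2 * p i) * C ^ (2 * p i) := by
            gcongr
            exact h2.le.trans (le_self_pow₀ hC (by omega))
          _ = _ := by rw [← mul_pow, mul_comm])
      exact ⟨b, hb, fun _ => by simpa only [mon_smul] using he⟩
    · exact ⟨fun _ => 0, analyticAt_const, fun h => absurd h hi⟩
  choose b hb hab using key
  refine ⟨b, hb, hab, ?_⟩
  have hall : ∀ᶠ w in 𝓝 0, ∀ i ∈ Finset.range D, a i w = mon γ w ^ (D - i) * b i w :=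
    (Finset.range D).eventually_all.mpr fun i hi => hab i (Finset.mem_range.mp hi)
  have hB : AnalyticAt ℝ (fun w => ∑ i ∈ Finset.range D, b i w ^ (2 * p i)) 0 :=
    Finset.analyticAt_fun_sum _ fun i _ => (hb i).pow _
  have hcancel := (NZ.of_mon (q • γ)).cancel (analyticAt_mon _ 0) hB hW (by
    filter_upwards [h, hall] with w h1 h2
    rw [← h1, Finset.mul_sum]
    refine Finset.sum_congr rfl fun i hi => ?_
    rw [h2 i hi, mul_pow, mon_smul, ← pow_mul, hpq i (Finset.mem_range.mp hi)])
  have h0 := hcancel.self_of_nhds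
  by_contra hcon
  push Not at hcon
  refine hW0 (h0 ▸ Finset.sum_eq_zero fun i hi => ?_)
  have hi' := Finset.mem_range.mp hi
  rw [hcon i hi', zero_pow (by have := hp i hi'; omega)]

theorem tendsto_comp_zero {m k : ℕ} {π : (Fin m → ℝ) → (Fin k → ℝ)} (h : AnalyticAt ℝ π 0)
    (h0 : π 0 = 0) : Tendsto π (𝓝 0) (𝓝 0) := by
  simpa [h0] using h.continuousAt.tendsto

/-- The inductive step: a Weierstrass-type expansion without subleading term. -/
theorem cov_weierstrass (hM : MonoCov n) {d : ℕ}
    (ih : ∀ e < d + 1, ∀ h : (Fin (n + 1) → ℝ) → ℝ, Reg e h →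
      Cov fun π J => Mono (fun w => h (π w)) ∧ (∀ i : Fin n, Mono fun w => π w i.succ) ∧ Mono J)
    {h U : (Fin (n + 1) → ℝ) → ℝ} {a : ℕ → (Fin n → ℝ) → ℝ} (ha : ∀ i, AnalyticAt ℝ (a i) 0)
    (ha0 : ∀ i < d + 1, a i 0 = 0) (had : ∀ᶠ v in 𝓝 0, a d v = 0) (hU : AnalyticAt ℝ U 0)
    (hU0 : U 0 ≠ 0) (he : ∀ᶠ w in 𝓝 0,
      h w = ∑ i ∈ Finset.range (d + 1), a i (Fin.tail w) * w 0 ^ i + w 0 ^ (d + 1) * U w) :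
    Cov fun π J => Mono (fun w => h (π w)) ∧ (∀ i : Fin n, Mono fun w => π w i.succ) ∧ Mono J := by
  set D := d + 1 with hD
  by_cases hz : ∀ i < D, ∀ᶠ v in 𝓝 0, a i v = 0
  · refine Cov.id ⟨?_, fun i => Mono.coord _, Mono.const one_ne_zero⟩
    refine (((Mono.coord 0).pow D).mul (Mono.unit hU hU0)).congr ?_
    have hall : ∀ᶠ v in 𝓝 0, ∀ i ∈ Finset.range D, a i v = 0 :=
      (Finset.range D).eventually_all.mpr fun i hi => hz i (Finset.mem_range.mp hi)
    filter_upwards [he, tendsto_tail.eventually hall] with w h1 h2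
    rw [h1, Finset.sum_eq_zero fun i hi => by rw [h2 i hi, zero_mul], zero_add]
  let p : ℕ → ℕ := fun i => D.factorial / (D - i)
  have hpD : ∀ i < D, p i * (D - i) = D.factorial := fun i hi =>
    Nat.div_mul_cancel (Nat.dvd_factorial (by omega) (by omega))
  have hp : ∀ i < D, 0 < p i := fun i hi => Nat.pos_of_ne_zero fun h0 => by
    have := hpD i hi
    rw [h0, zero_mul] at this
    exact (Nat.factorial_pos D).ne this
  have hpq : ∀ i < D, (D - i) * (2 * p i) = 2 * D.factorial := fun i hi => by
    rw [← hpD i hi]; ring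
  have hS : AnalyticAt ℝ (fun v => ∑ i ∈ Finset.range D, a i v ^ (2 * p i)) 0 :=
    Finset.analyticAt_fun_sum _ fun i _ => (ha i).pow _
  have nS : NZ fun v => ∑ i ∈ Finset.range D, a i v ^ (2 * p i) := by
    intro h0
    refine hz fun i hi => h0.mono fun v hv => ?_
    rw [Finset.sum_eq_zero_iff_of_nonneg fun j _ => (even_two_mul _).pow_nonneg _] at hv
    exact eq_zero_of_pow_eq_zero (hv i (Finset.mem_range.mpr hi))
  have hq2 : 2 ≤ 2 * D.factorial := by have := Nat.factorial_pos D; omega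
  have base := (hM.ramified hS nS (even_two_mul _) hq2).chart
  refine Cov.bind (Cov.lift (Q' := fun π J => ∃ τ r, ((Mono r ∧ (∀ i, Mono fun w => τ w i) ∧
    ∃ (γ : Fin n → ℕ) (W : (Fin n → ℝ) → ℝ), AnalyticAt ℝ W 0 ∧ W 0 ≠ 0 ∧ ∀ᶠ w in 𝓝 0,
      ∑ i ∈ Finset.range D, a i (τ w) ^ (2 * p i) = mon ((2 * D.factorial) • γ) w * W w) ∧
    IsChart τ r) ∧ (π = fun w => Fin.cons (w 0) (τ (Fin.tail w))) ∧ J = fun w => r (Fin.tail w))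
    base fun τ r h => ⟨τ, r, h, rfl, rfl⟩) ?_
  rintro _ _ ⟨τ, r, ⟨⟨hr, hτ, γ, W, hW, hW0, hS'⟩, hc⟩, rfl, rfl⟩ -
  obtain ⟨b, hb, hab, i₀, hi₀, hbi₀⟩ := exists_quotients (a := fun i w => a i (τ w))
    (fun i => hc.comp_analyticAt (ha i)) hp hpq hW hW0 hS'
  have hbd : b d 0 = 0 := by
    have := ((NZ.of_mon γ).pow (D - d)).cancel ((analyticAt_mon γ 0).pow _) (hb d)
      (analyticAt_const (v := (0 : ℝ))) (by
        filter_upwards [hab d (by omega), hc.tendsto.eventually had] with w h1 h2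
        rw [mul_zero, ← h1, h2])
    exact this.self_of_nhds
  have hγ : γ ≠ 0 := by
    rintro rfl
    have := (hab i₀ hi₀).self_of_nhds
    rw [hc.zero, ha0 i₀ hi₀, mon_zero, one_pow, one_mul] at this
    exact hbi₀ this.symm
  have hall : ∀ᶠ w in 𝓝 0, ∀ i ∈ Finset.range D, a i (τ w) = mon γ w ^ (D - i) * b i w :=
    (Finset.range D).eventually_all.mpr fun i hi => hab i (Finset.mem_range.mp hi)
  let P : (Fin (n + 1) → ℝ) → (Fin (n + 1) → ℝ) := fun w => Fin.cons (w 0) (τ (Fin.tail w))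
  have hP : AnalyticAt ℝ P 0 := analyticAt_cons (analyticAt_coord 0 0)
    (AnalyticAt.fun_comp (g := τ) hc.analyticAt (analyticAt_tail 0))
  have hP0 : P 0 = 0 := by
    simp only [P, Pi.zero_apply, tail_zero, hc.zero, cons_zero_zero]
  have hexp : ∀ᶠ w in 𝓝 0, h (P w) = ∑ i ∈ Finset.range D,
      mon γ (Fin.tail w) ^ (D - i) * b i (Fin.tail w) * w 0 ^ i + w 0 ^ D * U (P w) := by
    filter_upwards [(tendsto_comp_zero hP hP0).eventually he, tendsto_tail.eventually hall]
      with w h1 h2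
    rw [h1]
    simp only [P, Fin.tail_cons, Fin.cons_zero]
    congr 1
    exact Finset.sum_congr rfl fun i hi => by rw [h2 i hi]
  refine (cov_toric γ).bind fun ψ J hψ hcψ => ?_
  rcases hψ with ⟨y, hy⟩ | ⟨hJ, hψ, c, hca, hc0, hce⟩
  · -- coordinate `0` is divisible by the monomial
    have htail : ∀ w, Fin.tail (ψ w) = Fin.tail w := fun w => by rw [(hy w).1, Fin.tail_cons]
    have hψ0 : ∀ w, ψ w 0 = mon γ (Fin.tail w) * (y + w 0) := fun w => by
      rw [(hy w).1, Fin.cons_zero]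
    obtain ⟨e, heD, g, hg, hg0, hge⟩ := poly_order (b := fun i => b i 0) (U := U 0) hbd hi₀ hbi₀ y
    let h' : (Fin (n + 1) → ℝ) → ℝ := fun w =>
      ∑ i ∈ Finset.range D, b i (Fin.tail w) * (y + w 0) ^ i + U (P (ψ w)) * (y + w 0) ^ D
    have hUa : AnalyticAt ℝ (fun w => U (P (ψ w))) 0 :=
      hcψ.comp_analyticAt (u := fun w => U (P w)) (AnalyticAt.fun_comp (by rwa [hP0]) hP)
    have hy' : AnalyticAt ℝ (fun w : Fin (n + 1) → ℝ => y + w 0) 0 :=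
      analyticAt_const.add (analyticAt_coord 0 0)
    have hreg : Reg e h' := by
      refine ⟨(Finset.analyticAt_fun_sum _ fun i _ =>
        (analyticAt_comp_tail (hb i)).mul (hy'.pow i)).add (hUa.mul (hy'.pow D)),
        g, hg, hg0, Eventually.of_forall fun t => ?_⟩
      rw [← hge t]
      have h1 : ψ (Fin.cons t 0) = 0 := by
        rw [(hy _).1, Fin.tail_cons, mon_zero_eq_zero hγ, zero_mul, cons_zero_zero]
      simp only [h', Fin.tail_cons, Fin.cons_zero, h1, hP0]
      rfl
    have hfac : ∀ᶠ w in 𝓝 0, h (P (ψ w)) = mon γ (Fin.tail w) ^ D * h' w := by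
      filter_upwards [hcψ.tendsto.eventually hexp] with w hw
      rw [hw, htail, hψ0]
      simp only [h']
      rw [mul_add (mon γ (Fin.tail w) ^ D), Finset.mul_sum]
      congr 1
      · refine Finset.sum_congr rfl fun i hi => ?_
        rw [mul_pow]
        have : D = (D - i) + i := by have := Finset.mem_range.mp hi; omega
        conv_rhs => rw [this, pow_add]
        ring_nf
      · rw [mul_pow]; ring
    refine (ih e heD h' hreg).chart.mono fun σ s ⟨⟨h1, h2, h3⟩, hcσ⟩ => ?_
    have htσ : (fun w => (Fin.tail (σ w) : Fin n → ℝ)) 0 = 0 := by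
      beta_reduce; rw [hcσ.zero, tail_zero]
    have hmon : Mono fun w => mon γ (Fin.tail (σ w)) := (Mono.of_mon γ).comp h2 htσ
    refine ⟨?_, fun i => ?_, ?_⟩
    · exact ((hmon.pow D).mul h1).congr (hcσ.tendsto.eventually hfac)
    · simp only [Fin.cons_succ, htail]
      exact (hτ i).comp h2 htσ
    · simp only [htail, (hy _).2]
      exact (hr.comp h2 htσ).mul (hmon.mul h3)
  · -- the monomial is divisible by coordinate `0`
    have htψ : (fun w => (Fin.tail (ψ w) : Fin n → ℝ)) 0 = 0 := by
      beta_reduce; rw [hcψ.zero, tail_zero]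
    refine Cov.id ⟨?_, fun i => ?_, ?_⟩
    · let V : (Fin (n + 1) → ℝ) → ℝ := fun w =>
        ∑ i ∈ Finset.range D, c w ^ (D - i) * b i (Fin.tail (ψ w)) + U (P (ψ w))
      have hUa : AnalyticAt ℝ (fun w => U (P (ψ w))) 0 :=
        hcψ.comp_analyticAt (u := fun w => U (P w)) (AnalyticAt.fun_comp (by rwa [hP0]) hP)
      have hV : AnalyticAt ℝ V 0 := (Finset.analyticAt_fun_sum _ fun i _ =>
        (hca.pow _).mul (hcψ.comp_analyticAt (u := fun w => b i (Fin.tail w))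
          (analyticAt_comp_tail (hb i)))).add hUa
      have hV0 : V 0 ≠ 0 := by
        simp only [V, hc0, hcψ.zero, hP0]
        rw [Finset.sum_eq_zero fun i hi => ?_, zero_add]
        · exact hU0
        · have := Finset.mem_range.mp hi
          rw [zero_pow (by omega), zero_mul]
      refine (((hψ 0).pow D).mul (Mono.unit hV hV0)).congr ?_
      filter_upwards [hcψ.tendsto.eventually hexp, hce] with w h1 h2
      refine h1.trans ?_
      simp only [V]
      rw [h2, mul_add, Finset.mul_sum]
      congr 1
      refine Finset.sum_congr rfl fun i hi => ?_
      have : D = (D - i) + i := by have := Finset.mem_range.mp hi; omega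
      conv_rhs => rw [this, pow_add]
      rw [← this]
      ring
    · simp only [Fin.cons_succ]
      exact (hτ i).comp (fun j => hψ j.succ) htψ
    · simp only [mul_one]
      exact (hr.comp (fun j => hψ j.succ) htψ).mul hJ

theorem cov_reg (hM : MonoCov n) (d : ℕ) : ∀ h : (Fin (n + 1) → ℝ) → ℝ, Reg d h →
    Cov fun π J => Mono (fun w => h (π w)) ∧ (∀ i : Fin n, Mono fun w => π w i.succ) ∧ Mono J := by
  induction d using Nat.strong_induction_on with
  | _ d ih =>
  intro h hr
  cases d with
  | zero =>
    refine Cov.id ⟨Mono.unit hr.1 ?_, fun i => Mono.coord _, Mono.const one_ne_zero⟩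
    obtain ⟨_, g, _, hg0, hgt⟩ := hr
    have := hgt.self_of_nhds
    rw [cons_zero_zero, pow_zero, one_mul] at this
    rwa [this]
  | succ d =>
    obtain ⟨θ, a, U, hθ, ha, hU, ha0, had, hU0, he⟩ := exists_tschirnhaus hr
    refine Cov.shear 0 θ hθ ((cov_weierstrass hM ih ha ha0 had hU hU0 he).mono ?_)
    rintro σ r ⟨h1, h2, h3⟩
    refine ⟨h1, fun i => ?_, h3⟩
    simpa [shear] using h2 i

theorem exists_reg_linShear {u : (Fin (n + 1) → ℝ) → ℝ} (hu : AnalyticAt ℝ u 0) (nu : NZ u) :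
    ∃ (c : Fin n → ℝ) (d : ℕ), Reg d fun w => u (linShear c w) := by
  obtain ⟨ρ, hρ, hua⟩ := hu.exists_ball
  have hz := NZ.mul hu (analyticAt_coord 0 0) nu (NZ.coord 0)
  obtain ⟨x, hx, hux⟩ : ∃ x ∈ Metric.ball (0 : Fin (n + 1) → ℝ) ρ, u x * x 0 ≠ 0 := by
    by_contra hcon
    push Not at hcon
    exact hz (Filter.eventually_of_mem (Metric.ball_mem_nhds _ hρ) hcon)
  have hx0 : x 0 ≠ 0 := right_ne_zero_of_mul hux
  have hu0 : u x ≠ 0 := left_ne_zero_of_mul hux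
  let e : Fin (n + 1) → ℝ := (x 0)⁻¹ • x
  let φ : ℝ → ℝ := fun t => u (t • e)
  have hφx : φ (x 0) ≠ 0 := by
    simp only [φ, e, smul_smul, mul_inv_cancel₀ hx0, one_smul]; exact hu0
  have hline : ∀ t, AnalyticAt ℝ (fun t : ℝ => t • e) t := fun t => by fun_prop
  have hφa : AnalyticOnNhd ℝ φ {t | t • e ∈ Metric.ball (0 : Fin (n + 1) → ℝ) ρ} :=
    fun t ht => AnalyticAt.fun_comp (hua _ ht) (hline t)
  have hconv : Convex ℝ {t : ℝ | t • e ∈ Metric.ball (0 : Fin (n + 1) → ℝ) ρ} :=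
    (convex_ball _ _).is_linear_preimage (f := fun t : ℝ => t • e)
      ⟨fun a b => add_smul _ _ _, fun a b => smul_assoc _ _ _⟩
  have h0mem : (0 : ℝ) ∈ {t : ℝ | t • e ∈ Metric.ball (0 : Fin (n + 1) → ℝ) ρ} := by
    simpa using hρ
  have hxmem : x 0 ∈ {t : ℝ | t • e ∈ Metric.ball (0 : Fin (n + 1) → ℝ) ρ} := by
    simpa only [Set.mem_ofPred_eq, e, smul_smul, mul_inv_cancel₀ hx0, one_smul] using hx
  have hnz : ¬ ∀ᶠ t in 𝓝 (0 : ℝ), φ t = 0 := fun hcon =>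
    hφx (hφa.eqOn_zero_of_preconnected_of_eventuallyEq_zero hconv.isPreconnected h0mem hcon hxmem)
  obtain ⟨d, g, hg, hg0, hge⟩ :=
    (hφa 0 h0mem).exists_eventuallyEq_pow_smul_nonzero_iff.mpr hnz
  refine ⟨fun j => x j.succ / x 0, d, ?_, g, hg, hg0, ?_⟩
  · refine AnalyticAt.fun_comp (g := u) ?_ (analyticAt_cons (analyticAt_coord 0 0)
      (AnalyticAt.pi fun j => (analyticAt_coord _ 0).add
        (analyticAt_const.mul (analyticAt_coord 0 0))))
    convert hu using 1
    ext j
    refine Fin.cases ?_ (fun i => ?_) j <;> simp [linShear]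
  · filter_upwards [hge] with t ht
    rw [sub_zero, smul_eq_mul] at ht
    rw [← ht]
    simp only [φ]
    congr 1
    ext j
    refine Fin.cases ?_ (fun i => ?_) j
    · simp [linShear, e, hx0]
    · simp [linShear, e]; ring

theorem monoCov (n : ℕ) : MonoCov n := by
  induction n with
  | zero =>
    intro u hu nu
    refine Cov.id ⟨Mono.unit hu fun h0 => nu (Eventually.of_forall fun w => ?_),
      Mono.const one_ne_zero⟩
    rw [Subsingleton.elim w 0, h0]
  | succ n ih =>
    intro u hu nu
    obtain ⟨c, d, hr⟩ := exists_reg_linShear hu nu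
    exact Cov.linShear c ((cov_reg ih d _ hr).mono fun π J h => ⟨h.1, h.2.2⟩)

end OscDecay

namespace OscDecay

open Filter Topology MeasureTheory

variable {n : ℕ} {ι : Type*}

/-- On the finite set `s`, the germs `g j` are linear combinations of a chain of at most `#s`
monomials (times units) with strictly increasing exponents. -/
def ChainData (s : Finset ι) (g : ι → (Fin n → ℝ) → ℝ) : Prop :=
  ∃ (K : ℕ) (β : ℕ → Fin n → ℕ) (U : ℕ → (Fin n → ℝ) → ℝ) (T : ℕ → ι → ℝ),
    K ≤ s.card ∧ (∀ k < K, AnalyticAt ℝ (U k) 0 ∧ U k 0 ≠ 0 ∧ 0 < ∑ i, β k i) ∧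
    (∀ k l, k < l → l < K → (∀ i, β k i ≤ β l i) ∧ ∑ i, β k i < ∑ i, β l i) ∧
    ∀ j ∈ s, ∀ᶠ w in 𝓝 0, g j w = ∑ k ∈ Finset.range K, T k j * (mon (β k) w * U k w)

theorem exists_common_quotients {s : Finset ι} {g : ι → (Fin n → ℝ) → ℝ}
    (hg : ∀ j ∈ s, AnalyticAt ℝ (g j) 0) {γ : Fin n → ℕ} {W : (Fin n → ℝ) → ℝ}
    (hW : AnalyticAt ℝ W 0) (hW0 : W 0 ≠ 0)
    (h : ∀ᶠ w in 𝓝 0, ∑ j ∈ s, g j w ^ 2 = mon (2 • γ) w * W w) :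
    ∃ b : ι → (Fin n → ℝ) → ℝ, (∀ j, AnalyticAt ℝ (b j) 0) ∧
      (∀ j ∈ s, ∀ᶠ w in 𝓝 0, g j w = mon γ w * b j w) ∧ ∃ j ∈ s, b j 0 ≠ 0 := by
  classical
  set C := |W 0| + 1
  have hC : 1 ≤ C := by simp [C]
  have hWC : ∀ᶠ w in 𝓝 0, |W w| < C :=
    hW.continuousAt.abs.tendsto.eventually (gt_mem_nhds (by simp [C]))
  have key : ∀ j, ∃ b : (Fin n → ℝ) → ℝ, AnalyticAt ℝ b 0 ∧
      (j ∈ s → ∀ᶠ w in 𝓝 0, g j w = mon γ w * b w) := by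
    intro j
    by_cases hj : j ∈ s
    · obtain ⟨b, hb, he⟩ := exists_div_mon (α := γ) (hg j hj) (C := C) (by
        filter_upwards [h, hWC] with w h1 h2
        refine le_of_pow_le_pow_left₀ two_ne_zero (by positivity) ?_
        calc |g j w| ^ 2 = g j w ^ 2 := sq_abs _
          _ ≤ ∑ j ∈ s, g j w ^ 2 :=
            Finset.single_le_sum (f := fun j => g j w ^ 2) (fun i _ => sq_nonneg _) hj
          _ ≤ |mon (2 • γ) w * W w| := h1 ▸ le_abs_self _
          _ = |mon γ w| ^ 2 * |W w| := by rw [abs_mul, mon_smul, abs_pow]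
          _ ≤ |mon γ w| ^ 2 * C ^ 2 := by
            gcongr
            exact h2.le.trans (le_self_pow₀ hC two_ne_zero)
          _ = _ := by rw [← mul_pow, mul_comm])
      exact ⟨b, hb, fun _ => he⟩
    · exact ⟨fun _ => 0, analyticAt_const, fun h => absurd h hj⟩
  choose b hb hab using key
  refine ⟨b, hb, hab, ?_⟩
  have hall : ∀ᶠ w in 𝓝 0, ∀ j ∈ s, g j w = mon γ w * b j w :=
    s.eventually_all.mpr fun j hj => hab j hj
  have hcancel := (NZ.of_mon (2 • γ)).cancel (analyticAt_mon _ 0)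
    (Finset.analyticAt_fun_sum s fun i _ => (hb i).pow 2) hW (by
    filter_upwards [h, hall] with w h1 h2
    rw [← h1, Finset.mul_sum]
    refine Finset.sum_congr rfl fun j hj => ?_
    rw [h2 j hj, mul_pow, mon_smul, Pi.pow_apply])
  have h0 := hcancel.self_of_nhds
  by_contra hcon
  push Not at hcon
  refine hW0 (h0 ▸ Finset.sum_eq_zero fun j hj => ?_)
  rw [Pi.pow_apply, hcon j hj, zero_pow two_ne_zero]

theorem Mono.sum_pos {α : Fin n → ℕ} {u U : (Fin n → ℝ) → ℝ} (h0 : u 0 = 0) (hU : U 0 ≠ 0)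
    (h : ∀ᶠ w in 𝓝 0, u w = mon α w * U w) : 0 < ∑ i, α i := by
  rcases eq_or_ne α 0 with rfl | hα
  · exact absurd (by simpa [h0] using h.self_of_nhds.symm) hU
  · obtain ⟨i, hi⟩ := Function.ne_iff.mp hα
    exact Finset.sum_pos' (fun _ _ => Nat.zero_le _)
      ⟨i, Finset.mem_univ i, Nat.pos_of_ne_zero hi⟩

/-- Adding a new smallest monomial to a chain. -/
theorem ChainData.insert [DecidableEq ι] {s : Finset ι} {j₀ : ι} (hj₀ : j₀ ∈ s)
    {g r : ι → (Fin n → ℝ) → ℝ}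
    (h : ChainData (s.erase j₀) r) {m v : (Fin n → ℝ) → ℝ} (hm : Mono m) (hm0 : m 0 = 0)
    (hv : AnalyticAt ℝ v 0) (hv0 : v 0 ≠ 0) {t : ι → ℝ}
    (hj : ∀ᶠ w in 𝓝 0, g j₀ w = m w * v w)
    (hg : ∀ j ∈ s.erase j₀, ∀ᶠ w in 𝓝 0, g j w = m w * (t j * v w + r j w)) :
    ChainData s g := by
  obtain ⟨K, β, U, T, hK, hU, hβ, hr⟩ := h
  obtain ⟨α, V, hV, hV0, hmV⟩ := hm
  have hα := Mono.sum_pos hm0 hV0 hmV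
  refine ⟨K + 1, fun k => k.casesOn α fun k => α + β k,
    fun k => k.casesOn (fun w => V w * v w) fun k w => V w * U k w,
    fun k j => k.casesOn (if j = j₀ then 1 else t j) fun k => if j = j₀ then 0 else T k j,
    ?_, ?_, ?_, ?_⟩
  · rw [Finset.card_erase_of_mem hj₀] at hK
    have := Finset.card_pos.mpr ⟨j₀, hj₀⟩
    omega
  · rintro (_ | k) hk
    · exact ⟨hV.mul hv, mul_ne_zero hV0 hv0, hα⟩
    · obtain ⟨h1, h2, h3⟩ := hU k (by omega)
      refine ⟨hV.mul h1, mul_ne_zero hV0 h2, ?_⟩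
      simp only [Pi.add_apply, Finset.sum_add_distrib]
      omega
  · rintro (_ | k) (_ | l) hkl hl
    · omega
    · obtain ⟨h1, h2, h3⟩ := hU l (by omega)
      refine ⟨fun i => by simp, ?_⟩
      change ∑ i, α i < ∑ i, (α + β l) i
      simp only [Pi.add_apply, Finset.sum_add_distrib]
      omega
    · omega
    · obtain ⟨h1, h2⟩ := hβ k l (by omega) (by omega)
      refine ⟨fun i => by simpa using h1 i, ?_⟩
      simp only [Pi.add_apply, Finset.sum_add_distrib]
      omega
  · intro j hjs
    simp only [Finset.sum_range_succ']
    by_cases hjj : j = j₀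
    · subst hjj
      filter_upwards [hj, hmV] with w h1 h2
      rw [h1, h2]
      simp [mul_assoc]
    · have hjs' := Finset.mem_erase.mpr ⟨hjj, hjs⟩
      filter_upwards [hg j hjs', hr j hjs', hmV] with w h1 h2 h3
      rw [h1, h2, h3]
      simp only [hjj, if_false, mon_add, mul_add, Finset.mul_sum]
      rw [add_comm]
      congr 1
      · exact Finset.sum_congr rfl fun k _ => by ring
      · change _ = t j * (mon α w * (V w * v w))
        ring

theorem cov_chain (s : Finset ι) (g : ι → (Fin n → ℝ) → ℝ) (hg : ∀ j ∈ s, AnalyticAt ℝ (g j) 0)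
    (hg0 : ∀ j ∈ s, g j 0 = 0) :
    Cov fun π J => Mono J ∧ (∀ i, Mono fun w => π w i) ∧ ChainData s fun j w => g j (π w) := by
  classical
  induction hc : s.card generalizing s g with
  | zero =>
    obtain rfl := Finset.card_eq_zero.mp hc
    exact Cov.id ⟨Mono.const one_ne_zero, Mono.coord, 0, 0, fun _ _ => 0, fun _ _ => 0,
      by simp, by simp, by simp, by simp⟩
  | succ N ih =>
    have hu : AnalyticAt ℝ (fun w => ∑ j ∈ s, g j w ^ 2) 0 :=
      Finset.analyticAt_fun_sum s fun j hj => (hg j hj).pow 2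
    by_cases hz : ∀ᶠ w in 𝓝 0, ∑ j ∈ s, g j w ^ 2 = 0
    · refine Cov.id ⟨Mono.const one_ne_zero, Mono.coord, 0, 0, fun _ _ => 0, fun _ _ => 0,
        by simp, by simp, by simp, fun j hj => ?_⟩
      filter_upwards [hz] with w hw
      have := (Finset.sum_eq_zero_iff_of_nonneg fun j _ => sq_nonneg (g j w)).mp hw j hj
      simpa using this
    refine ((monoCov n).ramified hu hz even_two le_rfl).bind
      fun π J ⟨hJ, hπ, γ, W, hW, hW0, he⟩ hcπ => ?_
    obtain ⟨b, hb, hgb, j₀, hj₀, hbj⟩ := exists_common_quotients (s := s)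
      (g := fun j w => g j (π w)) (fun j hj => hcπ.comp_analyticAt (hg j hj)) hW hW0 he
    have hm0 : mon γ (0 : Fin n → ℝ) = 0 := by
      have := (hgb j₀ hj₀).self_of_nhds
      rw [hcπ.zero, hg0 j₀ hj₀, zero_eq_mul] at this
      exact this.resolve_right hbj
    refine (ih (s.erase j₀) (fun j w => b j w - b j 0 / b j₀ 0 * b j₀ w)
      (fun j _ => (hb j).sub (analyticAt_const.mul (hb j₀))) (fun j _ => by field_simp; ring)
      (by rw [Finset.card_erase_of_mem hj₀, hc]; rfl)).chart.mono
      fun σ r ⟨⟨h1, h2, h3⟩, hcσ⟩ => ?_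
    refine ⟨(hJ.comp h2 hcσ.zero).mul h1, fun i => (hπ i).comp h2 hcσ.zero, ?_⟩
    refine h3.insert hj₀ (m := fun w => mon γ (σ w)) (v := fun w => b j₀ (σ w))
      (t := fun j => b j 0 / b j₀ 0) ((Mono.of_mon γ).comp h2 hcσ.zero)
      (by rw [hcσ.zero, hm0]) (hcσ.comp_analyticAt (hb j₀))
      (by rwa [hcσ.zero]) (hcσ.tendsto.eventually (hgb j₀ hj₀)) fun j hj => ?_
    filter_upwards [hcσ.tendsto.eventually (hgb j (Finset.mem_of_mem_erase hj))] with w hw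
    rw [hw]
    ring

end OscDecay

namespace OscDecay

open Filter Topology MeasureTheory Set

/-- An oscillatory integral on `[a, b]` with amplitude `A` and phase `q 0`, where `q i` is the
`i`-th derivative of the phase. -/
structure OscData (a b α : ℝ) (A A' : ℝ → ℝ) (q : ℕ → ℝ → ℝ) : Prop where
  le : a ≤ b
  len : b ≤ a + 1
  amp : ∀ s ∈ Icc a b, HasDerivAt A (A' s) s
  cont : ContinuousOn A' (Icc a b)
  bound : ∀ s ∈ Icc a b, |A s| ≤ α
  bound' : ∀ s ∈ Icc a b, |A' s| ≤ α
  phase : ∀ i, ∀ s ∈ Icc a b, HasDerivAt (q i) (q (i + 1) s) s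

variable {a b c d α : ℝ} {A A' : ℝ → ℝ} {q : ℕ → ℝ → ℝ}

theorem OscData.sub (h : OscData a b α A A' q) (hac : a ≤ c) (hcd : c ≤ d) (hdb : d ≤ b) :
    OscData c d α A A' q := by
  have hs : Icc c d ⊆ Icc a b := Icc_subset_Icc hac hdb
  exact ⟨hcd, by linarith [h.len], fun s m => h.amp s (hs m), h.cont.mono hs,
    fun s m => h.bound s (hs m), fun s m => h.bound' s (hs m), fun i s m => h.phase i s (hs m)⟩

theorem OscData.nonneg (h : OscData a b α A A' q) : 0 ≤ α :=
  (abs_nonneg _).trans (h.bound a ⟨le_rfl, h.le⟩)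

theorem OscData.contA (h : OscData a b α A A' q) : ContinuousOn A (Icc a b) :=
  fun s hs => (h.amp s hs).continuousAt.continuousWithinAt

theorem OscData.contq (h : OscData a b α A A' q) (i : ℕ) : ContinuousOn (q i) (Icc a b) :=
  fun s hs => (h.phase i s hs).continuousAt.continuousWithinAt

theorem OscData.contInt (h : OscData a b α A A' q) :
    ContinuousOn (fun s => (A s : ℂ) * Complex.exp (Complex.I * q 0 s)) (Icc a b) := by
  have h1 := Complex.continuous_ofReal.comp_continuousOn h.contA
  have h2 := Complex.continuous_ofReal.comp_continuousOn (h.contq 0)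
  exact h1.mul (Complex.continuous_exp.comp_continuousOn (continuousOn_const.mul h2))

theorem OscData.intervalIntegrable (h : OscData a b α A A' q) :
    IntervalIntegrable (fun s => (A s : ℂ) * Complex.exp (Complex.I * q 0 s)) volume a b := by
  refine ContinuousOn.intervalIntegrable ?_
  rw [uIcc_of_le h.le]
  exact h.contInt

theorem norm_osc (x y : ℝ) : ‖(x : ℂ) * Complex.exp (Complex.I * y)‖ = |x| := by
  rw [norm_mul, Complex.norm_real, Real.norm_eq_abs, mul_comm Complex.I,
    Complex.norm_exp_ofReal_mul_I, mul_one]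

theorem OscData.trivial_bound (h : OscData a b α A A' q) :
    ‖∫ s in a..b, (A s : ℂ) * Complex.exp (Complex.I * q 0 s)‖ ≤ α * (b - a) := by
  have := intervalIntegral.norm_integral_le_of_norm_le_const
    (f := fun s => (A s : ℂ) * Complex.exp (Complex.I * q 0 s)) (a := a) (b := b) (C := α)
    (fun s hs => by
      rw [uIoc_of_le h.le] at hs
      rw [norm_osc]
      exact h.bound s ⟨hs.1.le, hs.2⟩)
  rwa [abs_of_nonneg (sub_nonneg.mpr h.le)] at this

/-- The first derivative test. -/
theorem OscData.first (h : OscData a b α A A' q) {τ D : ℝ} (hτ : 0 < τ)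
    (h1 : ∀ s ∈ Icc a b, τ ≤ |q 1 s|) (h2 : ∫ s in a..b, |q 2 s| / q 1 s ^ 2 ≤ D / τ) :
    ‖∫ s in a..b, (A s : ℂ) * Complex.exp (Complex.I * q 0 s)‖ ≤ (3 + D) * α / τ := by
  have hα := h.nonneg
  have hq1 : ∀ s ∈ Icc a b, q 1 s ≠ 0 := fun s hs h0 => by
    have := h1 s hs; rw [h0, abs_zero] at this; linarith
  let R : ℝ → ℝ := fun s => A s / q 1 s
  let R' : ℝ → ℝ := fun s => (A' s * q 1 s - A s * q 2 s) / q 1 s ^ 2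
  have hR : ∀ s ∈ Icc a b, HasDerivAt R (R' s) s := fun s hs =>
    (h.amp s hs).div (h.phase 1 s hs) (hq1 s hs)
  have hR'c : ContinuousOn R' (Icc a b) :=
    ((h.cont.mul (h.contq 1)).sub (h.contA.mul (h.contq 2))).div ((h.contq 1).pow 2)
      fun s hs => pow_ne_zero 2 (hq1 s hs)
  let F : ℝ → ℂ := fun s => -Complex.I * ((R s : ℂ) * Complex.exp (Complex.I * q 0 s))
  let G : ℝ → ℂ := fun s => (R' s : ℂ) * Complex.exp (Complex.I * q 0 s)
  have hF : ∀ s ∈ Icc a b, HasDerivAt F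
      ((A s : ℂ) * Complex.exp (Complex.I * q 0 s) + -Complex.I * G s) s := by
    intro s hs
    have e1 := (hR s hs).ofReal_comp
    have e2 := (((h.phase 0 s hs).ofReal_comp).const_mul Complex.I).cexp
    have e3 := (e1.mul e2).const_mul (-Complex.I)
    refine e3.congr_deriv ?_
    have : (q 1 s : ℂ) ≠ 0 := by exact_mod_cast hq1 s hs
    simp only [G, R, zero_add, Complex.ofReal_div]
    field_simp
    ring_nf
    simp only [Complex.I_sq]
    ring
  have hGc : ContinuousOn G (Icc a b) := by
    have c1 := Complex.continuous_ofReal.comp_continuousOn hR'c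
    have c2 := Complex.continuous_ofReal.comp_continuousOn (h.contq 0)
    exact c1.mul (Complex.continuous_exp.comp_continuousOn (continuousOn_const.mul c2))
  have hGi : IntervalIntegrable (fun s => -Complex.I * G s) volume a b := by
    refine ContinuousOn.intervalIntegrable ?_
    rw [uIcc_of_le h.le]
    exact continuousOn_const.mul hGc
  have hFTC := intervalIntegral.integral_eq_sub_of_hasDerivAt (f := F) (a := a) (b := b)
    (by rw [uIcc_of_le h.le]; exact hF) (h.intervalIntegrable.add hGi)
  rw [intervalIntegral.integral_add h.intervalIntegrable hGi] at hFTC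
  have hFb : ∀ s ∈ Icc a b, ‖F s‖ ≤ α / τ := by
    intro s hs
    have : ‖F s‖ = |R s| := by
      simp only [F]
      rw [norm_mul, norm_osc, norm_neg, Complex.norm_I, one_mul]
    rw [this, abs_div]
    exact div_le_div₀ hα (h.bound s hs) hτ (h1 s hs)
  have hGb : ‖∫ s in a..b, -Complex.I * G s‖ ≤ (1 + D) * α / τ := by
    have hint : IntervalIntegrable (fun s => |q 2 s| / q 1 s ^ 2) volume a b := by
      refine ContinuousOn.intervalIntegrable ?_
      rw [uIcc_of_le h.le]
      exact (h.contq 2).abs.div ((h.contq 1).pow 2) fun s hs => pow_ne_zero 2 (hq1 s hs)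
    have hle := intervalIntegral.norm_integral_le_of_norm_le (f := fun s => -Complex.I * G s)
      (g := fun s => α / τ + α * (|q 2 s| / q 1 s ^ 2)) (μ := volume) h.le
      (Eventually.of_forall fun s hs => by
        have hs' : s ∈ Icc a b := ⟨hs.1.le, hs.2⟩
        rw [norm_mul, norm_neg, Complex.norm_I, one_mul]
        simp only [G]
        rw [norm_osc]
        have hq := hq1 s hs'
        have : R' s = A' s / q 1 s - A s * (q 2 s / q 1 s ^ 2) := by
          simp only [R']; field_simp
        rw [this]
        refine (abs_sub _ _).trans (add_le_add ?_ ?_)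
        · rw [abs_div]
          exact div_le_div₀ hα (h.bound' s hs') hτ (h1 s hs')
        · rw [abs_mul, abs_div, abs_pow, sq_abs]
          exact mul_le_mul_of_nonneg_right (h.bound s hs') (by positivity))
      (intervalIntegrable_const.add (hint.const_mul α))
    refine hle.trans ?_
    rw [intervalIntegral.integral_add intervalIntegrable_const (hint.const_mul α),
      intervalIntegral.integral_const, intervalIntegral.integral_const_mul, smul_eq_mul]
    have e1 : (b - a) * (α / τ) ≤ 1 * (α / τ) :=
      mul_le_mul_of_nonneg_right (by linarith [h.len]) (by positivity)
    have e2 := mul_le_mul_of_nonneg_left h2 hα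
    calc _ ≤ 1 * (α / τ) + α * (D / τ) := add_le_add e1 e2
      _ = _ := by ring
  have e : ∫ s in a..b, (A s : ℂ) * Complex.exp (Complex.I * q 0 s) =
      F b - F a - ∫ s in a..b, -Complex.I * G s := by rw [← hFTC]; ring
  rw [e]
  calc _ ≤ ‖F b‖ + ‖F a‖ + ‖∫ s in a..b, -Complex.I * G s‖ :=
        (norm_sub_le _ _).trans (add_le_add_left (norm_sub_le _ _) _)
    _ ≤ α / τ + α / τ + (1 + D) * α / τ :=
        add_le_add (add_le_add (hFb b ⟨h.le, le_rfl⟩) (hFb a ⟨le_rfl, h.le⟩)) hGb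
    _ = _ := by ring

end OscDecay

namespace OscDecay

open Filter Topology MeasureTheory Set

variable {a b c d α : ℝ} {A A' : ℝ → ℝ} {q : ℕ → ℝ → ℝ}

theorem sign_of_ne_zero {g : ℝ → ℝ} (hg : ContinuousOn g (Icc a b)) (h0 : ∀ s ∈ Icc a b, g s ≠ 0) :
    (∀ s ∈ Icc a b, 0 < g s) ∨ ∀ s ∈ Icc a b, g s < 0 := by
  by_contra! ⟨⟨x, hx, hx0⟩, y, hy, hy0⟩
  obtain ⟨z, hz, hz0⟩ := isPreconnected_Icc.intermediate_value hx hy hg ⟨hx0, hy0⟩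
  exact h0 z hz hz0

theorem OscData.first_of_le (h : OscData a b α A A' q) {τ D : ℝ} (hτ : 0 < τ) (hD : 0 ≤ D)
    (h1 : ∀ s ∈ Icc a b, τ ≤ |q 1 s|) (h2 : ∀ s ∈ Icc a b, |q 2 s| ≤ D * τ) :
    ‖∫ s in a..b, (A s : ℂ) * Complex.exp (Complex.I * q 0 s)‖ ≤ (3 + D) * α / τ := by
  refine h.first hτ h1 ?_
  have := intervalIntegral.norm_integral_le_of_norm_le_const
    (f := fun s => |q 2 s| / q 1 s ^ 2) (a := a) (b := b) (C := D / τ) (fun s hs => by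
      rw [uIoc_of_le h.le] at hs
      have hs' : s ∈ Icc a b := ⟨hs.1.le, hs.2⟩
      rw [Real.norm_of_nonneg (by positivity), ← sq_abs (q 1 s)]
      calc |q 2 s| / |q 1 s| ^ 2 ≤ D * τ / τ ^ 2 :=
            div_le_div₀ (by positivity) (h2 s hs') (by positivity)
              (pow_le_pow_left₀ hτ.le (h1 s hs') 2)
        _ = D / τ := by field_simp)
  refine (le_abs_self _).trans (this.trans ?_)
  rw [abs_of_nonneg (sub_nonneg.mpr h.le)]
  exact mul_le_of_le_one_right (by positivity) (by linarith [h.len])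

theorem OscData.first_of_sign (h : OscData a b α A A' q) {τ : ℝ} (hτ : 0 < τ)
    (h1 : ∀ s ∈ Icc a b, τ ≤ |q 1 s|)
    (h2 : (∀ s ∈ Icc a b, 0 < q 2 s) ∨ ∀ s ∈ Icc a b, q 2 s < 0) :
    ‖∫ s in a..b, (A s : ℂ) * Complex.exp (Complex.I * q 0 s)‖ ≤ 5 * α / τ := by
  have hq1 : ∀ s ∈ Icc a b, q 1 s ≠ 0 := fun s hs h0 => by
    have := h1 s hs; rw [h0, abs_zero] at this; linarith
  have key : |∫ s in a..b, q 2 s / q 1 s ^ 2| ≤ 2 / τ := by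
    have hd : ∀ s ∈ uIcc a b, HasDerivAt (fun s => -(q 1 s)⁻¹) (q 2 s / q 1 s ^ 2) s := by
      rw [uIcc_of_le h.le]
      intro s hs
      exact ((h.phase 1 s hs).inv (hq1 s hs)).neg.congr_deriv (by ring)
    rw [intervalIntegral.integral_eq_sub_of_hasDerivAt hd]
    · have hb : ∀ s ∈ Icc a b, |(q 1 s)⁻¹| ≤ 1 / τ := fun s hs => by
        rw [abs_inv, ← one_div]
        exact one_div_le_one_div_of_le hτ (h1 s hs)
      calc _ ≤ |-(q 1 b)⁻¹| + |-(q 1 a)⁻¹| := abs_sub _ _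
        _ ≤ 1 / τ + 1 / τ := by
          rw [abs_neg, abs_neg]
          exact add_le_add (hb b ⟨h.le, le_rfl⟩) (hb a ⟨le_rfl, h.le⟩)
        _ = _ := by ring
    · refine ContinuousOn.intervalIntegrable ?_
      rw [uIcc_of_le h.le]
      exact (h.contq 2).div ((h.contq 1).pow 2) fun s hs => pow_ne_zero 2 (hq1 s hs)
  have e : ∫ s in a..b, |q 2 s| / q 1 s ^ 2 = |∫ s in a..b, q 2 s / q 1 s ^ 2| := by
    rcases h2 with h2 | h2
    · rw [abs_of_nonneg (intervalIntegral.integral_nonneg h.le fun s hs =>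
        div_nonneg (h2 s hs).le (by positivity))]
      refine intervalIntegral.integral_congr fun s hs => ?_
      rw [uIcc_of_le h.le] at hs
      rw [abs_of_pos (h2 s hs)]
    · rw [← abs_neg, ← intervalIntegral.integral_neg,
        abs_of_nonneg (intervalIntegral.integral_nonneg h.le fun s hs => ?_)]
      · refine intervalIntegral.integral_congr fun s hs => ?_
        rw [uIcc_of_le h.le] at hs
        rw [abs_of_neg (h2 s hs), neg_div]
      · rw [← neg_div]
        exact div_nonneg (neg_nonneg.mpr (h2 s hs).le) (by positivity)
  convert h.first hτ h1 (D := 2) (e ▸ key) using 3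
  norm_num

theorem exists_abs_ge {g g' : ℝ → ℝ} {τ : ℝ} (hab : a ≤ b)
    (hg : ∀ s ∈ Icc a b, HasDerivAt g (g' s) s) (h : ∀ s ∈ Icc a b, τ ≤ |g' s|) :
    ∃ x₀ ∈ Icc a b, ∀ x ∈ Icc a b, τ * |x - x₀| ≤ |g x| := by
  have hc : ContinuousOn g (Icc a b) := fun s hs => (hg s hs).continuousAt.continuousWithinAt
  obtain ⟨x₀, hx₀, hmin⟩ := isCompact_Icc.exists_isMinOn ⟨a, ⟨le_rfl, hab⟩⟩ hc.abs
  have hlt : ∀ x ∈ Icc a b, ∀ y ∈ Icc a b, x < y → τ * |y - x| ≤ |g y - g x| := by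
    intro x hx y hy hxy
    have hs : Icc x y ⊆ Icc a b := Icc_subset_Icc hx.1 hy.2
    obtain ⟨z, hz, he⟩ := exists_hasDerivAt_eq_slope g g' hxy (hc.mono hs) fun z hz =>
      hg z (hs (Ioo_subset_Icc_self hz))
    have h0 : y - x ≠ 0 := (sub_pos.mpr hxy).ne'
    have : g y - g x = g' z * (y - x) := by rw [he]; field_simp
    rw [this, abs_mul]
    exact mul_le_mul_of_nonneg_right (h z (hs (Ioo_subset_Icc_self hz))) (abs_nonneg _)
  have hdist : ∀ x ∈ Icc a b, τ * |x - x₀| ≤ |g x - g x₀| := by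
    intro x hx
    rcases lt_trichotomy x x₀ with h' | h' | h'
    · rw [abs_sub_comm x, abs_sub_comm (g x)]; exact hlt x hx x₀ hx₀ h'
    · simp [h']
    · exact hlt x₀ hx₀ x hx h'
  refine ⟨x₀, hx₀, fun x hx => (hdist x hx).trans ?_⟩
  have hm : |g x₀| ≤ |g x| := hmin hx
  by_cases h0 : g x₀ = 0
  · rw [h0, sub_zero]
  · have hne : ∀ s ∈ Icc a b, g s ≠ 0 := fun s hs hs0 => h0 (by
      have : |g x₀| ≤ |g s| := hmin hs
      rwa [hs0, abs_zero, abs_nonpos_iff] at this)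
    rcases sign_of_ne_zero hc hne with hs | hs
    · rw [abs_of_pos (hs x hx), abs_of_pos (hs x₀ hx₀)] at hm
      rw [abs_of_nonneg (by linarith), abs_of_pos (hs x hx)]
      linarith [hs x₀ hx₀]
    · rw [abs_of_neg (hs x hx), abs_of_neg (hs x₀ hx₀)] at hm
      rw [abs_of_nonpos (by linarith), abs_of_neg (hs x hx)]
      linarith [hs x₀ hx₀]

/-- Splitting off a neighbourhood of a point. -/
theorem OscData.split (h : OscData a b α A A' q) {x₀ r B : ℝ} (hx₀ : x₀ ∈ Icc a b) (hr : 0 ≤ r)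
    (hB : 0 ≤ B)
    (hp : ∀ c d, a ≤ c → c ≤ d → d ≤ b → (∀ x ∈ Icc c d, r ≤ |x - x₀|) →
      ‖∫ s in c..d, (A s : ℂ) * Complex.exp (Complex.I * q 0 s)‖ ≤ B) :
    ‖∫ s in a..b, (A s : ℂ) * Complex.exp (Complex.I * q 0 s)‖ ≤ 2 * B + 2 * r * α := by
  have hα := h.nonneg
  set c := max a (x₀ - r)
  set d := min b (x₀ + r)
  have hac : a ≤ c := le_max_left _ _
  have hcx : c ≤ x₀ := max_le hx₀.1 (by linarith)
  have hxd : x₀ ≤ d := le_min hx₀.2 (by linarith)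
  have hdb : d ≤ b := min_le_left _ _
  have h1 := h.sub le_rfl hac ((hcx.trans hxd).trans hdb)
  have h2 := h.sub hac (hcx.trans hxd) hdb
  have h3 := h.sub (hac.trans (hcx.trans hxd)) hdb le_rfl
  have e1 : ‖∫ s in a..c, (A s : ℂ) * Complex.exp (Complex.I * q 0 s)‖ ≤ B := by
    rcases le_total (x₀ - r) a with h' | h'
    · rw [show c = a from max_eq_left h']; simpa using hB
    · refine hp a c le_rfl hac ((hcx.trans hxd).trans hdb) fun x hx => ?_
      have : x ≤ x₀ - r := hx.2.trans_eq (max_eq_right h')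
      rw [abs_of_nonpos (by linarith)]; linarith
  have e3 : ‖∫ s in d..b, (A s : ℂ) * Complex.exp (Complex.I * q 0 s)‖ ≤ B := by
    rcases le_total b (x₀ + r) with h' | h'
    · rw [show d = b from min_eq_left h']; simpa using hB
    · refine hp d b (hac.trans (hcx.trans hxd)) hdb le_rfl fun x hx => ?_
      have : x₀ + r ≤ x := (min_eq_right h').symm.trans_le hx.1
      rw [abs_of_nonneg (by linarith)]; linarith
  have e2 := h2.trivial_bound
  have hcd : α * (d - c) ≤ 2 * r * α := by
    have : d - c ≤ 2 * r := by
      have := min_le_right b (x₀ + r)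
      have := le_max_right a (x₀ - r)
      linarith
    nlinarith
  rw [← intervalIntegral.integral_add_adjacent_intervals h1.intervalIntegrable
    (h2.intervalIntegrable.trans h3.intervalIntegrable),
    ← intervalIntegral.integral_add_adjacent_intervals h2.intervalIntegrable h3.intervalIntegrable]
  refine (norm_add_le _ _).trans ?_
  have := norm_add_le (∫ s in c..d, (A s : ℂ) * Complex.exp (Complex.I * q 0 s))
    (∫ s in d..b, (A s : ℂ) * Complex.exp (Complex.I * q 0 s))
  linarith

/-- Van der Corput's lemma. -/
theorem exists_vdc (j : ℕ) : ∃ C : ℝ, 0 ≤ C ∧ ∀ {a b α : ℝ} {A A' : ℝ → ℝ} {q : ℕ → ℝ → ℝ},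
    OscData a b α A A' q → ∀ τ > 0, (∀ s ∈ Icc a b, τ ≤ |q (j + 1) s|) →
    (j = 0 → (∀ s ∈ Icc a b, 0 < q 2 s) ∨ ∀ s ∈ Icc a b, q 2 s < 0) →
    ‖∫ s in a..b, (A s : ℂ) * Complex.exp (Complex.I * q 0 s)‖ ≤ C * α * τ ^ (-(1 / (j + 1) : ℝ)) := by
  induction j with
  | zero =>
    refine ⟨5, by norm_num, fun h τ hτ h1 h2 => (h.first_of_sign hτ h1 (h2 rfl)).trans_eq ?_⟩
    norm_num [Real.rpow_neg_one, div_eq_mul_inv]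
  | succ j ih =>
    obtain ⟨C, hC, ih⟩ := ih
    refine ⟨2 * C + 2, by positivity, fun {a b α A A' q} h τ hτ h1 _ => ?_⟩
    have hα := h.nonneg
    obtain ⟨x₀, hx₀, hx⟩ := exists_abs_ge h.le (fun s hs => h.phase (j + 1) s hs) h1
    set p : ℝ := 1 / ((j + 1 : ℕ) + 1 : ℝ) with hp
    have hr : 0 < τ ^ (-p) := Real.rpow_pos_of_pos hτ _
    have hτr : (τ * τ ^ (-p)) ^ (-(1 / (j + 1) : ℝ)) = τ ^ (-p) := by
      rw [← Real.rpow_one_add' hτ.le, ← Real.rpow_mul hτ.le]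
      · congr 1
        rw [hp]
        push_cast
        field_simp
        ring
      · rw [hp]
        push_cast
        have : (j : ℝ) + 1 + 1 ≠ 0 := by positivity
        field_simp
        ring_nf
        positivity
    have := h.split hx₀ hr.le (B := C * α * τ ^ (-p)) (by positivity) fun c d hac hcd hdb hcx => by
      rw [← hτr]
      have hs : Icc c d ⊆ Icc a b := Icc_subset_Icc hac hdb
      refine ih (h.sub hac hcd hdb) _ (by positivity) (fun s m => ?_) fun hj => ?_
      · exact (mul_le_mul_of_nonneg_left (hcx s m) hτ.le).trans (hx s (hs m))
      · subst hj
        refine sign_of_ne_zero ((h.contq 2).mono hs) fun s m h0 => ?_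
        have := h1 s (hs m)
        rw [zero_add, one_add_one_eq_two, h0, abs_zero] at this
        linarith
    refine this.trans_eq ?_
    ring

end OscDecay

namespace OscDecay

open Filter Topology MeasureTheory Set

variable {a b c d α : ℝ} {A A' : ℝ → ℝ} {q : ℕ → ℝ → ℝ}

/-- The estimate on an interval where a single derivative of order at most `N` is large. -/
theorem exists_piece_bound (N : ℕ) {c D : ℝ} (hc : 0 < c) (hc1 : c ≤ 1) (hD : 0 ≤ D) :
    ∃ C : ℝ, 0 ≤ C ∧ ∀ {a b α : ℝ} {A A' : ℝ → ℝ} {q : ℕ → ℝ → ℝ},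
    OscData a b α A A' q → ∀ m : ℝ, 1 ≤ m → ∀ j < N, (∀ s ∈ Icc a b, c * m ≤ |q (j + 1) s|) →
    (∀ s ∈ Icc a b, |q 2 s| ≤ D * m) →
    ‖∫ s in a..b, (A s : ℂ) * Complex.exp (Complex.I * q 0 s)‖ ≤ C * α * m ^ (-(1 / N : ℝ)) := by
  choose V hV0 hV using exists_vdc
  refine ⟨(3 + D / c + ∑ j ∈ Finset.range N, V j) * c⁻¹,
    by have := Finset.sum_nonneg fun j (_ : j ∈ Finset.range N) => hV0 j; positivity,
    fun {a b α A A' q} h m hm j hj h1 h2 => ?_⟩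
  have hα := h.nonneg
  have hm0 : 0 < m := by linarith
  have hS := Finset.sum_nonneg fun j (_ : j ∈ Finset.range N) => hV0 j
  have hN : (0 : ℝ) < N := by exact_mod_cast (Nat.zero_le j).trans_lt hj
  have hjN : (j : ℝ) + 1 ≤ N := by exact_mod_cast hj
  have hj1 : 1 / ((j : ℝ) + 1) ≤ 1 := by
    rw [div_le_one (by positivity)]
    have : (0 : ℝ) ≤ j := by positivity
    linarith
  have hpow : (c * m) ^ (-(1 / (j + 1) : ℝ)) ≤ c⁻¹ * m ^ (-(1 / N : ℝ)) := by
    rw [Real.mul_rpow hc.le hm0.le, ← Real.rpow_neg_one c]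
    gcongr ?_ * ?_
    · exact Real.rpow_le_rpow_of_exponent_ge hc hc1 (by linarith)
    · exact Real.rpow_le_rpow_of_exponent_le hm
        (neg_le_neg (one_div_le_one_div_of_le (by positivity) hjN))
  have key : ∃ B : ℝ, 0 ≤ B ∧ B ≤ 3 + D / c + ∑ j ∈ Finset.range N, V j ∧
      ‖∫ s in a..b, (A s : ℂ) * Complex.exp (Complex.I * q 0 s)‖ ≤
        B * α * (c * m) ^ (-(1 / (j + 1) : ℝ)) := by
    rcases Nat.eq_zero_or_pos j with rfl | hj0
    · refine ⟨3 + D / c, by positivity, by linarith, ?_⟩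
      refine (h.first_of_le (τ := c * m) (D := D / c) (by positivity) (by positivity) h1
        fun s hs => (h2 s hs).trans_eq (by field_simp)).trans_eq ?_
      norm_num [Real.rpow_neg_one, div_eq_mul_inv]
    · refine ⟨V j, hV0 j, ?_, hV j h _ (by positivity) h1 fun h0 => absurd h0 hj0.ne'⟩
      have := Finset.single_le_sum (fun j _ => hV0 j) (Finset.mem_range.mpr hj)
      have : 0 ≤ D / c := by positivity
      linarith
  obtain ⟨B, hB0, hB, hle⟩ := key
  calc _ ≤ B * α * (c * m) ^ (-(1 / (j + 1) : ℝ)) := hle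
    _ ≤ (3 + D / c + ∑ j ∈ Finset.range N, V j) * α * (c⁻¹ * m ^ (-(1 / N : ℝ))) := by
      gcongr
    _ = _ := by ring

/-- An oscillatory integral whose phase has, at every point, a large derivative of order between
`1` and `N`. -/
theorem exists_osc_bound (N : ℕ) {c D : ℝ} (hc : 0 < c) (hD : 0 ≤ D) :
    ∃ C : ℝ, 0 ≤ C ∧ ∀ {α : ℝ} {A A' : ℝ → ℝ} {q : ℕ → ℝ → ℝ},
    OscData 0 1 α A A' q → ∀ m : ℝ, 0 ≤ m → (∀ s ∈ Icc (0 : ℝ) 1, ∃ j < N, c * m ≤ |q (j + 1) s|) →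
    (∀ s ∈ Icc (0 : ℝ) 1, ∀ j ≤ N, |q (j + 1) s| ≤ D * m) →
    ‖∫ s in (0 : ℝ)..1, (A s : ℂ) * Complex.exp (Complex.I * q 0 s)‖ ≤
      C * α * (1 + m) ^ (-(1 / N : ℝ)) := by
  set c' := min (c / 2) 1
  have hc' : 0 < c' := lt_min (by positivity) one_pos
  obtain ⟨C, hC, hpiece⟩ := exists_piece_bound N hc' (min_le_right _ _) hD
  set L : ℕ := ⌈2 * D / c⌉₊ + 1
  have hL : (0 : ℝ) < L := by positivity
  have hDL : D / L ≤ c / 2 := by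
    have : 2 * D / c ≤ L := by
      simp only [L]; push_cast; linarith [Nat.le_ceil (2 * D / c)]
    rw [div_le_iff₀ hc] at this
    rw [div_le_iff₀ hL]
    linarith
  refine ⟨2 * (1 + L * C), by positivity, fun {α A A' q} h m hm h1 h2 => ?_⟩
  have hα := h.nonneg
  have hN0 : 0 < N := by
    obtain ⟨j, hj, -⟩ := h1 0 ⟨le_rfl, zero_le_one⟩
    omega
  have hN : (0 : ℝ) < N := by exact_mod_cast hN0
  have hN1 : 1 / (N : ℝ) ≤ 1 := by
    rw [div_le_one hN]; exact_mod_cast hN0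
  -- compare powers
  have htwo : ∀ x : ℝ, 0 < x → 1 + m ≤ 2 * x →
      x ^ (-(1 / N : ℝ)) ≤ 2 * (1 + m) ^ (-(1 / N : ℝ)) := fun x hx hmx => by
    have e1 : (2 * x) ^ (-(1 / N : ℝ)) ≤ (1 + m) ^ (-(1 / N : ℝ)) :=
      Real.rpow_le_rpow_of_nonpos (by linarith) hmx (by simp)
    have e2 : (2 : ℝ) ^ (-1 : ℝ) ≤ 2 ^ (-(1 / N : ℝ)) :=
      Real.rpow_le_rpow_of_exponent_le one_le_two (by linarith)
    rw [Real.mul_rpow two_pos.le hx.le] at e1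
    rw [Real.rpow_neg_one] at e2
    have e3 := Real.rpow_pos_of_pos hx (-(1 / N : ℝ))
    nlinarith
  rcases le_total m 1 with hm1 | hm1
  · refine h.trivial_bound.trans ?_
    have := htwo 1 one_pos (by linarith)
    rw [Real.one_rpow] at this
    have hp : 0 ≤ (1 + m) ^ (-(1 / N : ℝ)) := Real.rpow_nonneg (by linarith) _
    calc α * (1 - 0) = 1 * α * 1 := by ring
      _ ≤ (1 + L * C) * α * (2 * (1 + m) ^ (-(1 / N : ℝ))) := by
        gcongr
        have : 0 ≤ L * C := by positivity
        linarith
      _ = _ := by ring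
  have hm0 : 0 < m := by linarith
  let p : ℕ → ℝ := fun i => i / L
  have hp0 : ∀ i, 0 ≤ p i := fun i => by positivity
  have hp1 : ∀ i ≤ L, p i ≤ 1 := fun i hi => by
    rw [div_le_one hL]; exact_mod_cast hi
  have hpp : ∀ i, p (i + 1) = p i + 1 / L := fun i => by simp only [p]; push_cast; ring
  have hple : ∀ i, p i ≤ p (i + 1) := fun i => by
    rw [hpp]; have : (0 : ℝ) ≤ 1 / L := by positivity
    linarith
  have hsub : ∀ i < L, OscData (p i) (p (i + 1)) α A A' q := fun i hi =>
    h.sub (hp0 i) (hple i) (hp1 _ hi)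
  have hsum := intervalIntegral.sum_integral_adjacent_intervals
    (f := fun s => (A s : ℂ) * Complex.exp (Complex.I * q 0 s)) (a := p) (n := L) (μ := volume)
    fun i hi => (hsub i hi).intervalIntegrable
  have hpL : p L = 1 := div_self hL.ne'
  have hpz : p 0 = 0 := by simp [p]
  rw [hpz, hpL] at hsum
  have hbd : ∀ i < L, ‖∫ s in p i..p (i + 1), (A s : ℂ) * Complex.exp (Complex.I * q 0 s)‖ ≤
      C * α * m ^ (-(1 / N : ℝ)) := by
    intro i hi
    have hs : Icc (p i) (p (i + 1)) ⊆ Icc 0 1 := Icc_subset_Icc (hp0 i) (hp1 _ hi)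
    have hi0 : p i ∈ Icc (p i) (p (i + 1)) := ⟨le_rfl, hple i⟩
    obtain ⟨j, hj, hcj⟩ := h1 (p i) (hs hi0)
    refine hpiece (hsub i hi) m hm1 j hj (fun s m' => ?_) fun s m' => h2 s (hs m') 1 hN0
    have := (convex_Icc (p i) (p (i + 1))).norm_image_sub_le_of_norm_hasDerivWithin_le
      (f := q (j + 1)) (C := D * m)
      (fun x hx => (h.phase (j + 1) x (hs hx)).hasDerivWithinAt)
      (fun x hx => h2 x (hs hx) (j + 1) hj) hi0 m'
    rw [Real.norm_eq_abs, Real.norm_eq_abs] at this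
    have hdist : |s - p i| ≤ 1 / L := by
      rw [abs_of_nonneg (by linarith [m'.1])]
      have := m'.2
      rw [hpp] at this
      linarith
    have e1 : |q (j + 1) s - q (j + 1) (p i)| ≤ c / 2 * m :=
      calc _ ≤ D * m * |s - p i| := this
        _ ≤ D * m * (1 / L) := by gcongr
        _ = D / L * m := by ring
        _ ≤ _ := by gcongr
    have e2 := abs_sub_abs_le_abs_sub (q (j + 1) (p i)) (q (j + 1) s)
    rw [abs_sub_comm] at e2
    have e3 : c' * m ≤ c / 2 * m := by gcongr; exact min_le_left _ _
    linarith
  rw [← hsum]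
  have hmp := htwo m hm0 (by linarith)
  have hp : 0 ≤ (1 + m) ^ (-(1 / N : ℝ)) := Real.rpow_nonneg (by linarith) _
  calc _ ≤ ∑ i ∈ Finset.range L, ‖∫ s in p i..p (i + 1),
          (A s : ℂ) * Complex.exp (Complex.I * q 0 s)‖ := norm_sum_le _ _
    _ ≤ ∑ i ∈ Finset.range L, C * α * m ^ (-(1 / N : ℝ)) :=
        Finset.sum_le_sum fun i hi => hbd i (Finset.mem_range.mp hi)
    _ = L * C * α * m ^ (-(1 / N : ℝ)) := by
        rw [Finset.sum_const, Finset.card_range, nsmul_eq_mul]; ring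
    _ ≤ (1 + L * C) * α * (2 * (1 + m) ^ (-(1 / N : ℝ))) := by
        gcongr
        linarith
    _ = _ := by ring

end OscDecay

namespace OscDecay

open Filter Topology MeasureTheory Set

variable {n : ℕ}

/-- The functions with `d^j/ds^j (e^{bs} U(e^s w)) = e^{bs} (eul b U j)(e^s w)`. -/
noncomputable def eul (b : ℝ) (U : (Fin n → ℝ) → ℝ) : ℕ → (Fin n → ℝ) → ℝ
  | 0 => U
  | j + 1 => fun w => b * eul b U j w + fderiv ℝ (eul b U j) w w

variable {b : ℝ} {U : (Fin n → ℝ) → ℝ}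

theorem eul_analyticOnNhd {S : Set (Fin n → ℝ)} (hU : AnalyticOnNhd ℝ U S) (j : ℕ) :
    AnalyticOnNhd ℝ (eul b U j) S := by
  induction j with
  | zero => exact hU
  | succ j ih =>
    intro w hw
    have h : AnalyticAt ℝ (fun w => (fderiv ℝ (eul b U j) w, w)) w :=
      (AnalyticOnNhd.fderiv ih w hw).prod analyticAt_id
    exact (analyticAt_const.mul (ih w hw)).add (AnalyticAt.fun_comp
      (g := fun p : ((Fin n → ℝ) →L[ℝ] ℝ) × (Fin n → ℝ) => p.1 p.2)
      ((ContinuousLinearMap.id ℝ ((Fin n → ℝ) →L[ℝ] ℝ)).analyticAt_bilinear _) h)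

theorem eul_zero (j : ℕ) : eul b U j 0 = b ^ j * U 0 := by
  induction j with
  | zero => simp [eul]
  | succ j ih => simp [eul, ih, pow_succ]; ring

theorem eul_hasDerivAt {S : Set (Fin n → ℝ)} (hU : AnalyticOnNhd ℝ U S) (j : ℕ) {w : Fin n → ℝ}
    {s : ℝ} (hs : Real.exp s • w ∈ S) :
    HasDerivAt (fun s => Real.exp (b * s) * eul b U j (Real.exp s • w))
      (Real.exp (b * s) * eul b U (j + 1) (Real.exp s • w)) s := by
  have h1 : HasDerivAt (fun s => Real.exp (b * s)) (Real.exp (b * s) * b) s := by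
    simpa using ((hasDerivAt_id s).const_mul b).exp
  have h2 : HasDerivAt (fun s => Real.exp s • w) (Real.exp s • w) s :=
    (Real.hasDerivAt_exp s).smul_const w
  have h3 := ((eul_analyticOnNhd (b := b) hU j _ hs).differentiableAt.hasFDerivAt).comp_hasDerivAt s h2
  refine (h1.mul h3).congr_deriv ?_
  simp only [eul, Function.comp_apply]
  ring

/-- A matrix-valued function invertible at a point has locally uniformly bounded inverse. -/
theorem exists_matrix_bound {X : Type*} [TopologicalSpace X] {K : ℕ} {x₀ : X}
    {M : X → Matrix (Fin K) (Fin K) ℝ} (hM : ContinuousAt M x₀) (h0 : (M x₀).det ≠ 0) :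
    ∃ C : ℝ, 0 ≤ C ∧ ∀ᶠ x in 𝓝 x₀, ∀ Y : Fin K → ℝ,
      ∑ k, |Y k| ≤ C * ∑ j, |∑ k, Y k * M x j k| := by
  have hdet : ContinuousAt (fun x => (M x).det) x₀ :=
    (continuous_id.matrix_det).continuousAt.comp hM
  have hadj : ContinuousAt (fun x => (M x).adjugate) x₀ :=
    (continuous_id.matrix_adjugate).continuousAt.comp hM
  have hd : ∀ᶠ x in 𝓝 x₀, |(M x₀).det| / 2 < |(M x).det| :=
    hdet.abs.tendsto.eventually (lt_mem_nhds (half_lt_self (abs_pos.mpr h0)))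
  set B := ∑ k, ∑ j, |(M x₀).adjugate k j| + 1
  have ha : ∀ᶠ x in 𝓝 x₀, ∑ k, ∑ j, |(M x).adjugate k j| < B := by
    have hc : ContinuousAt (fun x => ∑ k, ∑ j, |(M x).adjugate k j|) x₀ := by
      have : Continuous fun A : Matrix (Fin K) (Fin K) ℝ => ∑ k, ∑ j, |A k j| := by fun_prop
      exact this.continuousAt.comp hadj
    exact hc.tendsto.eventually (gt_mem_nhds (by simp [B]))
  have hB : 0 ≤ B := by positivity
  have hδ : 0 < |(M x₀).det| / 2 := by positivity
  refine ⟨B / (|(M x₀).det| / 2), by positivity, ?_⟩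
  filter_upwards [hd, ha] with x h1 h2 Y
  set Z : Fin K → ℝ := fun j => ∑ k, Y k * M x j k
  have hZ : (M x).mulVec Y = Z := by
    ext j; simp only [Matrix.mulVec, dotProduct, Z, mul_comm]
  have hY : ∀ k, (M x).det * Y k = ∑ j, (M x).adjugate k j * Z j := by
    intro k
    have : (M x).adjugate.mulVec ((M x).mulVec Y) = (M x).det • Y := by
      rw [Matrix.mulVec_mulVec, Matrix.adjugate_mul, Matrix.smul_mulVec, Matrix.one_mulVec]
    have := congrFun this k
    rw [hZ] at this
    simpa [Matrix.mulVec, dotProduct] using this.symm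
  rw [div_mul_eq_mul_div, le_div_iff₀ hδ]
  calc (∑ k, |Y k|) * (|(M x₀).det| / 2) ≤ (∑ k, |Y k|) * |(M x).det| := by gcongr
    _ = ∑ k, |∑ j, (M x).adjugate k j * Z j| := by
      rw [Finset.sum_mul]
      exact Finset.sum_congr rfl fun k _ => by rw [← hY k, abs_mul, mul_comm]
    _ ≤ ∑ k, ∑ j, |(M x).adjugate k j| * ∑ j, |Z j| := by
      refine Finset.sum_le_sum fun k _ => (Finset.abs_sum_le_sum_abs _ _).trans ?_
      refine Finset.sum_le_sum fun j _ => ?_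
      rw [abs_mul]
      gcongr
      exact Finset.single_le_sum (f := fun j => |Z j|) (fun _ _ => abs_nonneg _) (Finset.mem_univ j)
    _ = (∑ k, ∑ j, |(M x).adjugate k j|) * ∑ j, |Z j| := by
      simp only [Finset.sum_mul]
    _ ≤ B * ∑ j, |Z j| := by gcongr

/-- Uniform control of the Euler derivatives of finitely many monomials with distinct degrees. -/
theorem exists_eul_bounds {K N : ℕ} {b : ℕ → ℝ} (hb : ∀ k < K, 0 < b k)
    (hbb : ∀ k l, k < l → l < K → b k < b l) {U : ℕ → (Fin n → ℝ) → ℝ}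
    (hU : ∀ k < K, AnalyticAt ℝ (U k) 0 ∧ U k 0 ≠ 0) :
    ∃ R > 0, ∃ C D : ℝ, 0 ≤ C ∧ 0 ≤ D ∧ (∀ k < K, AnalyticOnNhd ℝ (U k) (Metric.ball 0 R)) ∧
      ∀ v ∈ Metric.ball (0 : Fin n → ℝ) R,
        (∀ Y : ℕ → ℝ, ∑ k ∈ Finset.range K, |Y k| ≤
          C * ∑ j ∈ Finset.range K, |∑ k ∈ Finset.range K, Y k * eul (b k) (U k) (j + 1) v|) ∧
        ∀ k < K, ∀ j ≤ N, |eul (b k) (U k) j v| ≤ D := by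
  have hev : ∀ᶠ v in 𝓝 (0 : Fin n → ℝ), ∀ k ∈ Finset.range K, AnalyticAt ℝ (U k) v :=
    (Finset.range K).eventually_all.mpr fun k hk =>
      (hU k (Finset.mem_range.mp hk)).1.eventually_analyticAt
  have hea : ∀ k < K, ∀ j, AnalyticAt ℝ (eul (b k) (U k) j) 0 := fun k hk j => by
    obtain ⟨r, hr, h⟩ := (hU k hk).1.exists_ball
    exact eul_analyticOnNhd h j 0 (Metric.mem_ball_self hr)
  let M : (Fin n → ℝ) → Matrix (Fin K) (Fin K) ℝ := fun v =>
    Matrix.of fun j k => eul (b k) (U k) (j + 1) v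
  have hM : ContinuousAt M 0 := by
    refine continuousAt_pi.mpr fun j => continuousAt_pi.mpr fun k => ?_
    exact (hea k k.2 (j + 1)).continuousAt
  have hM0 : (M 0).det ≠ 0 := by
    have hb' : ∀ k : Fin K, b k ≠ 0 := fun k => (hb k k.2).ne'
    have e : M 0 = (Matrix.vandermonde fun k : Fin K => b k).transpose *
        Matrix.diagonal fun k : Fin K => b k * U k 0 := by
      ext j k
      rw [Matrix.mul_diagonal]
      simp only [M, Matrix.of_apply, eul_zero, Matrix.transpose_apply, Matrix.vandermonde_apply]
      ring
    rw [e, Matrix.det_mul, Matrix.det_transpose, Matrix.det_diagonal]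
    refine mul_ne_zero (Matrix.det_vandermonde_ne_zero_iff.mpr ?_)
      (Finset.prod_ne_zero_iff.mpr fun k _ => mul_ne_zero (hb' k) (hU k k.2).2)
    intro k l hkl
    rcases lt_trichotomy k l with h | h | h
    · exact absurd hkl (hbb k l h l.2).ne
    · exact h
    · exact absurd hkl (hbb l k h k.2).ne'
  obtain ⟨C, hC, hCe⟩ := exists_matrix_bound hM hM0
  set D := ∑ k ∈ Finset.range K, ∑ j ∈ Finset.range (N + 1), |eul (b k) (U k) j 0| + 1
  have hD : 0 ≤ D := by positivity
  have hDe : ∀ᶠ v in 𝓝 (0 : Fin n → ℝ),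
      ∑ k ∈ Finset.range K, ∑ j ∈ Finset.range (N + 1), |eul (b k) (U k) j v| < D := by
    have : ContinuousAt (fun v : Fin n → ℝ =>
        ∑ k ∈ Finset.range K, ∑ j ∈ Finset.range (N + 1), |eul (b k) (U k) j v|) 0 :=
      tendsto_finsetSum _ fun k hk => tendsto_finsetSum _ fun j _ =>
        (hea k (Finset.mem_range.mp hk) j).continuousAt.abs
    exact this.tendsto.eventually (gt_mem_nhds (by simp [D]))
  obtain ⟨R, hR, h⟩ := Metric.eventually_nhds_iff_ball.mp (hev.and (hCe.and hDe))
  refine ⟨R, hR, C, D, hC, hD, fun k hk v hv => (h v hv).1 k (Finset.mem_range.mpr hk),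
    fun v hv => ⟨fun Y => ?_, fun k hk j hj => ?_⟩⟩
  · have := (h v hv).2.1 fun k => Y k
    simp only [M, Matrix.of_apply] at this
    simpa only [Finset.sum_range] using this
  · refine le_trans ?_ (h v hv).2.2.le
    refine le_trans ?_ (Finset.single_le_sum (f := fun k => ∑ j ∈ Finset.range (N + 1),
      |eul (b k) (U k) j v|) (fun _ _ => Finset.sum_nonneg fun _ _ => abs_nonneg _)
      (Finset.mem_range.mpr hk))
    exact Finset.single_le_sum (f := fun j => |eul (b k) (U k) j v|) (fun _ _ => abs_nonneg _)
      (Finset.mem_range.mpr (by omega))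

end OscDecay

namespace OscDecay

open Filter Topology MeasureTheory Set

variable {n : ℕ}

theorem mon_exp_smul (α : Fin n → ℕ) (s : ℝ) (w : Fin n → ℝ) :
    mon α (Real.exp s • w) = Real.exp ((∑ i, α i : ℕ) * s) * mon α w := by
  simp only [mon, Pi.smul_apply, smul_eq_mul, mul_pow, Finset.prod_mul_distrib]
  congr 1
  rw [Finset.prod_pow_eq_pow_sum, ← Real.exp_nat_mul]

theorem exp_smul_mem_ball {R : ℝ} {w : Fin n → ℝ} (hw : w ∈ Metric.ball (0 : Fin n → ℝ) R) {s : ℝ}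
    (hs : s ∈ Icc (0 : ℝ) 1) : Real.exp s • w ∈ Metric.ball (0 : Fin n → ℝ) (3 * R) := by
  rw [mem_ball_zero_iff] at hw ⊢
  rw [norm_smul, Real.norm_eq_abs, Real.abs_exp]
  have h1 : Real.exp s ≤ 3 :=
    (Real.exp_le_exp.mpr hs.2).trans (Real.exp_one_lt_d9.le.trans (by norm_num))
  nlinarith [norm_nonneg w]

/-- Averaging an integral over dilations. -/
theorem norm_integral_le_of_dilation {G : (Fin n → ℝ) → ℂ} (hG : Continuous G) {R : ℝ}
    (hGR : ∀ w, R ≤ ‖w‖ → G w = 0) {H : (Fin n → ℝ) → ℝ}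
    (hH : IntegrableOn H (Metric.ball 0 R))
    (h : ∀ w ∈ Metric.ball (0 : Fin n → ℝ) R,
      ‖∫ s in (0 : ℝ)..1, (Real.exp (n * s) : ℂ) * G (Real.exp s • w)‖ ≤ H w) :
    ‖∫ w, G w‖ ≤ ∫ w in Metric.ball 0 R, H w := by
  set F : ℝ → (Fin n → ℝ) → ℂ := fun s w => (Real.exp (n * s) : ℂ) * G (Real.exp s • w)
  have hF0 : ∀ s ∈ Icc (0 : ℝ) 1, ∀ w, R ≤ ‖w‖ → F s w = 0 := fun s hs w hw => by
    simp only [F]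
    rw [hGR, mul_zero]
    rw [norm_smul, Real.norm_eq_abs, Real.abs_exp]
    have : 1 ≤ Real.exp s := Real.one_le_exp hs.1
    nlinarith [norm_nonneg w]
  have hFc : Continuous (Function.uncurry F) := by
    simp only [F, Function.uncurry_def]
    fun_prop
  have e1 : ∀ s : ℝ, ∫ w, F s w = ∫ w, G w := fun s => by
    simp only [F]
    rw [integral_const_mul, Measure.integral_comp_smul, Module.finrank_fin_fun,
      abs_of_pos (by positivity), ← Real.exp_nat_mul, ← Complex.coe_smul, smul_eq_mul, ← mul_assoc,
      ← Complex.ofReal_mul, mul_inv_cancel₀ (Real.exp_pos _).ne', Complex.ofReal_one, one_mul]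
  have hI : Integrable (Function.uncurry F)
      ((volume.restrict (uIoc (0 : ℝ) 1)).prod (volume : Measure (Fin n → ℝ))) := by
    have : (volume.restrict (uIoc (0 : ℝ) 1)).prod (volume : Measure (Fin n → ℝ)) =
        (volume.prod volume).restrict (uIoc (0 : ℝ) 1 ×ˢ univ) := by
      rw [← Measure.prod_restrict, Measure.restrict_univ]
    rw [this, uIoc_of_le zero_le_one]
    have hc : IntegrableOn (Function.uncurry F) (Icc (0 : ℝ) 1 ×ˢ Metric.closedBall 0 R)
        (volume.prod volume) :=
      hFc.continuousOn.integrableOn_compact (isCompact_Icc.prod (isCompact_closedBall _ _))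
    refine hc.of_forall_sdiff_eq_zero (measurableSet_Ioc.prod MeasurableSet.univ) ?_
    rintro ⟨s, w⟩ ⟨⟨hs, -⟩, hn⟩
    refine hF0 s (Ioc_subset_Icc_self hs) w (le_of_not_ge fun hw => hn
      ⟨Ioc_subset_Icc_self hs, mem_closedBall_zero_iff.mpr hw⟩)
  have e2 : ∫ w, G w = ∫ w, ∫ s in (0 : ℝ)..1, F s w := by
    rw [← intervalIntegral_integral_swap hI]
    simp only [e1]
    simp
  have e3 : ∫ w, ∫ s in (0 : ℝ)..1, F s w =
      ∫ w in Metric.ball 0 R, ∫ s in (0 : ℝ)..1, F s w := by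
    refine (setIntegral_eq_integral_of_forall_compl_eq_zero fun w hw => ?_).symm
    rw [intervalIntegral.integral_congr (g := fun _ => (0 : ℂ)), intervalIntegral.integral_zero]
    intro s hs
    rw [uIcc_of_le zero_le_one] at hs
    exact hF0 s hs w (by simpa using hw)
  rw [e2, e3]
  refine norm_integral_le_of_norm_le hH ?_
  filter_upwards [ae_restrict_mem measurableSet_ball] with w hw using h w hw

end OscDecay

namespace OscDecay

open Filter Topology MeasureTheory Set

variable {n : ℕ}

/-- The oscillatory integral over a dilation orbit. -/
theorem exists_orbit_bound {K N : ℕ} (hK : K ≤ N) (hN : 0 < N) {b : ℕ → ℝ} (hb : ∀ k < K, 0 < b k)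
    (hbb : ∀ k l, k < l → l < K → b k < b l) {U : ℕ → (Fin n → ℝ) → ℝ}
    (hU : ∀ k < K, AnalyticAt ℝ (U k) 0 ∧ U k 0 ≠ 0) (d : ℝ) :
    ∃ R > 0, (∀ k < K, AnalyticOnNhd ℝ (U k) (Metric.ball 0 (3 * R))) ∧
      ∀ χ : (Fin n → ℝ) → ℝ, ContDiff ℝ 1 χ → HasCompactSupport χ → ∃ C, 0 ≤ C ∧
        ∀ w ∈ Metric.ball (0 : Fin n → ℝ) R, ∀ Y : ℕ → ℝ,
          ‖∫ s in (0 : ℝ)..1, ((Real.exp (d * s) * χ (Real.exp s • w) : ℝ) : ℂ) * Complex.exp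
            (Complex.I * (∑ k ∈ Finset.range K, Y k * (Real.exp (b k * s) *
              U k (Real.exp s • w)) : ℝ))‖ ≤
            C * (1 + ∑ k ∈ Finset.range K, |Y k|) ^ (-(1 / N : ℝ)) := by
  obtain ⟨R', hR', C₁, D₁, hC₁, hD₁, hUa, hbd⟩ := exists_eul_bounds (N := N + 1) hb hbb hU
  have e3 : 3 * (R' / 3) = R' := by ring
  refine ⟨R' / 3, by positivity, by rwa [e3], fun χ hχ hχc => ?_⟩
  set c : ℝ := 1 / (C₁ * N + 1)
  have hc : 0 < c := by positivity
  set D : ℝ := D₁ * ∑ k ∈ Finset.range K, Real.exp (b k)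
  have hD : 0 ≤ D := by positivity
  obtain ⟨C₂, hC₂, hosc⟩ := exists_osc_bound N hc hD
  obtain ⟨X₀, hX₀⟩ := hχc.exists_bound_of_continuous hχ.continuous
  obtain ⟨X₁, hX₁⟩ := (hχc.fderiv (𝕜 := ℝ)).exists_bound_of_continuous (hχ.continuous_fderiv one_ne_zero)
  have hX₀0 : 0 ≤ X₀ := (norm_nonneg _).trans (hX₀ 0)
  have hX₁0 : 0 ≤ X₁ := (norm_nonneg _).trans (hX₁ 0)
  set E := Real.exp |d|
  have hE : ∀ s ∈ Icc (0 : ℝ) 1, Real.exp (d * s) ≤ E := fun s hs => by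
    refine Real.exp_le_exp.mpr ?_
    calc d * s ≤ |d * s| := le_abs_self _
      _ = |d| * s := by rw [abs_mul, abs_of_nonneg hs.1]
      _ ≤ |d| * 1 := by gcongr; exact hs.2
      _ = |d| := mul_one _
  set α := E * (|d| * X₀ + X₀ + X₁ * R')
  refine ⟨C₂ * α, by positivity, fun w hw Y => ?_⟩
  have hball : ∀ s ∈ Icc (0 : ℝ) 1, Real.exp s • w ∈ Metric.ball (0 : Fin n → ℝ) R' := fun s hs =>
    e3 ▸ exp_smul_mem_ball hw hs
  let q : ℕ → ℝ → ℝ := fun i s => ∑ k ∈ Finset.range K, Y k * (Real.exp (b k * s) *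
    eul (b k) (U k) i (Real.exp s • w))
  let A : ℝ → ℝ := fun s => Real.exp (d * s) * χ (Real.exp s • w)
  let A' : ℝ → ℝ := fun s => Real.exp (d * s) * (d * χ (Real.exp s • w) +
    fderiv ℝ χ (Real.exp s • w) (Real.exp s • w))
  have hdata : OscData 0 1 α A A' q := by
    refine ⟨zero_le_one, by norm_num, fun s hs => ?_, ?_, fun s hs => ?_, fun s hs => ?_,
      fun i s hs => ?_⟩
    · have h1 : HasDerivAt (fun s => Real.exp (d * s)) (Real.exp (d * s) * d) s := by
        simpa using ((hasDerivAt_id s).const_mul d).exp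
      have h2 : HasDerivAt (fun s => Real.exp s • w) (Real.exp s • w) s :=
        (Real.hasDerivAt_exp s).smul_const w
      have h3 := ((hχ.differentiable one_ne_zero).differentiableAt.hasFDerivAt).comp_hasDerivAt s h2
      refine (h1.mul h3).congr_deriv ?_
      simp only [A', Function.comp_apply]
      ring
    · have := hχ.continuous_fderiv one_ne_zero
      have := hχ.continuous
      exact Continuous.continuousOn (by fun_prop)
    · simp only [A, abs_mul, Real.abs_exp]
      refine mul_le_mul (hE s hs) ?_ (abs_nonneg _) (by positivity)
      have := hX₀ (Real.exp s • w)
      rw [Real.norm_eq_abs] at this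
      have : 0 ≤ |d| * X₀ := by positivity
      have : 0 ≤ X₁ * R' := by positivity
      linarith
    · simp only [A', abs_mul, Real.abs_exp]
      refine mul_le_mul (hE s hs) ?_ (abs_nonneg _) (by positivity)
      have h0 := hX₀ (Real.exp s • w)
      rw [Real.norm_eq_abs] at h0
      have h1 : |fderiv ℝ χ (Real.exp s • w) (Real.exp s • w)| ≤ X₁ * R' := by
        rw [← Real.norm_eq_abs]
        refine (ContinuousLinearMap.le_opNorm _ _).trans ?_
        have := hball s hs
        rw [mem_ball_zero_iff] at this
        exact mul_le_mul (hX₁ _) this.le (norm_nonneg _) hX₁0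
      calc _ ≤ |d * χ (Real.exp s • w)| + |fderiv ℝ χ (Real.exp s • w) (Real.exp s • w)| :=
            abs_add_le _ _
        _ ≤ |d| * X₀ + X₁ * R' := by
            rw [abs_mul]
            gcongr
        _ ≤ _ := by linarith
    · simp only [q]
      exact HasDerivAt.fun_sum fun k hk => (eul_hasDerivAt (hUa k (Finset.mem_range.mp hk)) i
        (hball s hs)).const_mul (Y k)
  set m := ∑ k ∈ Finset.range K, |Y k|
  have hm : 0 ≤ m := by positivity
  have hexp : ∀ s ∈ Icc (0 : ℝ) 1, ∀ k < K, 1 ≤ Real.exp (b k * s) := fun s hs k hk =>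
    Real.one_le_exp (mul_nonneg (hb k hk).le hs.1)
  refine hosc hdata m hm (fun s hs => ?_) fun s hs j hj => ?_
  · by_contra! hcon
    rcases hm.eq_or_lt with h0 | h0
    · have := hcon 0 hN
      rw [← h0, mul_zero] at this
      exact absurd this (not_lt.mpr (abs_nonneg _))
    · have h1 := (hbd _ (hball s hs)).1 fun k => Y k * Real.exp (b k * s)
      have h2 : m ≤ ∑ k ∈ Finset.range K, |Y k * Real.exp (b k * s)| := by
        refine Finset.sum_le_sum fun k hk => ?_
        rw [abs_mul, Real.abs_exp]
        exact le_mul_of_one_le_right (abs_nonneg _) (hexp s hs k (Finset.mem_range.mp hk))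
      have h3 : ∑ j ∈ Finset.range K, |∑ k ∈ Finset.range K, Y k * Real.exp (b k * s) *
          eul (b k) (U k) (j + 1) (Real.exp s • w)| ≤ N * (c * m) := by
        calc _ ≤ ∑ j ∈ Finset.range K, c * m := by
              refine Finset.sum_le_sum fun j hj => ?_
              have := (hcon j ((Finset.mem_range.mp hj).trans_le hK)).le
              simpa only [q, mul_assoc] using this
          _ = K * (c * m) := by rw [Finset.sum_const, Finset.card_range, nsmul_eq_mul]
          _ ≤ N * (c * m) := by gcongr
      have h4 : m ≤ C₁ * (N * (c * m)) := h2.trans (h1.trans (by gcongr))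
      have h5 : c * (C₁ * N + 1) = 1 := by simp only [c]; field_simp
      nlinarith [mul_pos hc h0]
  · calc |q (j + 1) s| ≤ ∑ k ∈ Finset.range K, |Y k * (Real.exp (b k * s) *
          eul (b k) (U k) (j + 1) (Real.exp s • w))| := Finset.abs_sum_le_sum_abs _ _
      _ ≤ ∑ k ∈ Finset.range K, m * (Real.exp (b k) * D₁) := by
        refine Finset.sum_le_sum fun k hk => ?_
        rw [abs_mul, abs_mul, Real.abs_exp]
        have hk' := Finset.mem_range.mp hk
        have h1 : |Y k| ≤ m := Finset.single_le_sum (f := fun k => |Y k|)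
          (fun _ _ => abs_nonneg _) hk
        have h2 : Real.exp (b k * s) ≤ Real.exp (b k) :=
          Real.exp_le_exp.mpr (mul_le_of_le_one_right (hb k hk').le hs.2)
        have h3 := (hbd _ (hball s hs)).2 k hk' (j + 1) (by omega)
        gcongr
      _ = D * m := by
        simp only [D, Finset.mul_sum, Finset.sum_mul]
        exact Finset.sum_congr rfl fun k _ => by ring

/-- Oscillatory integrals with monomial amplitude and phase a combination of a chain of monomials. -/
theorem exists_mono_bound {K N : ℕ} (hK : K ≤ N) (hN : 0 < N) {β : ℕ → Fin n → ℕ}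
    {U : ℕ → (Fin n → ℝ) → ℝ}
    (hU : ∀ k < K, AnalyticAt ℝ (U k) 0 ∧ U k 0 ≠ 0 ∧ 0 < ∑ i, β k i)
    (hβ : ∀ k l, k < l → l < K → ∑ i, β k i < ∑ i, β l i) (κ : Fin n → ℕ) :
    ∃ R₀ > 0, ∀ R ≤ R₀, ∀ χ : (Fin n → ℝ) → ℝ, ContDiff ℝ 1 χ → HasCompactSupport χ →
      tsupport χ ⊆ Metric.ball 0 R → ∃ C, 0 ≤ C ∧ ∀ c : ℕ → ℝ,
        ‖∫ w, ((χ w * |mon κ w| : ℝ) : ℂ) * Complex.exp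
          (Complex.I * (∑ k ∈ Finset.range K, c k * (mon (β k) w * U k w) : ℝ))‖ ≤
        C * ∫ w in Metric.ball 0 R,
          |mon κ w| * (1 + ∑ k ∈ Finset.range K, |c k * mon (β k) w|) ^ (-(1 / N : ℝ)) := by
  obtain ⟨R₀, hR₀, hUa, hbd⟩ := exists_orbit_bound (n := n) hK hN
    (b := fun k => ((∑ i, β k i : ℕ) : ℝ)) (U := U) (fun k hk => by exact_mod_cast (hU k hk).2.2)
    (fun k l h1 h2 => by exact_mod_cast hβ k l h1 h2) (fun k hk => ⟨(hU k hk).1, (hU k hk).2.1⟩)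
    ((n + ∑ i, κ i : ℕ) : ℝ)
  refine ⟨R₀, hR₀, fun R hR χ hχ hχc hχs => ?_⟩
  obtain ⟨C, hC, h⟩ := hbd χ hχ hχc
  refine ⟨C, hC, fun c => ?_⟩
  have hRR : Metric.ball (0 : Fin n → ℝ) R ⊆ Metric.ball 0 R₀ := Metric.ball_subset_ball hR
  have hR3 : Metric.ball (0 : Fin n → ℝ) R ⊆ Metric.ball 0 (3 * R₀) :=
    Metric.ball_subset_ball (by linarith)
  set G : (Fin n → ℝ) → ℂ := fun w => ((χ w * |mon κ w| : ℝ) : ℂ) * Complex.exp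
    (Complex.I * (∑ k ∈ Finset.range K, c k * (mon (β k) w * U k w) : ℝ)) with hGdef
  have hGs : Function.support G ⊆ tsupport χ := fun w hw => by
    refine subset_tsupport _ fun h0 => hw ?_
    simp only [hGdef, h0, zero_mul, Complex.ofReal_zero]
  have hGc : Continuous G := by
    have hts : tsupport G ⊆ Metric.ball 0 R :=
      (closure_minimal hGs (isClosed_tsupport _)).trans hχs
    refine continuous_of_tsupport fun w hw => ?_
    have hw' := hts hw
    have hs : ContinuousAt (fun w => ∑ k ∈ Finset.range K, c k * (mon (β k) w * U k w)) w :=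
      tendsto_finsetSum _ fun k hk => continuousAt_const.mul
        ((continuous_mon _).continuousAt.mul
          (hUa k (Finset.mem_range.mp hk) w (hR3 hw')).continuousAt)
    have h1 : ContinuousAt (fun w => χ w * |mon κ w|) w :=
      (hχ.continuous.mul (continuous_mon _).abs).continuousAt
    exact (Complex.continuous_ofReal.continuousAt.comp h1).mul
      (Complex.continuous_exp.continuousAt.comp
        (continuousAt_const.mul (Complex.continuous_ofReal.continuousAt.comp hs)))
  have hcont : Continuous fun w : Fin n → ℝ =>
      |mon κ w| * (1 + ∑ k ∈ Finset.range K, |c k * mon (β k) w|) ^ (-(1 / N : ℝ)) := by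
    refine (continuous_mon _).abs.mul (Continuous.rpow_const ?_ fun w => Or.inl ?_)
    · exact continuous_const.add (continuous_finsetSum _ fun k _ =>
        (continuous_const.mul (continuous_mon _)).abs)
    · positivity
  rw [← integral_const_mul]
  refine norm_integral_le_of_dilation hGc (R := R) (fun w hw => ?_) ?_ fun w hw => ?_
  · by_contra h0
    have := hχs (hGs h0)
    rw [mem_ball_zero_iff] at this
    linarith
  · exact ((hcont.const_smul C).continuousOn.integrableOn_compact
      (isCompact_closedBall 0 R)).mono_set Metric.ball_subset_closedBall
  · have h1 := h w (hRR hw) fun k => c k * mon (β k) w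
    have h2 : ∫ s in (0 : ℝ)..1, (Real.exp (n * s) : ℂ) * G (Real.exp s • w) =
        ((|mon κ w| : ℝ) : ℂ) * ∫ s in (0 : ℝ)..1,
          ((Real.exp (((n + ∑ i, κ i : ℕ) : ℝ) * s) * χ (Real.exp s • w) : ℝ) : ℂ) * Complex.exp
            (Complex.I * (∑ k ∈ Finset.range K, c k * mon (β k) w *
              (Real.exp (((∑ i, β k i : ℕ) : ℝ) * s) * U k (Real.exp s • w)) : ℝ)) := by
      rw [← intervalIntegral.integral_const_mul]
      refine intervalIntegral.integral_congr fun s _ => ?_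
      simp only [hGdef, mon_exp_smul, abs_mul, Real.abs_exp]
      have e1 : ∀ k, c k * (Real.exp (((∑ i, β k i : ℕ) : ℝ) * s) * mon (β k) w *
          U k (Real.exp s • w)) = c k * mon (β k) w *
          (Real.exp (((∑ i, β k i : ℕ) : ℝ) * s) * U k (Real.exp s • w)) := fun k => by ring
      simp only [e1]
      rw [Nat.cast_add, add_mul, Real.exp_add]
      push_cast
      ring
    rw [h2, norm_mul, Complex.norm_real, Real.norm_eq_abs, abs_abs]
    calc _ ≤ |mon κ w| * (C * (1 + ∑ k ∈ Finset.range K, |c k * mon (β k) w|) ^ (-(1 / N : ℝ))) := by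
          gcongr
      _ = _ := by ring

end OscDecay

namespace OscDecay

open Filter Topology MeasureTheory Set

variable {n : ℕ}

/-- The averaged sublevel integral controlling the oscillatory integrals. -/
noncomputable def subInt (F : (Fin n → ℝ) → ℝ) (ρ t : ℝ) : ℝ :=
  ∫ x in Metric.ball 0 ρ, (1 + |t * F x|) ^ (-(1 / (n + 1 : ℕ) : ℝ))

/-- The linearly perturbed phase. -/
def phase (F : (Fin n → ℝ) → ℝ) (η : Fin n → ℝ) (t : ℝ) (x : Fin n → ℝ) : ℝ :=
  t * (F x + ∑ i, η i * x i)

/-- Local oscillatory integral estimate in the chart `π` with Jacobian `J`. -/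
def Est (F : (Fin n → ℝ) → ℝ) (ρ : ℝ) (π : (Fin n → ℝ) → (Fin n → ℝ)) (J : (Fin n → ℝ) → ℝ) : Prop :=
  ∃ r > 0, ∃ η₀ > 0, ∀ ψ : (Fin n → ℝ) → ℝ, ContDiff ℝ 1 ψ → HasCompactSupport ψ →
    tsupport ψ ⊆ Metric.ball 0 r → ∃ C, 0 ≤ C ∧ ∀ η : Fin n → ℝ, (∀ i, |η i| ≤ η₀) → ∀ t : ℝ,
      ‖∫ w, ((ψ w * |J w| : ℝ) : ℂ) * Complex.exp (Complex.I * phase F η t (π w))‖ ≤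
        C * subInt F ρ t

variable {F : (Fin n → ℝ) → ℝ} {ρ : ℝ}

theorem continuous_subInt_integrand (hF : Continuous F) (t p : ℝ) :
    Continuous fun x => (1 + |t * F x|) ^ p :=
  (continuous_const.add (continuous_const.mul hF).abs).rpow_const fun _ => Or.inl
    (add_pos_of_pos_of_nonneg one_pos (abs_nonneg _)).ne'

theorem subInt_nonneg (t : ℝ) : 0 ≤ subInt F ρ t :=
  integral_nonneg fun x => Real.rpow_nonneg (by positivity) _

theorem exists_push_subInt (hF : Continuous F) {π : (Fin n → ℝ) → (Fin n → ℝ)}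
    {J : (Fin n → ℝ) → ℝ} (h : IsChart π J) {R : ℝ}
    (hR : ∀ w ∈ Metric.ball (0 : Fin n → ℝ) R, π w ∈ Metric.ball 0 ρ) :
    ∃ M, 0 ≤ M ∧ ∀ t, ∫ w in Metric.ball 0 R,
      |J w| * (1 + |t * F (π w)|) ^ (-(1 / (n + 1 : ℕ) : ℝ)) ≤ M * subInt F ρ t := by
  obtain ⟨M, hM⟩ := h.push
  refine ⟨M, M.2, fun t => ?_⟩
  set p : ℝ := -(1 / (n + 1 : ℕ) : ℝ)
  have hg : Continuous fun x => (1 + |t * F x|) ^ p := continuous_subInt_integrand hF t p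
  have hg0 : ∀ x, 0 ≤ (1 + |t * F x|) ^ p := fun x => Real.rpow_nonneg (by positivity) _
  have hJ := h.jac_contDiff.continuous.abs
  have hgp := hg.comp h.contDiff.continuous
  have hi : IntegrableOn (fun x => (1 + |t * F x|) ^ p) (Metric.ball 0 ρ) :=
    (hg.continuousOn.integrableOn_compact (isCompact_closedBall 0 ρ)).mono_set
      Metric.ball_subset_closedBall
  have hi' : IntegrableOn (fun w => |J w| * (1 + |t * F (π w)|) ^ p) (Metric.ball 0 R) :=
    ((hJ.mul hgp).continuousOn.integrableOn_compact (isCompact_closedBall 0 R)).mono_set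
      Metric.ball_subset_closedBall
  have key := hM ((Metric.ball 0 ρ).indicator fun x => ENNReal.ofReal ((1 + |t * F x|) ^ p))
    (Measurable.indicator hg.measurable.ennreal_ofReal measurableSet_ball)
  rw [lintegral_indicator measurableSet_ball,
    ← ofReal_integral_eq_lintegral_ofReal hi (ae_of_all _ hg0)] at key
  have h2 : ENNReal.ofReal (∫ w in Metric.ball 0 R, |J w| * (1 + |t * F (π w)|) ^ p) ≤
      M * ENNReal.ofReal (subInt F ρ t) := by
    rw [ofReal_integral_eq_lintegral_ofReal hi'
      (ae_of_all _ fun w => mul_nonneg (abs_nonneg _) (hg0 _))]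
    refine le_trans ?_ key
    refine le_trans (setLIntegral_mono' measurableSet_ball fun w hw => ?_) (setLIntegral_le_lintegral _ _)
    rw [indicator_of_mem (hR w hw), ENNReal.ofReal_mul (abs_nonneg _)]
  rw [← ENNReal.ofReal_coe_nnreal, ← ENNReal.ofReal_mul M.coe_nonneg] at h2
  exact (ENNReal.ofReal_le_ofReal_iff (mul_nonneg M.2 (subInt_nonneg t))).mp h2

theorem abs_mon_le {α β : Fin n → ℕ} (h : ∀ i, α i ≤ β i) {w : Fin n → ℝ} (hw : ‖w‖ ≤ 1) :
    |mon β w| ≤ |mon α w| := by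
  simp only [mon, Finset.abs_prod, abs_pow]
  refine Finset.prod_le_prod (fun i _ => by positivity) fun i _ => ?_
  exact pow_le_pow_of_le_one (abs_nonneg _) ((norm_le_pi_norm w i).trans hw) (h i)

/-- Domination of the `none` column by the perturbed coefficients. -/
theorem exists_domination {K : ℕ} {β : ℕ → Fin n → ℕ}
    (hβ : ∀ k l, k < l → l < K → ∀ i, β k i ≤ β l i) (a : ℕ → ℝ) (T : ℕ → Fin n → ℝ)
    {u : ℝ} (hu : 0 ≤ u) :
    ∃ η₀ > 0, ∃ L ≥ 1, ∀ η : Fin n → ℝ, (∀ i, |η i| ≤ η₀) → ∀ t : ℝ, ∀ w : Fin n → ℝ, ‖w‖ ≤ 1 →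
      ∀ V : ℕ → ℝ, (∀ k < K, |V k| ≤ u) →
      1 + |t * ∑ k ∈ Finset.range K, a k * (mon (β k) w * V k)| ≤
        L * (1 + ∑ k ∈ Finset.range K, |t * (a k + ∑ i, η i * T k i) * mon (β k) w|) := by
  by_cases h : ∀ k < K, a k = 0
  · refine ⟨1, one_pos, 1, le_rfl, fun η _ t w _ V _ => ?_⟩
    rw [Finset.sum_eq_zero fun k hk => by rw [h k (Finset.mem_range.mp hk), zero_mul]]
    simp only [mul_zero, abs_zero, add_zero, one_mul, le_add_iff_nonneg_right]
    positivity
  · push Not at h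
    classical
    set k₀ := Nat.find h
    obtain ⟨hkK, hk0⟩ : k₀ < K ∧ a k₀ ≠ 0 := Nat.find_spec h
    have hlt : ∀ k < k₀, a k = 0 := fun k hk => by
      by_contra h0
      exact Nat.find_min h hk ⟨hk.trans hkK, h0⟩
    have hpos : 0 < |a k₀| := abs_pos.mpr hk0
    set S := ∑ i, |T k₀ i|
    set A := (∑ k ∈ Finset.range K, |a k|) * u
    have hA : 0 ≤ A := by positivity
    refine ⟨|a k₀| / 2 / (S + 1), by positivity, 1 + 2 * A / |a k₀|,
      le_add_of_nonneg_right (by positivity), fun η hη t w hw V hV => ?_⟩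
    have h1 : |∑ i, η i * T k₀ i| ≤ |a k₀| / 2 := by
      calc _ ≤ ∑ i, |η i * T k₀ i| := Finset.abs_sum_le_sum_abs _ _
        _ ≤ ∑ i, |a k₀| / 2 / (S + 1) * |T k₀ i| := by
          refine Finset.sum_le_sum fun i _ => ?_
          rw [abs_mul]
          exact mul_le_mul_of_nonneg_right (hη i) (abs_nonneg _)
        _ = |a k₀| / 2 * (S / (S + 1)) := by rw [← Finset.mul_sum]; ring
        _ ≤ |a k₀| / 2 * 1 := by
          gcongr
          rw [div_le_one (by positivity)]
          linarith
        _ = _ := mul_one _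
    have h2 : |a k₀| / 2 ≤ |a k₀ + ∑ i, η i * T k₀ i| := by
      have := abs_sub_abs_le_abs_add (a k₀) (∑ i, η i * T k₀ i)
      linarith
    have h3 : |∑ k ∈ Finset.range K, a k * (mon (β k) w * V k)| ≤ A * |mon (β k₀) w| := by
      calc _ ≤ ∑ k ∈ Finset.range K, |a k * (mon (β k) w * V k)| := Finset.abs_sum_le_sum_abs _ _
        _ ≤ ∑ k ∈ Finset.range K, |a k| * (|mon (β k₀) w| * u) := by
          refine Finset.sum_le_sum fun k hk => ?_
          have hk := Finset.mem_range.mp hk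
          rcases lt_or_ge k k₀ with hlk | hlk
          · rw [hlt k hlk]; simp
          · rw [abs_mul, abs_mul]
            have := hV k hk
            have h4 : |mon (β k) w| ≤ |mon (β k₀) w| := by
              rcases hlk.eq_or_lt with e | e
              · rw [e]
              · exact abs_mon_le (hβ k₀ k e hk) hw
            gcongr
        _ = _ := by rw [← Finset.sum_mul]; ring
    set Z := ∑ k ∈ Finset.range K, |t * (a k + ∑ i, η i * T k i) * mon (β k) w|
    have h4 : |t| * (|a k₀| / 2) * |mon (β k₀) w| ≤ Z := by
      refine le_trans ?_ (Finset.single_le_sum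
        (f := fun k => |t * (a k + ∑ i, η i * T k i) * mon (β k) w|)
        (fun _ _ => abs_nonneg _) (Finset.mem_range.mpr hkK))
      simp only [abs_mul]
      gcongr
    have hS : 0 ≤ Z := by positivity
    have hq : 0 ≤ 2 * A / |a k₀| := by positivity
    calc _ ≤ 1 + |t| * (A * |mon (β k₀) w|) := by rw [abs_mul]; gcongr
      _ = 1 + 2 * A / |a k₀| * (|t| * (|a k₀| / 2) * |mon (β k₀) w|) := by
        field_simp
      _ ≤ 1 + 2 * A / |a k₀| * Z := by gcongr
      _ ≤ _ := by nlinarith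

theorem rpow_le_of_le_mul {x y L p : ℝ} (hx : 0 < x) (hL : 0 < L) (hy : 0 < y) (hp : p ≤ 0)
    (h : x ≤ L * y) : y ^ p ≤ L ^ (-p) * x ^ p := by
  have h1 := Real.rpow_le_rpow_of_nonpos hx h hp
  rw [Real.mul_rpow hL.le hy.le] at h1
  calc y ^ p = L ^ (-p) * (L ^ p * y ^ p) := by
        rw [← mul_assoc, ← Real.rpow_add hL]; simp
    _ ≤ _ := by gcongr

end OscDecay

namespace OscDecay

open Filter Topology MeasureTheory Set

variable {n : ℕ} {F : (Fin n → ℝ) → ℝ} {ρ : ℝ}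

/-- The components of the graph map. -/
def graphFn (F : (Fin n → ℝ) → ℝ) : Option (Fin n) → (Fin n → ℝ) → ℝ
  | none => F
  | some i => fun x => x i

/-- The amplitude of a chart integral with a unit factor absorbed. -/
theorem contDiff_mul_abs {ψ V : (Fin n → ℝ) → ℝ} (hψ : ContDiff ℝ 1 ψ)
    (hV : ∀ w ∈ tsupport ψ, ContDiffAt ℝ 1 V w ∧ V w ≠ 0) :
    ContDiff ℝ 1 fun w => ψ w * |V w| := by
  rw [contDiff_iff_contDiffAt]
  intro w
  by_cases hw : w ∈ tsupport ψ
  · exact hψ.contDiffAt.mul ((hV w hw).1.abs (hV w hw).2)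
  · have h0 := notMem_tsupport_iff_eventuallyEq.mp hw
    refine (contDiffAt_const (c := (0 : ℝ))).congr_of_eventuallyEq ?_
    filter_upwards [h0] with v hv
    rw [hv]; simp

theorem est_of_chain (hF : Continuous F) (hρ : 0 < ρ) {π : (Fin n → ℝ) → (Fin n → ℝ)}
    {J : (Fin n → ℝ) → ℝ} (h : IsChart π J) (hJ : Mono J)
    (hc : ChainData Finset.univ fun j w => graphFn F j (π w)) : Est F ρ π J := by
  obtain ⟨K, β, U, T, hK, hU, hβ, hT⟩ := hc
  obtain ⟨κ, V, hVa, hV0, hVJ⟩ := hJ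
  have hKn : K ≤ n + 1 := by simpa using hK
  obtain ⟨R₀, hR₀, hbd⟩ := exists_mono_bound (N := n + 1) hKn n.succ_pos hU
    (fun k l h1 h2 => (hβ k l h1 h2).2) κ
  set u := ∑ k ∈ Finset.range K, |U k 0| + 1
  have hu0 : 0 ≤ u := by positivity
  have hue : ∀ᶠ w in 𝓝 (0 : Fin n → ℝ), ∑ k ∈ Finset.range K, |U k w| < u := by
    have : ContinuousAt (fun w : Fin n → ℝ => ∑ k ∈ Finset.range K, |U k w|) 0 :=
      tendsto_finsetSum _ fun k hk => (hU k (Finset.mem_range.mp hk)).1.continuousAt.abs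
    exact this.tendsto.eventually (gt_mem_nhds (by simp [u]))
  have hv : 0 < |V 0| / 2 := by positivity
  have hve : ∀ᶠ w in 𝓝 (0 : Fin n → ℝ), |V 0| / 2 < |V w| :=
    hVa.continuousAt.abs.tendsto.eventually (lt_mem_nhds (half_lt_self (abs_pos.mpr hV0)))
  have hπe : ∀ᶠ w in 𝓝 (0 : Fin n → ℝ), π w ∈ Metric.ball (0 : Fin n → ℝ) ρ := by
    have := h.contDiff.continuous.continuousAt (x := (0 : Fin n → ℝ))
    refine this.tendsto.eventually ?_
    rw [h.zero]
    exact Metric.ball_mem_nhds _ hρ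
  have hTe : ∀ᶠ w in 𝓝 (0 : Fin n → ℝ), ∀ j ∈ (Finset.univ : Finset (Option (Fin n))),
      graphFn F j (π w) = ∑ k ∈ Finset.range K, T k j * (mon (β k) w * U k w) :=
    Finset.univ.eventually_all.mpr hT
  obtain ⟨R₁, hR₁, hall⟩ := Metric.eventually_nhds_iff_ball.mp
    (hue.and (hve.and (hπe.and (hTe.and (hVJ.and hVa.eventually_analyticAt)))))
  set R := min R₀ (min R₁ 1)
  have hR : 0 < R := lt_min hR₀ (lt_min hR₁ one_pos)
  replace hall : ∀ w ∈ Metric.ball (0 : Fin n → ℝ) R, _ := fun w hw =>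
    hall w (Metric.ball_subset_ball ((min_le_right _ _).trans (min_le_left _ _)) hw)
  obtain ⟨η₀, hη₀, L, hL, hdom⟩ := exists_domination (fun k l h1 h2 => (hβ k l h1 h2).1)
    (fun k => T k none) (fun k i => T k (some i)) hu0
  obtain ⟨M, hM0, hM⟩ := exists_push_subInt (ρ := ρ) hF h (R := R) fun w hw => (hall w hw).2.2.1
  refine ⟨R, hR, η₀, hη₀, fun ψ hψ hψc hψs => ?_⟩
  have hχ : ContDiff ℝ 1 fun w => ψ w * |V w| := contDiff_mul_abs hψ fun w hw => by
    have := hall w (hψs hw)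
    exact ⟨this.2.2.2.2.2.contDiffAt, fun h0 => by
      have := this.2.1
      rw [h0, abs_zero] at this
      linarith⟩
  obtain ⟨C, hC, hCb⟩ := hbd R (min_le_left _ _) _ hχ hψc.mul_right
    ((tsupport_mul_subset_left).trans hψs)
  set p : ℝ := -(1 / (n + 1 : ℕ) : ℝ)
  have hp : p ≤ 0 := by simp only [p]; rw [neg_nonpos]; positivity
  have hL0 : 0 < L := by linarith
  refine ⟨C * ((|V 0| / 2)⁻¹ * L ^ (-p) * M), by positivity, fun η hη t => ?_⟩
  set c : ℕ → ℝ := fun k => t * (T k none + ∑ i, η i * T k (some i))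
  have hz : ∀ w, w ∉ Metric.ball (0 : Fin n → ℝ) R → ψ w = 0 := fun w hw =>
    image_eq_zero_of_notMem_tsupport fun h' => hw (hψs h')
  have e1 : ∫ w, ((ψ w * |J w| : ℝ) : ℂ) * Complex.exp (Complex.I * phase F η t (π w)) =
      ∫ w, ((ψ w * |V w| * |mon κ w| : ℝ) : ℂ) * Complex.exp
          (Complex.I * (∑ k ∈ Finset.range K, c k * (mon (β k) w * U k w) : ℝ)) := by
    congr 1
    ext w
    by_cases hw : w ∈ Metric.ball (0 : Fin n → ℝ) R
    · obtain ⟨-, -, -, h4, h5, -⟩ := hall w hw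
      have hph : phase F η t (π w) = ∑ k ∈ Finset.range K, c k * (mon (β k) w * U k w) := by
        have h6 : F (π w) = _ := h4 none (Finset.mem_univ _)
        have h7 : ∀ i, π w i = _ := fun i => h4 (some i) (Finset.mem_univ _)
        simp only [phase, c]
        rw [h6]
        simp only [h7, Finset.mul_sum, mul_add, add_mul, Finset.sum_add_distrib, Finset.sum_mul]
        congr 1
        · exact Finset.sum_congr rfl fun k _ => by ring
        · rw [Finset.sum_comm]
          exact Finset.sum_congr rfl fun k _ => Finset.sum_congr rfl fun i _ => by ring
      rw [hph, h5, abs_mul]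
      congr 2
      ring
    · simp [hz w hw]
  rw [e1]
  refine (hCb c).trans ?_
  rw [mul_assoc]
  refine mul_le_mul_of_nonneg_left ?_ hC
  have hJc := h.jac_contDiff.continuous.abs
  have hgp := (continuous_subInt_integrand hF t p).comp h.contDiff.continuous
  have hcont : Continuous fun w : Fin n → ℝ =>
      |mon κ w| * (1 + ∑ k ∈ Finset.range K, |c k * mon (β k) w|) ^ p := by
    refine (continuous_mon _).abs.mul (Continuous.rpow_const ?_ fun w => Or.inl ?_)
    · exact continuous_const.add (continuous_finsetSum _ fun k _ =>
        (continuous_const.mul (continuous_mon _)).abs)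
    · positivity
  calc ∫ w in Metric.ball 0 R, |mon κ w| * (1 + ∑ k ∈ Finset.range K, |c k * mon (β k) w|) ^ p
      ≤ ∫ w in Metric.ball 0 R, ((|V 0| / 2)⁻¹ * L ^ (-p)) * (|J w| * (1 + |t * F (π w)|) ^ p) := by
        refine setIntegral_mono_on ?_ ?_ measurableSet_ball fun w hw => ?_
        · exact (hcont.continuousOn.integrableOn_compact (isCompact_closedBall 0 R)).mono_set
            Metric.ball_subset_closedBall
        · exact ((continuous_const.mul (hJc.mul hgp)).continuousOn.integrableOn_compact
            (isCompact_closedBall 0 R)).mono_set Metric.ball_subset_closedBall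
        · obtain ⟨h1, h2, -, h4, h5, -⟩ := hall w hw
          have hw1 : ‖w‖ ≤ 1 := by
            rw [mem_ball_zero_iff] at hw
            exact hw.le.trans ((min_le_right _ _).trans (min_le_right _ _))
          have hd := hdom η hη t w hw1 (fun k => U k w) fun k hk =>
            (Finset.single_le_sum (f := fun k => |U k w|) (fun _ _ => abs_nonneg _)
              (Finset.mem_range.mpr hk)).trans h1.le
          have h6 : F (π w) = _ := h4 none (Finset.mem_univ _)
          rw [← h6] at hd
          have hx : 0 < 1 + |t * F (π w)| := by positivity
          have hr := rpow_le_of_le_mul hx hL0 (by positivity) hp hd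
          have hJm : |mon κ w| ≤ (|V 0| / 2)⁻¹ * |J w| := by
            rw [h5, abs_mul, inv_mul_eq_div, le_div_iff₀ hv]
            exact mul_le_mul_of_nonneg_left h2.le (abs_nonneg _)
          calc _ ≤ (|V 0| / 2)⁻¹ * |J w| * (L ^ (-p) * (1 + |t * F (π w)|) ^ p) := by
                refine mul_le_mul hJm hr ?_ (by positivity)
                exact Real.rpow_nonneg (by positivity) _
            _ = _ := by ring
    _ = ((|V 0| / 2)⁻¹ * L ^ (-p)) *
        ∫ w in Metric.ball 0 R, |J w| * (1 + |t * F (π w)|) ^ p := integral_const_mul _ _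
    _ ≤ ((|V 0| / 2)⁻¹ * L ^ (-p)) * (M * subInt F ρ t) := by
        refine mul_le_mul_of_nonneg_left (hM t) (by positivity)
    _ = _ := by ring

/-- The graph map has charts with the oscillatory integral estimate. -/
theorem cov_est (hF : Continuous F) (hFa : AnalyticAt ℝ F 0) (hF0 : F 0 = 0) (hρ : 0 < ρ) :
    Cov (Est F ρ) := by
  have h1 := cov_chain (Finset.univ : Finset (Option (Fin n))) (graphFn F)
    (fun j _ => by
      cases j with
      | none => exact hFa
      | some i => exact analyticAt_coord i 0)
    (fun j _ => by
      cases j with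
      | none => exact hF0
      | some i => rfl)
  refine h1.chart.mono fun π J hQ => ?_
  exact est_of_chain hF hρ hQ.2 hQ.1.1 hQ.1.2.2

end OscDecay

namespace OscDecay

open Filter Topology MeasureTheory Set

variable {n : ℕ} {F : (Fin n → ℝ) → ℝ} {ρ r r' η₀ η₁ : ℝ} {π : (Fin n → ℝ) → (Fin n → ℝ)}
  {J ψ : (Fin n → ℝ) → ℝ}

/-- The integrand of the oscillatory integrals. -/
noncomputable def oscG (F : (Fin n → ℝ) → ℝ) (η : Fin n → ℝ) (t : ℝ) (ψ : (Fin n → ℝ) → ℝ)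
    (π : (Fin n → ℝ) → (Fin n → ℝ)) (J : (Fin n → ℝ) → ℝ) (w : Fin n → ℝ) : ℂ :=
  ((ψ w * |J w| : ℝ) : ℂ) * Complex.exp (Complex.I * phase F η t (π w))

/-- The estimate `Est` with given radii. -/
def EstAt (F : (Fin n → ℝ) → ℝ) (ρ r η₀ : ℝ) (π : (Fin n → ℝ) → (Fin n → ℝ))
    (J : (Fin n → ℝ) → ℝ) : Prop :=
  ∀ ψ : (Fin n → ℝ) → ℝ, ContDiff ℝ 1 ψ → HasCompactSupport ψ →
    tsupport ψ ⊆ Metric.ball 0 r → ∃ C, 0 ≤ C ∧ ∀ η : Fin n → ℝ, (∀ i, |η i| ≤ η₀) → ∀ t : ℝ,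
      ‖∫ w, oscG F η t ψ π J w‖ ≤ C * subInt F ρ t

theorem est_iff : Est F ρ π J ↔ ∃ r > 0, ∃ η₀ > 0, EstAt F ρ r η₀ π J := Iff.rfl

theorem hasCompactSupport_of_subset_ball (h : tsupport ψ ⊆ Metric.ball 0 r) :
    HasCompactSupport ψ :=
  (isCompact_closedBall (0 : Fin n → ℝ) r).of_isClosed_subset (isClosed_tsupport _)
    (h.trans Metric.ball_subset_closedBall)

theorem continuous_phase (hF : Continuous F) (η : Fin n → ℝ) (t : ℝ) : Continuous (phase F η t) := by
  unfold phase
  fun_prop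

theorem continuous_oscG (hF : Continuous F) (η : Fin n → ℝ) (t : ℝ) (hψ : Continuous ψ)
    (hπ : Continuous π) (hJ : Continuous J) : Continuous (oscG F η t ψ π J) := by
  have := (continuous_phase hF η t).comp hπ
  simp only [Function.comp_def] at this
  unfold oscG
  fun_prop

theorem integrable_oscG (hF : Continuous F) (η : Fin n → ℝ) (t : ℝ) (hψ : Continuous ψ)
    (hψc : HasCompactSupport ψ) (hπ : Continuous π) (hJ : Continuous J) :
    Integrable (oscG F η t ψ π J) := by
  refine (continuous_oscG hF η t hψ hπ hJ).integrable_of_hasCompactSupport (hψc.mono' ?_)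
  intro w hw
  refine subset_tsupport _ fun h0 => hw ?_
  simp [oscG, h0]

theorem EstAt.of_integral_eq {c : (Fin n → ℝ) → (Fin n → ℝ)} {d : (Fin n → ℝ) → ℝ}
    (h : EstAt F ρ r η₀ (fun w => π (c w)) d) {Ψ : (Fin n → ℝ) → ℝ} (hΨ : ContDiff ℝ 1 Ψ)
    (hΨs : tsupport Ψ ⊆ Metric.ball 0 r) : ∃ C, 0 ≤ C ∧ ∀ η : Fin n → ℝ, (∀ i, |η i| ≤ η₀) →
    ∀ t : ℝ, ‖∫ w, oscG F η t Ψ (fun w => π (c w)) d w‖ ≤ C * subInt F ρ t :=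
  h Ψ hΨ (hasCompactSupport_of_subset_ball hΨs) hΨs

theorem tsupport_comp_subset_ball {c : (Fin n → ℝ) → (Fin n → ℝ)} (hc : Continuous c)
    (hs : tsupport ψ ⊆ Metric.ball 0 r)
    (h : ∀ w, c w ∈ Metric.ball (0 : Fin n → ℝ) r → w ∈ Metric.ball (0 : Fin n → ℝ) r') :
    tsupport (fun w => ψ (c w)) ⊆ Metric.ball 0 r' :=
  (tsupport_comp_subset_preimage ψ hc).trans fun w hw => h w (hs hw)

theorem shear_neg_shear {i : Fin n} {θ : (Fin n → ℝ) → ℝ} (h : ShearFn i θ) (w : Fin n → ℝ) :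
    shear i (fun w => -θ w) (shear i θ w) = w := by
  ext j
  rcases eq_or_ne j i with rfl | hj
  · simp [shear, h.indep]
  · simp [shear, hj]

theorem Est.shear {i : Fin n} {θ : (Fin n → ℝ) → ℝ} (h : ShearFn i θ) (hF : Continuous F)
    (hπ : Continuous π) (hJ : Continuous J)
    (hE : Est F ρ (fun w => π (shear i θ w)) (fun w => J (shear i θ w))) : Est F ρ π J := by
  obtain ⟨r₁, hr₁, η₀, hη₀, hE⟩ := est_iff.mp hE
  have hc := contDiff_shear (i := i) h.contDiff
  have hc' : Continuous (OscDecay.shear i fun w => -θ w) :=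
    (contDiff_shear (i := i) h.contDiff.neg).continuous
  have h0 : OscDecay.shear i (fun w => -θ w) 0 = 0 := by
    have := shear_neg_shear h 0
    rwa [shear_zero h] at this
  have hev : ∀ᶠ x in 𝓝 (0 : Fin n → ℝ),
      OscDecay.shear i (fun w => -θ w) x ∈ Metric.ball (0 : Fin n → ℝ) r₁ := by
    refine hc'.continuousAt.tendsto.eventually ?_
    rw [h0]
    exact Metric.ball_mem_nhds _ hr₁
  obtain ⟨r, hr, hb⟩ := Metric.eventually_nhds_iff_ball.mp hev
  refine est_iff.mpr ⟨r, hr, η₀, hη₀, fun ψ hψ hψc hψs => ?_⟩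
  obtain ⟨C, hC, hCb⟩ := hE.of_integral_eq (hψ.comp hc)
    (tsupport_comp_subset_ball (c := OscDecay.shear i θ) hc.continuous hψs fun w hw => by
      have := hb _ hw
      rwa [shear_neg_shear h] at this)
  refine ⟨C, hC, fun η hη t => ?_⟩
  have e : ∫ w, oscG F η t ψ π J w = ∫ w, oscG F η t ψ π J (OscDecay.shear i θ w) := by
    conv_lhs => rw [← map_shear h]
    exact integral_map hc.continuous.measurable.aemeasurable
      (continuous_oscG hF η t hψ.continuous hπ hJ).aestronglyMeasurable
  rw [e]
  exact hCb η hη t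

theorem Est.pow {i : Fin n} {q : ℕ} (hq : Even q) (h2 : 2 ≤ q) (hF : Continuous F)
    (hπ : Continuous π) (hJ : Continuous J)
    (hE : ∀ s : ℝ, s = 1 ∨ s = -1 → Est F ρ (fun w => π (powc i q s w))
      (fun w => J (powc i q s w) * (q * w i ^ (q - 1)))) : Est F ρ π J := by
  obtain ⟨r₁, hr₁, η₁, hη₁, hE₁⟩ := est_iff.mp (hE 1 (Or.inl rfl))
  obtain ⟨r₂, hr₂, η₂, hη₂, hE₂⟩ := est_iff.mp (hE (-1) (Or.inr rfl))
  set ε := min 1 (min r₁ r₂)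
  have hε : 0 < ε := lt_min one_pos (lt_min hr₁ hr₂)
  have hε1 : ε ≤ 1 := min_le_left _ _
  have hq0 : q ≠ 0 := by omega
  have hsub : ∀ s : ℝ, s = 1 ∨ s = -1 → ∀ w, powc i q s w ∈ Metric.ball (0 : Fin n → ℝ) (ε ^ q) →
      w ∈ Metric.ball (0 : Fin n → ℝ) ε := by
    intro s hs w hw
    rw [mem_ball_zero_iff, pi_norm_lt_iff (by positivity)] at hw
    rw [mem_ball_zero_iff, pi_norm_lt_iff hε]
    intro j
    have hj := hw j
    rcases eq_or_ne j i with rfl | hji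
    · have hs1 : |s| = 1 := by rcases hs with rfl | rfl <;> simp
      simp only [powc, Function.update_self, Real.norm_eq_abs, abs_mul, hs1, one_mul, abs_pow] at hj
      exact lt_of_pow_lt_pow_left₀ q hε.le hj
    · simp only [powc, Function.update_of_ne hji] at hj
      exact hj.trans_le (pow_le_of_le_one hε.le hε1 hq0)
  refine est_iff.mpr ⟨ε ^ q, by positivity, min η₁ η₂, lt_min hη₁ hη₂, fun ψ hψ hψc hψs => ?_⟩
  have hc : ∀ s, ContDiff ℝ 1 (powc i q s) := contDiff_powc i q
  obtain ⟨C₁, hC₁, hb₁⟩ := hE₁.of_integral_eq (hψ.comp (hc 1))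
    ((tsupport_comp_subset_ball (hc 1).continuous hψs (hsub 1 (Or.inl rfl))).trans
      (Metric.ball_subset_ball ((min_le_right _ _).trans (min_le_left _ _))))
  obtain ⟨C₂, hC₂, hb₂⟩ := hE₂.of_integral_eq (hψ.comp (hc (-1)))
    ((tsupport_comp_subset_ball (hc (-1)).continuous hψs (hsub (-1) (Or.inr rfl))).trans
      (Metric.ball_subset_ball ((min_le_right _ _).trans (min_le_right _ _))))
  refine ⟨C₁ + C₂, by positivity, fun η hη t => ?_⟩
  set G := oscG F η t ψ π J
  have hGc : Continuous G := continuous_oscG hF η t hψ.continuous hπ hJ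
  have hGi : Integrable G := integrable_oscG hF η t hψ.continuous hψc hπ hJ
  set δ : (Fin n → ℝ) → ENNReal := fun w => ENNReal.ofReal (q * |w i| ^ (q - 1))
  have hδ : Measurable δ := by fun_prop
  have hint : Integrable G (Measure.map (powc i q 1) (volume.withDensity δ) +
      Measure.map (powc i q (-1)) (volume.withDensity δ)) := by
    rw [map_powc hq h2]
    exact hGi.smul_measure (by simp)
  have hs : ∀ s, ∫ x, G x ∂(Measure.map (powc i q s) (volume.withDensity δ)) =
      ∫ w, oscG F η t (fun w => ψ (powc i q s w)) (fun w => π (powc i q s w))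
        (fun w => J (powc i q s w) * (q * w i ^ (q - 1))) w := fun s => by
    rw [integral_map (hc s).continuous.measurable.aemeasurable hGc.aestronglyMeasurable,
      integral_withDensity_eq_integral_toReal_smul hδ (ae_of_all _ fun _ => ENNReal.ofReal_lt_top)]
    congr 1
    ext w
    simp only [δ, G, oscG]
    rw [ENNReal.toReal_ofReal (by positivity), abs_mul, abs_mul, abs_pow, Nat.abs_cast,
      Complex.real_smul]
    push_cast
    ring
  have key : (2 : ℝ) • ∫ x, G x = (∫ x, G x ∂(Measure.map (powc i q 1) (volume.withDensity δ))) +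
      ∫ x, G x ∂(Measure.map (powc i q (-1)) (volume.withDensity δ)) := by
    rw [← integral_add_measure hint.left_of_add_measure hint.right_of_add_measure, map_powc hq h2,
      integral_smul_measure]
    simp
  rw [hs, hs] at key
  have h3 := hb₁ η (fun i => (hη i).trans (min_le_left _ _)) t
  have h4 := hb₂ η (fun i => (hη i).trans (min_le_right _ _)) t
  have h5 : ‖∫ x, G x‖ ≤ ‖(2 : ℝ) • ∫ x, G x‖ := by
    rw [norm_smul, Real.norm_ofNat]
    linarith [norm_nonneg (∫ x, G x)]
  rw [add_mul]
  refine h5.trans ?_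
  rw [key]
  exact (norm_add_le _ _).trans (add_le_add h3 h4)

end OscDecay

namespace OscDecay

open Filter Topology MeasureTheory Set
open scoped Manifold ContDiff

variable {n : ℕ} {F : (Fin n → ℝ) → ℝ} {ρ r η₀ : ℝ} {π : (Fin n → ℝ) → (Fin n → ℝ)}
  {J ψ : (Fin n → ℝ) → ℝ}

theorem EstAt.blow_part {i j : Fin n} (hij : i ≠ j) (y : ℝ) (hF : Continuous F)
    (hπ : Continuous π) (hJ : Continuous J) (hr : 0 < r)
    (h : EstAt F ρ r η₀ (fun w => π (blow i j y w)) (fun w => J (blow i j y w) * w i))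
    {τ : ℝ → ℝ} {m : (Fin n → ℝ) → ℝ} (hτ : ContDiff ℝ 1 τ) (hτs : tsupport τ ⊆ Metric.ball 0 r)
    (hm : Measurable m) (hmτ : ∀ᵐ w, m (blow i j y w) = τ (w j)) (hψ : ContDiff ℝ 1 ψ)
    (hψs : tsupport ψ ⊆ Metric.ball 0 r) :
    ∃ C, 0 ≤ C ∧ ∀ η : Fin n → ℝ, (∀ i, |η i| ≤ η₀) → ∀ t : ℝ,
      ‖∫ x, (m x : ℂ) * oscG F η t ψ π J x‖ ≤ C * subInt F ρ t := by
  have hc := contDiff_blow i j y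
  obtain ⟨C, hC, hb⟩ := h.of_integral_eq (Ψ := fun w => ψ (blow i j y w) * τ (w j))
    ((hψ.comp hc).mul (hτ.comp (contDiff_apply ℝ ℝ j))) (by
      intro w hw
      have h1 : blow i j y w ∈ Metric.ball (0 : Fin n → ℝ) r :=
        hψs (tsupport_comp_subset_preimage ψ hc.continuous (tsupport_mul_subset_left hw))
      have h2 : w j ∈ Metric.ball (0 : ℝ) r :=
        hτs (tsupport_comp_subset_preimage (f := fun w : Fin n → ℝ => w j) τ (continuous_apply j)
          (tsupport_mul_subset_right (f := fun w => ψ (blow i j y w)) hw))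
      rw [mem_ball_zero_iff, pi_norm_lt_iff hr] at h1 ⊢
      intro k
      rcases eq_or_ne k j with rfl | hk
      · simpa using h2
      · have := h1 k
        rwa [blow, Function.update_of_ne hk] at this)
  refine ⟨C, hC, fun η hη t => ?_⟩
  set G := oscG F η t ψ π J
  have hGc : Continuous G := continuous_oscG hF η t hψ.continuous hπ hJ
  set δ : (Fin n → ℝ) → ENNReal := fun w => ENNReal.ofReal |w i|
  have hδ : Measurable δ := by fun_prop
  have e : ∫ x, (m x : ℂ) * G x = ∫ w, oscG F η t (fun w => ψ (blow i j y w) * τ (w j))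
      (fun w => π (blow i j y w)) (fun w => J (blow i j y w) * w i) w := by
    conv_lhs => rw [← map_blow hij y]
    have hmeas : Measurable fun x => (m x : ℂ) * G x :=
      (Complex.measurable_ofReal.comp hm).mul hGc.measurable
    rw [integral_map hc.continuous.measurable.aemeasurable hmeas.aestronglyMeasurable,
      integral_withDensity_eq_integral_toReal_smul hδ (ae_of_all _ fun _ => ENNReal.ofReal_lt_top)]
    refine integral_congr_ae ?_
    filter_upwards [hmτ] with w hw
    simp only [δ, G, oscG]
    rw [hw, ENNReal.toReal_ofReal (abs_nonneg _), abs_mul, Complex.real_smul]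
    push_cast
    ring
  rw [e]
  exact hb η hη t

/-- Finite partition of a compactly supported function on the line. -/
theorem exists_partition {ε : ℝ → ℝ} (hε : ∀ y, 0 < ε y) {χ : ℝ → ℝ} (hχ : ContDiff ℝ 1 χ)
    (hχc : HasCompactSupport χ) : ∃ (s : Finset ℝ) (χ' : s → ℝ → ℝ),
      (∀ y, ContDiff ℝ 1 (χ' y)) ∧ (∀ y : s, tsupport (χ' y) ⊆ Metric.ball (y : ℝ) (ε y)) ∧
      ∀ z, χ z = ∑ y, χ' y z := by
  obtain ⟨s, -, hs⟩ := hχc.elim_nhds_subcover (fun y => Metric.ball y (ε y))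
    fun y _ => Metric.ball_mem_nhds y (hε y)
  obtain ⟨f, hf⟩ := SmoothPartitionOfUnity.exists_isSubordinate 𝓘(ℝ, ℝ) (isClosed_tsupport χ)
    (fun y : s => Metric.ball (y : ℝ) (ε y)) (fun _ => Metric.isOpen_ball) fun z hz => by
      simpa using hs hz
  refine ⟨s, fun y z => f y z * χ z, fun y => ?_, fun y => ?_, fun z => ?_⟩
  · have : ContDiff ℝ ∞ (f y) := (f y).contMDiff.contDiff
    exact (this.of_le (by norm_num)).mul hχ
  · exact tsupport_mul_subset_left.trans (hf y)
  · rw [← Finset.sum_mul]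
    by_cases hz : z ∈ tsupport χ
    · have := f.sum_eq_one hz
      rw [finsum_eq_sum_of_fintype] at this
      rw [this, one_mul]
    · rw [image_eq_zero_of_notMem_tsupport hz, mul_zero]

/-- The complementary cutoff in the inverted variable. -/
theorem exists_inverted_cutoff {ε : ℝ} (hε : 0 < ε) : ∃ χ τ : ℝ → ℝ, ContDiff ℝ 1 χ ∧
    HasCompactSupport χ ∧ ContDiff ℝ 1 τ ∧ tsupport τ ⊆ Metric.ball 0 ε ∧
    ∀ z, z ≠ 0 → 1 - χ z⁻¹ = τ z := by
  let b : ContDiffBump (0 : ℝ) := ⟨2 / ε, 4 / ε, by positivity, by gcongr; norm_num⟩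
  refine ⟨b, fun z => if z = 0 then 1 else 1 - b z⁻¹, b.contDiff, b.hasCompactSupport, ?_, ?_,
    fun z hz => by simp [hz]⟩
  · rw [contDiff_iff_contDiffAt]
    intro z
    by_cases hz : z = 0
    · refine (contDiffAt_const (c := (1 : ℝ))).congr_of_eventuallyEq ?_
      filter_upwards [Metric.ball_mem_nhds z (show 0 < ε / 4 by positivity)] with v hv
      split_ifs with hv0
      · rfl
      · rw [b.zero_of_le_dist, sub_zero]
        rw [hz, Metric.mem_ball, dist_zero_right, Real.norm_eq_abs] at hv
        rw [dist_zero_right, Real.norm_eq_abs, abs_inv]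
        change 4 / ε ≤ _
        have hp : 0 < |v| := abs_pos.mpr hv0
        rw [div_le_iff₀ hε, inv_mul_eq_div, le_div_iff₀ hp]
        linarith
    · have h1 : ContDiffAt ℝ 1 (fun z => 1 - b z⁻¹) z :=
        contDiffAt_const.sub (b.contDiff.contDiffAt.comp z (contDiffAt_inv ℝ hz))
      refine h1.congr_of_eventuallyEq ?_
      filter_upwards [isOpen_ne.mem_nhds hz] with v hv
      simp [show v ≠ 0 from hv]
  · have : tsupport (fun z => if z = 0 then (1 : ℝ) else 1 - b z⁻¹) ⊆ Metric.closedBall 0 (ε / 2) := by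
      refine closure_minimal (fun z hz => ?_) Metric.isClosed_closedBall
      by_contra hn
      rw [Metric.mem_closedBall, dist_zero_right, Real.norm_eq_abs, not_le] at hn
      have hz0 : z ≠ 0 := by
        rintro rfl
        rw [abs_zero] at hn
        linarith
      refine hz ?_
      beta_reduce
      rw [if_neg hz0, b.one_of_mem_closedBall, sub_self]
      rw [Metric.mem_closedBall, dist_zero_right, Real.norm_eq_abs, abs_inv]
      change _ ≤ 2 / ε
      rw [inv_le_comm₀ (by linarith) (by positivity), inv_div]
      exact hn.le
    exact this.trans (Metric.closedBall_subset_ball (by linarith))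

theorem Est.blow {i j : Fin n} (hij : i ≠ j) (hF : Continuous F)
    (hπ : Continuous π) (hJ : Continuous J)
    (h1 : ∀ y, Est F ρ (fun w => π (blow i j y w)) (fun w => J (blow i j y w) * w i))
    (h2 : Est F ρ (fun w => π (blow j i 0 w)) (fun w => J (blow j i 0 w) * w j)) :
    Est F ρ π J := by
  obtain ⟨r₀, hr₀, η₀, hη₀, hE₀⟩ := est_iff.mp h2
  choose ε hε κ hκ hE using fun y => est_iff.mp (h1 y)
  obtain ⟨χ, τ, hχ, hχc, hτ, hτs, hχτ⟩ := exists_inverted_cutoff hr₀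
  obtain ⟨s, χ', hχ', hχs, hsum⟩ := exists_partition hε hχ hχc
  obtain ⟨r, hr, hrr⟩ : ∃ r > 0, r ≤ r₀ ∧ ∀ y : s, r ≤ ε y := by
    have h : ∀ᶠ r in 𝓝[>] (0 : ℝ), 0 < r ∧ r ≤ r₀ ∧ ∀ y : s, r ≤ ε y := by
      refine Filter.Eventually.and self_mem_nhdsWithin (nhdsWithin_le_nhds ?_)
      refine Filter.Eventually.and (Iic_mem_nhds hr₀) (eventually_all.mpr fun y => Iic_mem_nhds (hε y))
    exact h.exists.imp fun r h => ⟨h.1, h.2⟩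
  obtain ⟨ζ, hζ, hζζ⟩ : ∃ r > 0, r ≤ η₀ ∧ ∀ y : s, r ≤ κ y := by
    have h : ∀ᶠ r in 𝓝[>] (0 : ℝ), 0 < r ∧ r ≤ η₀ ∧ ∀ y : s, r ≤ κ y := by
      refine Filter.Eventually.and self_mem_nhdsWithin (nhdsWithin_le_nhds ?_)
      refine Filter.Eventually.and (Iic_mem_nhds hη₀) (eventually_all.mpr fun y => Iic_mem_nhds (hκ y))
    exact h.exists.imp fun r h => ⟨h.1, h.2⟩
  refine est_iff.mpr ⟨r, hr, ζ, hζ, fun ψ hψ hψc hψs => ?_⟩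
  have hdiv : Measurable fun x : Fin n → ℝ => x j / x i :=
    (measurable_pi_apply j).div (measurable_pi_apply i)
  obtain ⟨C₀, hC₀, hb₀⟩ := hE₀.blow_part (m := fun x => 1 - χ (x j / x i)) hij.symm 0 hF hπ hJ hr₀
    hτ hτs (measurable_const.sub (hχ.continuous.measurable.comp hdiv))
    (by
      filter_upwards [ae_coord_ne_zero i, ae_coord_ne_zero j] with w hwi hwj
      rw [← hχτ _ hwi]
      simp only [OscDecay.blow, Function.update_self, Function.update_of_ne hij.symm, zero_add]
      congr 2
      field_simp)
    hψ (hψs.trans (Metric.ball_subset_ball hrr.1))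
  have hpart : ∀ y : s, ∃ C, 0 ≤ C ∧ ∀ η : Fin n → ℝ, (∀ i, |η i| ≤ κ y) → ∀ t : ℝ,
      ‖∫ x, (χ' y (x j / x i) : ℂ) * oscG F η t ψ π J x‖ ≤ C * subInt F ρ t := fun y => by
    refine (hE y).blow_part (m := fun x => χ' y (x j / x i)) (τ := fun z => χ' y (y + z)) hij y hF
      hπ hJ (hε y) ((hχ' y).comp (contDiff_const.add contDiff_id)) ?_
      ((hχ' y).continuous.measurable.comp hdiv) ?_ hψ (hψs.trans (Metric.ball_subset_ball (hrr.2 y)))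
    · refine (tsupport_comp_subset_preimage (χ' y) (continuous_const.add continuous_id)).trans ?_
      intro z hz
      simpa using hχs y hz
    · filter_upwards [ae_coord_ne_zero i] with w hwi
      simp only [OscDecay.blow, Function.update_self, Function.update_of_ne hij]
      congr 1
      field_simp
  choose C hC hb using hpart
  refine ⟨C₀ + ∑ y, C y, add_nonneg hC₀ (Finset.sum_nonneg fun y _ => hC y), fun η hη t => ?_⟩
  set G := oscG F η t ψ π J
  have hGi : Integrable G := integrable_oscG hF η t hψ.continuous hψc hπ hJ
  have hbdd : ∀ y : s, Integrable fun x => (χ' y (x j / x i) : ℂ) * G x := fun y => by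
    have hcs : HasCompactSupport (χ' y) :=
      (isCompact_closedBall (y : ℝ) (ε y)).of_isClosed_subset (isClosed_tsupport _)
        ((hχs y).trans Metric.ball_subset_closedBall)
    obtain ⟨B, hB⟩ := hcs.exists_bound_of_continuous (hχ' y).continuous
    refine hGi.bdd_mul (c := B)
      (Complex.measurable_ofReal.comp ((hχ' y).continuous.measurable.comp hdiv)).aestronglyMeasurable
      (ae_of_all _ fun x => ?_)
    rw [Complex.norm_real]
    exact hB _
  have hpt : ∀ x, G x = ((1 - χ (x j / x i) : ℝ) : ℂ) * G x +
      ∑ y, (χ' y (x j / x i) : ℂ) * G x := fun x => by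
    rw [← Finset.sum_mul, ← Complex.ofReal_sum, ← hsum]
    push_cast
    ring
  have hS : Integrable fun x => ∑ y, (χ' y (x j / x i) : ℂ) * G x :=
    integrable_finsetSum _ fun y _ => hbdd y
  have hM : Integrable fun x => ((1 - χ (x j / x i) : ℝ) : ℂ) * G x := by
    refine (hGi.sub hS).congr (ae_of_all _ fun x => ?_)
    simp only [Pi.sub_apply]
    rw [sub_eq_iff_eq_add]
    exact hpt x
  have key : ∫ x, G x = (∫ x, ((1 - χ (x j / x i) : ℝ) : ℂ) * G x) +
      ∑ y, ∫ x, (χ' y (x j / x i) : ℂ) * G x := by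
    rw [← integral_finsetSum _ fun y _ => hbdd y, ← integral_add hM hS]
    exact integral_congr_ae (ae_of_all _ hpt)
  rw [key, add_mul, Finset.sum_mul]
  refine (norm_add_le _ _).trans (add_le_add (hb₀ η (fun i => (hη i).trans hζζ.1) t) ?_)
  exact (norm_sum_le _ _).trans (Finset.sum_le_sum fun y _ =>
    hb y η (fun i => (hη i).trans (hζζ.2 y)) t)

theorem Cov.est {Q : ((Fin n → ℝ) → (Fin n → ℝ)) → ((Fin n → ℝ) → ℝ) → Prop} (h : Cov Q)
    (hF : Continuous F) : ∀ {π : (Fin n → ℝ) → (Fin n → ℝ)} {J : (Fin n → ℝ) → ℝ}, Continuous π →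
    Continuous J → (∀ σ d, Q σ d → Est F ρ (fun w => π (σ w)) (fun w => J (σ w) * d w)) →
    Est F ρ π J := by
  induction h with
  | id h =>
    intro π J hπ hJ hQ
    simpa using hQ _ _ h
  | shear i θ hθ _ ih =>
    intro π J hπ hJ hQ
    have hc := (contDiff_shear (i := i) hθ.contDiff).continuous
    exact Est.shear hθ hF hπ hJ (ih (hπ.comp hc) (hJ.comp hc) fun σ d h => hQ _ _ h)
  | blow i j hij _ _ ih1 ih2 =>
    intro π J hπ hJ hQ
    refine Est.blow hij hF hπ hJ (fun y => ?_) ?_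
    · have hc := (contDiff_blow i j y).continuous
      refine ih1 y (hπ.comp hc) ((hJ.comp hc).mul (continuous_apply i)) fun σ d h => ?_
      simpa only [mul_assoc, Function.comp_def] using hQ _ _ h
    · have hc := (contDiff_blow j i 0).continuous
      refine ih2 (hπ.comp hc) ((hJ.comp hc).mul (continuous_apply j)) fun σ d h => ?_
      simpa only [mul_assoc, Function.comp_def] using hQ _ _ h
  | pow i q hq h2 _ ih =>
    intro π J hπ hJ hQ
    refine Est.pow (i := i) hq h2 hF hπ hJ fun s hs => ?_
    have hc := (contDiff_powc i q s).continuous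
    refine ih s hs (hπ.comp hc) ((hJ.comp hc).mul
      (continuous_const.mul ((continuous_apply i).pow (q - 1)))) fun σ d h => ?_
    simpa only [mul_assoc, Function.comp_def] using hQ _ _ h

/-- The local oscillatory integral estimate, uniform in small linear perturbations. -/
theorem est_id (hF : Continuous F) (hFa : AnalyticAt ℝ F 0) (hF0 : F 0 = 0) (hρ : 0 < ρ) :
    Est F ρ (fun w => w) fun _ => 1 := by
  refine (cov_est hF hFa hF0 hρ).est hF continuous_id continuous_const fun σ d h => ?_
  simpa using h

end OscDecay

namespace OscDecay

open Filter Topology MeasureTheory Set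

variable {n : ℕ} {F : (Fin n → ℝ) → ℝ} {ρ : ℝ}

theorem rpow_le_dyadic_sum {p y : ℝ} (hp : p ≤ 0) (hp1 : -1 ≤ p) (hy : 0 ≤ y) (J : ℕ) :
    (1 + y) ^ p ≤ ∑ j ∈ Finset.range (J + 1), 2 * ((2 : ℝ) ^ j) ^ p *
      (if y < 2 ^ j then 1 else 0) + ((2 : ℝ) ^ J) ^ p := by
  have hterm : ∀ j ∈ Finset.range (J + 1), 0 ≤ 2 * ((2 : ℝ) ^ j) ^ p *
      (if y < 2 ^ j then 1 else 0) := fun j _ => by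
    split_ifs <;> positivity
  have hanti : ∀ j : ℕ, (2 : ℝ) ^ j ≤ y → (1 + y) ^ p ≤ ((2 : ℝ) ^ j) ^ p := fun j hj =>
    Real.rpow_le_rpow_of_nonpos (by positivity) (by linarith) hp
  by_cases h : y < 2 ^ J
  · classical
    have hex : ∃ j : ℕ, y < 2 ^ j := ⟨J, h⟩
    set j := Nat.find hex
    have hj : y < 2 ^ j := Nat.find_spec hex
    have hjJ : j ≤ J := Nat.find_min' hex h
    have h1 : (1 + y) ^ p ≤ 2 * ((2 : ℝ) ^ j) ^ p := by
      rcases hj0 : j with _ | i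
      · rw [pow_zero, Real.one_rpow]
        exact (Real.rpow_le_one_of_one_le_of_nonpos (by linarith) hp).trans (by norm_num)
      · have hi : (2 : ℝ) ^ i ≤ y := by
          by_contra hc
          exact Nat.find_min hex (m := i) (by omega) (not_le.mp hc)
        refine (hanti i hi).trans ?_
        rw [pow_succ, Real.mul_rpow (by positivity) (by norm_num)]
        have h2 : (2 : ℝ)⁻¹ ≤ 2 ^ p := by
          rw [← Real.rpow_neg_one]
          exact Real.rpow_le_rpow_of_exponent_le one_le_two hp1
        have h3 : 0 ≤ ((2 : ℝ) ^ i) ^ p := by positivity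
        nlinarith
    have h2 := Finset.single_le_sum hterm (Finset.mem_range.mpr (by omega : j < J + 1))
    rw [if_pos hj, mul_one] at h2
    have : 0 ≤ ((2 : ℝ) ^ J) ^ p := by positivity
    linarith
  · have := Finset.sum_nonneg hterm
    have := hanti J (not_lt.mp h)
    linarith

theorem subInt_le_dyadic_sum (hF : Continuous F) (t : ℝ) (ht : 0 < |t|) (J : ℕ) :
    subInt F ρ t ≤ ∑ j ∈ Finset.range (J + 1), 2 * ((2 : ℝ) ^ j) ^ (-(1 / (n + 1 : ℕ) : ℝ)) *
      (volume {x | x ∈ Metric.ball (0 : Fin n → ℝ) ρ ∧ |F x| < 2 ^ j / |t|}).toReal +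
      ((2 : ℝ) ^ J) ^ (-(1 / (n + 1 : ℕ) : ℝ)) *
        (volume (Metric.ball (0 : Fin n → ℝ) ρ)).toReal := by
  set p : ℝ := -(1 / (n + 1 : ℕ) : ℝ)
  have hp : p ≤ 0 := by simp only [p]; rw [neg_nonpos]; positivity
  have hp1 : -1 ≤ p := by
    simp only [p, neg_le_neg_iff]
    rw [div_le_one (by positivity)]
    exact_mod_cast Nat.le_add_left 1 n
  set B := Metric.ball (0 : Fin n → ℝ) ρ
  have hfin : volume B ≠ ⊤ := measure_ball_lt_top.ne
  set S : ℕ → Set (Fin n → ℝ) := fun j => {x | |F x| < 2 ^ j / |t|}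
  have hS : ∀ j, MeasurableSet (S j) := fun j =>
    measurableSet_lt hF.abs.measurable measurable_const
  have hind : ∀ j, IntegrableOn ((S j).indicator fun _ => (1 : ℝ)) B := fun j =>
    (integrableOn_const hfin).indicator (hS j)
  have hterm : ∀ j ∈ Finset.range (J + 1), Integrable
      (fun x => 2 * ((2 : ℝ) ^ j) ^ p * (S j).indicator (fun _ => (1 : ℝ)) x)
      (volume.restrict B) := fun j _ => (hind j).const_mul _
  have hconst : Integrable (fun _ : Fin n → ℝ => ((2 : ℝ) ^ J) ^ p) (volume.restrict B) :=
    integrableOn_const hfin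
  have hle : subInt F ρ t ≤ ∫ x in B, (∑ j ∈ Finset.range (J + 1), 2 * ((2 : ℝ) ^ j) ^ p *
      (S j).indicator (fun _ => (1 : ℝ)) x + ((2 : ℝ) ^ J) ^ p) := by
    refine setIntegral_mono_on ?_ ((integrable_finsetSum _ hterm).add hconst)
      measurableSet_ball fun x _ => ?_
    · exact ((continuous_subInt_integrand hF t p).continuousOn.integrableOn_compact
        (isCompact_closedBall 0 ρ)).mono_set Metric.ball_subset_closedBall
    · refine (rpow_le_dyadic_sum hp hp1 (abs_nonneg _) J).trans_eq ?_
      congr 1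
      refine Finset.sum_congr rfl fun j _ => ?_
      congr 1
      have e : |t * F x| < 2 ^ j ↔ |F x| < 2 ^ j / |t| := by rw [abs_mul, lt_div_iff₀' ht]
      by_cases h : |F x| < 2 ^ j / |t|
      · rw [if_pos (e.mpr h), indicator_of_mem (show x ∈ S j from h)]
      · rw [if_neg (mt e.mp h), indicator_of_notMem (show x ∉ S j from h)]
  refine hle.trans_eq ?_
  rw [integral_add (integrable_finsetSum _ hterm) hconst, integral_finsetSum _ hterm]
  congr 1
  · refine Finset.sum_congr rfl fun j _ => ?_
    rw [integral_const_mul, setIntegral_indicator (hS j)]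
    congr 1
    rw [setIntegral_const, smul_eq_mul, mul_one]
    rfl
  · rw [setIntegral_const, smul_eq_mul, mul_comm]
    rfl

/-- Decay of the averaged sublevel integral from the sublevel growth rate. -/
theorem exists_subInt_bound (hF : Continuous F) {k : ℕ} {A ε₀ : ℝ} (hA : 0 ≤ A) (hε₀ : 0 < ε₀)
    (hε₁ : ε₀ ≤ 1) (hgrow : ∀ ε, 0 < ε → ε < ε₀ →
      (volume {x | x ∈ Metric.ball (0 : Fin n → ℝ) ρ ∧ |F x| < ε}).toReal ≤
        A * ε ^ (1 / (n + 1 : ℕ) : ℝ) * Real.log (1 / ε) ^ k) :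
    ∃ C, 0 ≤ C ∧ ∀ t, 2 / ε₀ ≤ |t| → subInt F ρ t ≤
      C * |t| ^ (-(1 / (n + 1 : ℕ) : ℝ)) * Real.log |t| ^ (k + 1) := by
  set p : ℝ := -(1 / (n + 1 : ℕ) : ℝ)
  have hp : p ≤ 0 := by simp only [p]; rw [neg_nonpos]; positivity
  have hlog2 : 0 < Real.log 2 := Real.log_pos one_lt_two
  set v := (volume (Metric.ball (0 : Fin n → ℝ) ρ)).toReal
  have hv : 0 ≤ v := ENNReal.toReal_nonneg
  set c₁ := 2 * A * (2 / Real.log 2)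
  set c₂ := (ε₀ / 4) ^ p * v * (1 / Real.log 2) ^ (k + 1)
  refine ⟨c₁ + c₂, by positivity, fun t ht => ?_⟩
  have ht2 : 2 ≤ |t| := by
    refine le_trans ?_ ht
    rw [le_div_iff₀ hε₀]
    linarith
  have ht0 : 0 < |t| := by linarith
  have hlogt : Real.log 2 ≤ Real.log |t| := Real.log_le_log two_pos ht2
  have hlog0 : 0 < Real.log |t| := hlog2.trans_le hlogt
  have hx1 : 1 ≤ ε₀ * |t| / 2 := by
    rw [div_le_iff₀ hε₀] at ht
    linarith
  obtain ⟨J, hJ1, hJ2⟩ := exists_nat_pow_near hx1 one_lt_two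
  refine (subInt_le_dyadic_sum hF t ht0 J).trans ?_
  have htp : 0 < |t| ^ p := by positivity
  have hterm : ∀ j ∈ Finset.range (J + 1), 2 * ((2 : ℝ) ^ j) ^ p *
      (volume {x | x ∈ Metric.ball (0 : Fin n → ℝ) ρ ∧ |F x| < 2 ^ j / |t|}).toReal ≤
      2 * A * |t| ^ p * Real.log |t| ^ k := by
    intro j hj
    have hjJ : (2 : ℝ) ^ j ≤ ε₀ * |t| / 2 :=
      (pow_le_pow_right₀ one_le_two (by have := Finset.mem_range.mp hj; omega)).trans hJ1
    have h2j : (1 : ℝ) ≤ 2 ^ j := one_le_pow₀ one_le_two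
    have hpos : (0 : ℝ) < 2 ^ j / |t| := by positivity
    have hlt : (2 : ℝ) ^ j / |t| < ε₀ := by
      rw [div_lt_iff₀ ht0]
      have : 0 < ε₀ * |t| := by positivity
      linarith
    have h1 := hgrow _ hpos hlt
    have h3 : Real.log (1 / (2 ^ j / |t|)) ≤ Real.log |t| := by
      refine Real.log_le_log (by positivity) ?_
      rw [one_div_div]
      exact div_le_self ht0.le h2j
    have h4 : 0 ≤ Real.log (1 / (2 ^ j / |t|)) := by
      refine Real.log_nonneg ?_
      rw [le_div_iff₀ hpos]
      linarith
    have h5 : ((2 : ℝ) ^ j) ^ p * (2 ^ j / |t|) ^ (1 / (n + 1 : ℕ) : ℝ) = |t| ^ p := by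
      rw [Real.div_rpow (by positivity) ht0.le, ← mul_div_assoc, ← Real.rpow_add (by positivity)]
      simp only [p]
      rw [neg_add_cancel, Real.rpow_zero, Real.rpow_neg ht0.le, one_div]
    calc _ ≤ 2 * ((2 : ℝ) ^ j) ^ p * (A * (2 ^ j / |t|) ^ (1 / (n + 1 : ℕ) : ℝ) *
          Real.log (1 / (2 ^ j / |t|)) ^ k) := by gcongr
      _ = 2 * A * (((2 : ℝ) ^ j) ^ p * (2 ^ j / |t|) ^ (1 / (n + 1 : ℕ) : ℝ)) *
          Real.log (1 / (2 ^ j / |t|)) ^ k := by ring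
      _ ≤ _ := by rw [h5]; gcongr
  have hJ3 : (J : ℝ) + 1 ≤ 2 / Real.log 2 * Real.log |t| := by
    have h1 : (J : ℝ) * Real.log 2 ≤ Real.log |t| := by
      rw [← Real.log_pow]
      refine Real.log_le_log (by positivity) (hJ1.trans ?_)
      nlinarith
    rw [div_mul_eq_mul_div, le_div_iff₀ hlog2]
    linarith
  have hJ4 : ((2 : ℝ) ^ J) ^ p ≤ (ε₀ / 4) ^ p * |t| ^ p := by
    rw [← Real.mul_rpow (by positivity) ht0.le]
    refine Real.rpow_le_rpow_of_nonpos (by positivity) ?_ hp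
    rw [pow_succ] at hJ2
    linarith
  have hone : 1 ≤ (1 / Real.log 2) ^ (k + 1) * Real.log |t| ^ (k + 1) := by
    rw [← mul_pow]
    refine one_le_pow₀ ?_
    rw [one_div_mul_eq_div, le_div_iff₀ hlog2]
    linarith
  calc _ ≤ ∑ j ∈ Finset.range (J + 1), 2 * A * |t| ^ p * Real.log |t| ^ k +
        (ε₀ / 4) ^ p * |t| ^ p * v := add_le_add (Finset.sum_le_sum hterm) (by gcongr)
    _ = (J + 1) * (2 * A * |t| ^ p * Real.log |t| ^ k) + (ε₀ / 4) ^ p * |t| ^ p * v * 1 := by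
        rw [Finset.sum_const, Finset.card_range, nsmul_eq_mul]
        push_cast
        ring
    _ ≤ (2 / Real.log 2 * Real.log |t|) * (2 * A * |t| ^ p * Real.log |t| ^ k) +
        (ε₀ / 4) ^ p * |t| ^ p * v * ((1 / Real.log 2) ^ (k + 1) * Real.log |t| ^ (k + 1)) := by
        gcongr
    _ = _ := by
        simp only [c₁, c₂]
        ring

end OscDecay

namespace OscDecay

open Filter Topology MeasureTheory Set

variable {n : ℕ} {F : (Fin n → ℝ) → ℝ} {ρ r η₀ : ℝ}

theorem norm_integral_mul_deriv_exp_le {u P : (Fin n → ℝ) → ℝ} (hu : ContDiff ℝ 1 u)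
    (hus : HasCompactSupport u) (hP : ContDiff ℝ 1 P) (v : Fin n → ℝ) :
    ‖∫ x, ((u x * fderiv ℝ P x v : ℝ) : ℂ) * Complex.exp (Complex.I * P x)‖ ≤
      ∫ x, |fderiv ℝ u x v| := by
  have hd : ∀ x, HasFDerivAt (fun x => Complex.exp (Complex.I * P x))
      (Complex.exp (Complex.I * P x) • Complex.I • Complex.ofRealCLM.comp (fderiv ℝ P x)) x :=
    fun x => (((Complex.ofRealCLM.hasFDerivAt (x := P x)).comp x
      (hP.differentiable one_ne_zero x).hasFDerivAt).const_mul Complex.I).cexp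
  have hdu : ∀ x, HasFDerivAt (fun x => (u x : ℂ)) (Complex.ofRealCLM.comp (fderiv ℝ u x)) x :=
    fun x => (Complex.ofRealCLM.hasFDerivAt (x := u x)).comp x
      (hu.differentiable one_ne_zero x).hasFDerivAt
  have hg : Continuous fun x => Complex.exp (Complex.I * P x) := by
    have := hP.continuous
    fun_prop
  have hu' : Continuous fun x => fderiv ℝ u x v :=
    (hu.continuous_fderiv one_ne_zero).clm_apply continuous_const
  have hP' : Continuous fun x => fderiv ℝ P x v :=
    (hP.continuous_fderiv one_ne_zero).clm_apply continuous_const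
  have hus' : HasCompactSupport fun x => fderiv ℝ u x v := hus.fderiv_apply ℝ v
  have hc : ∀ {w : (Fin n → ℝ) → ℝ}, HasCompactSupport w →
      HasCompactSupport fun x => (w x : ℂ) := fun h => h.comp_left Complex.ofReal_zero
  have key := integral_mul_fderiv_eq_neg_fderiv_mul_of_integrable (𝕜 := ℂ) (μ := volume)
    (f := fun x => (u x : ℂ)) (g := fun x => Complex.exp (Complex.I * P x)) (v := v)
    (by
      simp only [(hdu _).fderiv]
      exact Continuous.integrable_of_hasCompactSupport
        ((Complex.continuous_ofReal.comp hu').mul hg) ((hc hus').mul_right))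
    (by
      simp only [(hd _).fderiv]
      refine Continuous.integrable_of_hasCompactSupport ((Complex.continuous_ofReal.comp
        hu.continuous).mul ?_) ((hc hus).mul_right)
      exact hg.mul (continuous_const.mul (Complex.continuous_ofReal.comp hP')))
    (Continuous.integrable_of_hasCompactSupport
      ((Complex.continuous_ofReal.comp hu.continuous).mul hg) ((hc hus).mul_right))
    (fun x _ => (hdu x).differentiableAt) fun x _ => (hd x).differentiableAt
  simp only [(hdu _).fderiv, (hd _).fderiv] at key
  have e : ∫ x, ((u x * fderiv ℝ P x v : ℝ) : ℂ) * Complex.exp (Complex.I * P x) =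
      Complex.I * ∫ x, ((fderiv ℝ u x v : ℝ) : ℂ) * Complex.exp (Complex.I * P x) := by
    rw [← neg_inj, ← mul_right_inj' Complex.I_ne_zero, mul_neg, mul_neg, ← integral_const_mul,
      ← mul_assoc, Complex.I_mul_I, neg_one_mul, neg_neg]
    refine Eq.trans ?_ ((congrArg Neg.neg key).trans (neg_neg _))
    congr 1
    refine integral_congr_ae (ae_of_all _ fun x => ?_)
    simp only [smul_apply, ContinuousLinearMap.comp_apply,
      Complex.ofRealCLM_apply, smul_eq_mul]
    push_cast
    ring
  rw [e, norm_mul, Complex.norm_I, one_mul]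
  refine (norm_integral_le_integral_norm _).trans_eq (integral_congr_ae (ae_of_all _ fun x => ?_))
  beta_reduce
  rw [norm_mul, Complex.norm_real, Real.norm_eq_abs, mul_comm Complex.I,
    Complex.norm_exp_ofReal_mul_I, mul_one]

/-- Nonstationary phase: one integration by parts in the direction of a dominant linear
coefficient. -/
theorem exists_nonstationary_bound (hF : ContDiff ℝ 1 F) (hη₀ : 0 < η₀)
    (hFa : ∀ x ∈ Metric.ball (0 : Fin n → ℝ) r, AnalyticAt ℝ F x)
    (hs : ∀ x ∈ Metric.ball (0 : Fin n → ℝ) r, ∀ i, |fderiv ℝ F x (Pi.single i 1)| ≤ η₀ / 2)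
    {φ : (Fin n → ℝ) → ℝ} (hφ : ContDiff ℝ 1 φ) (hφc : HasCompactSupport φ)
    (hφs : tsupport φ ⊆ Metric.ball 0 r) (i : Fin n) :
    ∃ C, 0 ≤ C ∧ ∀ (ξ : Fin n → ℝ) (t : ℝ), η₀ * |t| < |ξ i| →
      ‖∫ x, (φ x : ℂ) * Complex.exp (Complex.I * ((t * F x + ∑ j, ξ j * x j : ℝ) : ℂ))‖ ≤
        C / |ξ i| := by
  set e : Fin n → ℝ := Pi.single i 1
  set G : (Fin n → ℝ) → ℝ := fun x => fderiv ℝ F x e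
  have hGa : ∀ x ∈ tsupport φ, AnalyticAt ℝ G x := fun x hx =>
    (ContinuousLinearMap.apply ℝ ℝ e).analyticAt _ |>.comp (hFa x (hφs hx)).fderiv
  have hGc : ContinuousOn (fun x => fderiv ℝ G x e) (tsupport φ) := fun x hx =>
    ((ContinuousLinearMap.apply ℝ ℝ e).analyticAt _ |>.comp
      (hGa x hx).fderiv).continuousAt.continuousWithinAt
  obtain ⟨X₀, hX₀⟩ := hφc.exists_bound_of_continuousOn (f := φ) hφ.continuous.continuousOn
  obtain ⟨X₁, hX₁⟩ := hφc.exists_bound_of_continuousOn (f := fun x => fderiv ℝ φ x e)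
    ((hφ.continuous_fderiv one_ne_zero).clm_apply continuous_const).continuousOn
  obtain ⟨X₂, hX₂⟩ := hφc.exists_bound_of_continuousOn hGc
  have hfin : volume (tsupport φ) ≠ ⊤ := hφc.measure_lt_top.ne
  set M := 2 * |X₁| + 4 * |X₀| * |X₂| / η₀
  refine ⟨M * (volume (tsupport φ)).toReal, by positivity, fun ξ t ht => ?_⟩
  set a := |ξ i|
  have ha : 0 < a := lt_of_le_of_lt (by positivity) ht
  set D : (Fin n → ℝ) → ℝ := fun x => t * G x + ξ i
  have hD : ∀ x ∈ tsupport φ, a / 2 ≤ |D x| := fun x hx => by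
    have h1 := abs_sub_abs_le_abs_add (ξ i) (t * G x)
    have h2 : |t * G x| ≤ |t| * (η₀ / 2) := by
      rw [abs_mul]
      exact mul_le_mul_of_nonneg_left (hs x (hφs hx) i) (abs_nonneg _)
    simp only [D, a] at ht ⊢
    rw [add_comm (t * G x)]
    linarith
  have hD0 : ∀ x ∈ tsupport φ, D x ≠ 0 := fun x hx => by
    have := hD x hx
    intro h
    rw [h, abs_zero] at this
    linarith
  have hDa : ∀ x ∈ tsupport φ, AnalyticAt ℝ D x := fun x hx =>
    (analyticAt_const.mul (hGa x hx)).add analyticAt_const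
  have hD' : ∀ x ∈ tsupport φ, HasFDerivAt D (t • fderiv ℝ G x) x := fun x hx =>
    (((hGa x hx).differentiableAt.hasFDerivAt).const_mul t).add_const _
  set u : (Fin n → ℝ) → ℝ := fun x => φ x * (D x)⁻¹
  have hu : ContDiff ℝ 1 u := by
    rw [contDiff_iff_contDiffAt]
    intro x
    by_cases hx : x ∈ tsupport φ
    · exact hφ.contDiffAt.mul ((hDa x hx).contDiffAt.inv (hD0 x hx))
    · refine (contDiffAt_const (c := (0 : ℝ))).congr_of_eventuallyEq ?_
      filter_upwards [notMem_tsupport_iff_eventuallyEq.mp hx] with y hy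
      simp [u, hy]
  have huc : HasCompactSupport u := hφc.mul_right
  set P : (Fin n → ℝ) → ℝ := fun x => t * F x + ∑ j, ξ j * x j
  have hP : ContDiff ℝ 1 P := (contDiff_const.mul hF).add
    (ContDiff.sum fun j _ => contDiff_const.mul (contDiff_apply ℝ ℝ j))
  have hP' : ∀ x, fderiv ℝ P x e = D x := fun x => by
    have h1 := ((hF.differentiable one_ne_zero x).hasFDerivAt.const_mul t).add
      (HasFDerivAt.fun_sum (u := Finset.univ) fun j _ =>
        ((ContinuousLinearMap.proj (R := ℝ) (φ := fun _ : Fin n => ℝ) j).hasFDerivAt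
          (x := x)).const_mul (ξ j))
    have h2 : fderiv ℝ P x = _ := h1.fderiv
    rw [h2]
    simp [D, G, e, Pi.single_apply]
  have e1 : ∀ x, φ x = u x * fderiv ℝ P x e := fun x => by
    rw [hP']
    by_cases hx : x ∈ tsupport φ
    · simp only [u]
      rw [mul_assoc, inv_mul_cancel₀ (hD0 x hx), mul_one]
    · simp only [u]
      rw [image_eq_zero_of_notMem_tsupport hx, zero_mul, zero_mul]
  have hbd : ∀ x ∈ tsupport φ, |fderiv ℝ u x e| ≤ M / a := fun x hx => by
    have h1 := (hφ.differentiable one_ne_zero x).hasFDerivAt.mul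
      ((hasDerivAt_inv (hD0 x hx)).comp_hasFDerivAt x (hD' x hx))
    have h2 : fderiv ℝ u x = _ := h1.fderiv
    have h3 : fderiv ℝ u x e = fderiv ℝ φ x e * (D x)⁻¹ -
        φ x * (t * fderiv ℝ G x e) * ((D x)⁻¹ * (D x)⁻¹) := by
      rw [h2]
      simp
      ring_nf
    have h4 : |(D x)⁻¹| ≤ 2 / a := by
      rw [abs_inv, ← inv_div]
      exact inv_anti₀ (by positivity) (hD x hx)
    have h5 : |t| ≤ a / η₀ := by
      rw [le_div_iff₀ hη₀]
      linarith
    have h6 : |fderiv ℝ φ x e| ≤ |X₁| := (hX₁ x hx).trans (le_abs_self _)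
    have h7 : |φ x| ≤ |X₀| := (hX₀ x hx).trans (le_abs_self _)
    have h8 : |fderiv ℝ G x e| ≤ |X₂| := (hX₂ x hx).trans (le_abs_self _)
    rw [h3]
    refine (abs_sub _ _).trans ?_
    simp only [abs_mul]
    calc _ ≤ |X₁| * (2 / a) + |X₀| * (a / η₀ * |X₂|) * (2 / a * (2 / a)) := by gcongr
      _ = M / a := by
        simp only [M]
        field_simp
        ring
  have hz : ∀ x ∉ tsupport φ, |fderiv ℝ u x e| = 0 := fun x hx => by
    have : u =ᶠ[𝓝 x] fun _ => 0 := by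
      filter_upwards [notMem_tsupport_iff_eventuallyEq.mp hx] with y hy
      simp [u, hy]
    rw [this.fderiv_eq]
    simp
  have hmain := norm_integral_mul_deriv_exp_le hu huc hP e
  simp only [← e1] at hmain
  refine hmain.trans ?_
  rw [← setIntegral_eq_integral_of_forall_compl_eq_zero hz]
  calc _ ≤ ∫ x in tsupport φ, M / a := by
        refine setIntegral_mono_on ?_ (integrableOn_const hfin) (isClosed_tsupport _).measurableSet hbd
        exact (((hu.continuous_fderiv one_ne_zero).clm_apply
          continuous_const).abs.continuousOn.integrableOn_compact hφc)
    _ = _ := by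
      rw [setIntegral_const, smul_eq_mul, measureReal_def]
      ring

end OscDecay

namespace OscDecay

open Filter Topology MeasureTheory Set

variable {n : ℕ} {F : (Fin n → ℝ) → ℝ} {ρ r η₀ : ℝ}

theorem exists_dominant_bound (hF : ContDiff ℝ 1 F) (hη₀ : 0 < η₀)
    (hFa : ∀ x ∈ Metric.ball (0 : Fin n → ℝ) r, AnalyticAt ℝ F x)
    (hs : ∀ x ∈ Metric.ball (0 : Fin n → ℝ) r, ∀ i, |fderiv ℝ F x (Pi.single i 1)| ≤ η₀ / 2)
    {φ : (Fin n → ℝ) → ℝ} (hφ : ContDiff ℝ 1 φ) (hφc : HasCompactSupport φ)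
    (hφs : tsupport φ ⊆ Metric.ball 0 r) :
    ∃ C, 0 ≤ C ∧ ∀ (ξ : Fin n → ℝ) (t S : ℝ), 0 < S → S ≤ |t| + ∑ i, |ξ i| →
      (∃ i, η₀ * |t| < |ξ i|) →
      ‖∫ x, (φ x : ℂ) * Complex.exp (Complex.I * ((t * F x + ∑ j, ξ j * x j : ℝ) : ℂ))‖ ≤
        C / S := by
  choose c hc0 hc using exists_nonstationary_bound hF hη₀ hFa hs hφ hφc hφs
  refine ⟨(∑ i, c i) * (1 / η₀ + n), mul_nonneg (Finset.sum_nonneg fun i _ => hc0 i)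
    (by positivity), fun ξ t S hS hSle ⟨i₀, hi₀⟩ => ?_⟩
  obtain ⟨i, -, hi⟩ := Finset.exists_max_image Finset.univ (fun i => |ξ i|) ⟨i₀, Finset.mem_univ _⟩
  have hit := hi₀.trans_le (hi i₀ (Finset.mem_univ _))
  have ha : 0 < |ξ i| := lt_of_le_of_lt (by positivity) hit
  refine (hc i ξ t hit).trans ?_
  have h1 : ∑ j, |ξ j| ≤ n * |ξ i| := by
    refine (Finset.sum_le_card_nsmul _ _ _ fun j hj => hi j hj).trans_eq ?_
    simp
  have h2 : |t| ≤ 1 / η₀ * |ξ i| := by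
    rw [one_div, inv_mul_eq_div, le_div_iff₀ hη₀, mul_comm]
    exact hit.le
  have h3 : S ≤ (1 / η₀ + n) * |ξ i| := by linarith
  have h4 : c i ≤ ∑ i, c i := Finset.single_le_sum (fun i _ => hc0 i) (Finset.mem_univ i)
  rw [div_le_div_iff₀ ha hS]
  calc _ ≤ (∑ i, c i) * ((1 / η₀ + n) * |ξ i|) := by
        gcongr
        exact Finset.sum_nonneg fun i _ => hc0 i
    _ = _ := by ring

/-- Uniform decay of the Fourier transform of a smooth density on the graph of `F`. -/
theorem exists_decay (hF : ContDiff ℝ 1 F) (hFa : AnalyticAt ℝ F 0) (hF0 : F 0 = 0)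
    (hdF : fderiv ℝ F 0 = 0) (hρ : 0 < ρ) {k : ℕ} {A ε₀ : ℝ} (hA : 0 ≤ A) (hε₀ : 0 < ε₀)
    (hε₁ : ε₀ ≤ 1) (hgrow : ∀ ε, 0 < ε → ε < ε₀ →
      (volume {x | x ∈ Metric.ball (0 : Fin n → ℝ) ρ ∧ |F x| < ε}).toReal ≤
        A * ε ^ (1 / (n + 1 : ℕ) : ℝ) * Real.log (1 / ε) ^ k) :
    ∃ r > 0, ∀ φ : (Fin n → ℝ) → ℝ, ContDiff ℝ 1 φ → HasCompactSupport φ →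
      tsupport φ ⊆ Metric.ball 0 r → ∃ C, 0 < C ∧ ∀ (ξ : Fin n → ℝ) (t S : ℝ), 2 < S → |t| ≤ S →
        S ≤ |t| + ∑ i, |ξ i| →
        ‖∫ x, (φ x : ℂ) * Complex.exp (Complex.I * ((t * F x + ∑ j, ξ j * x j : ℝ) : ℂ))‖ ≤
          C * S ^ (-(1 / (n + 1 : ℕ) : ℝ)) * Real.log S ^ (k + 1) := by
  set p : ℝ := -(1 / (n + 1 : ℕ) : ℝ)
  have hp : p ≤ 0 := by simp only [p]; rw [neg_nonpos]; positivity
  have hp1 : -1 ≤ p := by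
    simp only [p, neg_le_neg_iff]
    rw [div_le_one (by positivity)]
    exact_mod_cast Nat.le_add_left 1 n
  obtain ⟨r₁, hr₁, η₀, hη₀, hest⟩ := est_id hF.continuous hFa hF0 hρ
  obtain ⟨C₁, hC₁, hsub⟩ := exists_subInt_bound hF.continuous hA hε₀ hε₁ hgrow
  have hsm : ∀ᶠ x in 𝓝 (0 : Fin n → ℝ), ∀ i, |fderiv ℝ F x (Pi.single i 1)| ≤ η₀ / 2 := by
    rw [eventually_all]
    intro i
    have hcont : Continuous fun x => |fderiv ℝ F x (Pi.single i 1)| :=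
      ((hF.continuous_fderiv one_ne_zero).clm_apply continuous_const).abs
    refine (hcont.tendsto 0).eventually (ge_mem_nhds ?_)
    rw [hdF]
    simpa using hη₀
  obtain ⟨r₂, hr₂, hball⟩ := Metric.eventually_nhds_iff_ball.mp
    (hsm.and hFa.eventually_analyticAt)
  refine ⟨min r₁ r₂, lt_min hr₁ hr₂, fun φ hφ hφc hφs => ?_⟩
  obtain ⟨C₂, hC₂, hosc⟩ := hest φ hφ hφc (hφs.trans (Metric.ball_subset_ball (min_le_left _ _)))
  obtain ⟨C₃, hC₃, hdom⟩ := exists_dominant_bound hF hη₀ (fun x hx => (hball x hx).2)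
    (fun x hx => (hball x hx).1) hφ hφc (hφs.trans (Metric.ball_subset_ball (min_le_right _ _)))
  have hl2 : 0 < Real.log 2 := Real.log_pos one_lt_two
  set B := 1 + n * η₀
  have hB : 0 < B := by positivity
  set T := 2 / ε₀
  have hT : 0 < T := by positivity
  set X := ∫ x, ‖φ x‖
  have hX : 0 ≤ X := integral_nonneg fun x => norm_nonneg _
  set m := (1 / Real.log 2) ^ (k + 1)
  refine ⟨C₂ * C₁ * B ^ (-p) + X * (B * T) ^ (-p) * m + C₃ * m + 1, by positivity,
    fun ξ t S hS htS hSle => ?_⟩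
  have hS0 : 0 < S := two_pos.trans hS
  have hlS : Real.log 2 ≤ Real.log S := Real.log_le_log two_pos hS.le
  have hm : 1 ≤ m * Real.log S ^ (k + 1) := by
    rw [← mul_pow, one_div, inv_mul_eq_div]
    exact one_le_pow₀ ((one_le_div hl2).mpr hlS)
  have hlS0 : 0 < Real.log S := hl2.trans_le hlS
  have hSp : 0 < S ^ p := Real.rpow_pos_of_pos hS0 p
  have hy : 0 ≤ C₂ * C₁ * B ^ (-p) * S ^ p * Real.log S ^ (k + 1) := by positivity
  have hy' : 0 ≤ X * (B * T) ^ (-p) * m * S ^ p * Real.log S ^ (k + 1) := by positivity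
  have hy'' : 0 ≤ C₃ * m * S ^ p * Real.log S ^ (k + 1) := by positivity
  have hy3 : 0 ≤ S ^ p * Real.log S ^ (k + 1) := by positivity
  have hsplit : (C₂ * C₁ * B ^ (-p) + X * (B * T) ^ (-p) * m + C₃ * m + 1) * S ^ p *
      Real.log S ^ (k + 1) = C₂ * C₁ * B ^ (-p) * S ^ p * Real.log S ^ (k + 1) +
        X * (B * T) ^ (-p) * m * S ^ p * Real.log S ^ (k + 1) +
        C₃ * m * S ^ p * Real.log S ^ (k + 1) + S ^ p * Real.log S ^ (k + 1) := by ring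
  rw [hsplit]
  by_cases hcase : ∃ i, η₀ * |t| < |ξ i|
  · refine le_trans ((hdom ξ t S hS0 hSle hcase).trans ?_)
      (show C₃ * m * S ^ p * Real.log S ^ (k + 1) ≤ _ by linarith)
    have h1 : S⁻¹ ≤ S ^ p := by
      rw [← Real.rpow_neg_one]
      exact Real.rpow_le_rpow_of_exponent_le (by linarith) hp1
    calc C₃ / S = C₃ * S⁻¹ * 1 := by rw [mul_one, div_eq_mul_inv]
      _ ≤ C₃ * S ^ p * (m * Real.log S ^ (k + 1)) := by gcongr
      _ = _ := by ring
  · push Not at hcase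
    have hSB : S ≤ B * |t| := by
      have : ∑ i, |ξ i| ≤ n * (η₀ * |t|) := by
        refine (Finset.sum_le_card_nsmul _ _ _ fun j _ => hcase j).trans_eq ?_
        simp
      simp only [B]
      linarith
    have ht : 0 < |t| := by
      by_contra h
      have : |t| = 0 := le_antisymm (not_lt.mp h) (abs_nonneg t)
      rw [this, mul_zero] at hSB
      linarith
    rcases le_or_gt T |t| with hTt | hTt
    · refine le_trans ?_ (show C₂ * C₁ * B ^ (-p) * S ^ p * Real.log S ^ (k + 1) ≤ _ by linarith)
      have ht0 : t ≠ 0 := abs_pos.mp ht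
      have h1 := hosc (fun i => ξ i / t) (fun i => by
        rw [abs_div, div_le_iff₀ ht]
        exact hcase i) t
      have h2 : ∀ x : Fin n → ℝ, phase F (fun i => ξ i / t) t x = t * F x + ∑ j, ξ j * x j := by
        intro x
        simp only [phase]
        rw [mul_add, Finset.mul_sum]
        congr 1
        refine Finset.sum_congr rfl fun i _ => ?_
        field_simp
      simp only [h2, abs_one, mul_one] at h1
      refine h1.trans ?_
      have h3 : |t| ^ p ≤ B ^ (-p) * S ^ p := rpow_le_of_le_mul hS0 hB ht hp hSB
      have h4 : 1 ≤ |t| := by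
        refine le_trans ?_ hTt
        rw [le_div_iff₀ hε₀]
        linarith
      have h5 : 0 ≤ Real.log |t| := Real.log_nonneg h4
      calc _ ≤ C₂ * (C₁ * |t| ^ p * Real.log |t| ^ (k + 1)) := by
            gcongr
            exact hsub t hTt
        _ ≤ C₂ * (C₁ * (B ^ (-p) * S ^ p) * Real.log S ^ (k + 1)) := by gcongr
        _ = _ := by ring
    · refine le_trans ?_
        (show X * (B * T) ^ (-p) * m * S ^ p * Real.log S ^ (k + 1) ≤ _ by linarith)
      have h1 : ‖∫ x, (φ x : ℂ) *
          Complex.exp (Complex.I * ((t * F x + ∑ j, ξ j * x j : ℝ) : ℂ))‖ ≤ X := by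
        refine (norm_integral_le_integral_norm _).trans_eq
          (integral_congr_ae (ae_of_all _ fun x => ?_))
        beta_reduce
        rw [norm_mul, Complex.norm_real, mul_comm Complex.I, Complex.norm_exp_ofReal_mul_I,
          mul_one]
      have h2 : (1 : ℝ) ≤ (B * T) ^ (-p) * S ^ p := by
        have := rpow_le_of_le_mul (y := 1) hS0 (mul_pos hB hT) one_pos hp (by
          rw [mul_one]
          exact hSB.trans (by gcongr))
        rwa [Real.one_rpow] at this
      calc _ ≤ X := h1
        _ = X * 1 * 1 := by ring
        _ ≤ X * ((B * T) ^ (-p) * S ^ p) * (m * Real.log S ^ (k + 1)) := by gcongr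
        _ = _ := by ring

end OscDecay

namespace OscDecay

open Filter Topology MeasureTheory Set

/-- The sublevel growth bound in product coordinates. -/
theorem exists_growth {n k : ℕ} {f : EuclideanSpace ℝ (Fin n) → ℝ} {F : (Fin n → ℝ) → ℝ} {r c : ℝ}
    (hr : 0 < r) (hc : 0 < c) (hF : ∀ᶠ y in 𝓝 (0 : Fin n → ℝ), F y = f (WithLp.toLp 2 y))
    (h : (fun ε : ℝ => (volume {x : EuclideanSpace ℝ (Fin n) | ‖x‖ < r ∧ |f x| < ε}).toReal
      - c * ε ^ (1 / (n + 1) : ℝ) * Real.log (1 / ε) ^ k)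
        =o[𝓝[>] (0 : ℝ)] fun ε : ℝ => ε ^ (1 / (n + 1) : ℝ) * Real.log (1 / ε) ^ k) :
    ∃ ρ > 0, ∃ A, 0 ≤ A ∧ ∃ ε₀, 0 < ε₀ ∧ ε₀ ≤ 1 ∧ ∀ ε, 0 < ε → ε < ε₀ →
      (volume {x | x ∈ Metric.ball (0 : Fin n → ℝ) ρ ∧ |F x| < ε}).toReal ≤
        A * ε ^ (1 / (n + 1 : ℕ) : ℝ) * Real.log (1 / ε) ^ k := by
  have hnorm : ∀ᶠ y in 𝓝 (0 : Fin n → ℝ), ‖(WithLp.toLp 2 y : EuclideanSpace ℝ (Fin n))‖ < r := by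
    have hcont : Continuous fun y : Fin n → ℝ =>
        ‖(WithLp.toLp 2 y : EuclideanSpace ℝ (Fin n))‖ := (PiLp.continuous_toLp 2 _).norm
    refine (hcont.tendsto 0).eventually (gt_mem_nhds ?_)
    simpa using hr
  obtain ⟨ρ, hρ, hball⟩ := Metric.eventually_nhds_iff_ball.mp (hF.and hnorm)
  obtain ⟨δ, hδ, hδb⟩ := mem_nhdsGT_iff_exists_Ioo_subset.mp (h.bound one_pos)
  refine ⟨ρ, hρ, c + 1, by positivity, min δ 1, lt_min hδ one_pos, min_le_right _ _,
    fun ε hε hεlt => ?_⟩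
  have h1 : ‖_‖ ≤ 1 * ‖_‖ := hδb ⟨hε, hεlt.trans_le (min_le_left _ _)⟩
  have hlog : 0 ≤ Real.log (1 / ε) := Real.log_nonneg (by
    rw [le_div_iff₀ hε, one_mul]
    exact (hεlt.trans_le (min_le_right _ _)).le)
  rw [one_mul, Real.norm_eq_abs, Real.norm_of_nonneg (by positivity)] at h1
  have h2 : volume {x | x ∈ Metric.ball (0 : Fin n → ℝ) ρ ∧ |F x| < ε} ≤
      volume {x : EuclideanSpace ℝ (Fin n) | ‖x‖ < r ∧ |f x| < ε} := by
    rw [← (EuclideanSpace.volume_preserving_symm_measurableEquiv_toLp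
      (Fin n)).symm.measure_preimage_equiv]
    refine measure_mono fun x hx => ?_
    obtain ⟨e1, e2⟩ := hball x hx.1
    exact ⟨e2, show |f (WithLp.toLp 2 x)| < ε from e1 ▸ hx.2⟩
  have h3 : volume {x : EuclideanSpace ℝ (Fin n) | ‖x‖ < r ∧ |f x| < ε} ≠ ⊤ :=
    ((measure_mono fun x hx => mem_ball_zero_iff.mpr hx.1).trans_lt
      (measure_ball_lt_top (x := (0 : EuclideanSpace ℝ (Fin n))) (r := r))).ne
  refine (ENNReal.toReal_mono h3 h2).trans ?_
  have h4 := (le_abs_self _).trans h1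
  push_cast
  linarith

theorem norm_euclidean_le_sum {ι : Type*} [Fintype ι] (x : EuclideanSpace ℝ ι) :
    ‖x‖ ≤ ∑ i, |x i| := by
  classical
  rw [EuclideanSpace.norm_eq]
  refine Real.sqrt_le_iff.mpr ⟨Finset.sum_nonneg fun i _ => abs_nonneg _, ?_⟩
  exact Finset.sum_sq_le_sq_sum_of_nonneg fun i _ => norm_nonneg _

end OscDecay

open MeasureTheory Filter Topology Asymptotics Complex

/-- Fourier transform decay of a hypersurface measure; borderline case
`g = 1/(n+1)`, with an extra logarithmic factor. -/
theorem stmt1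
    (n : ℕ) (hn : 1 ≤ n)
    (f : EuclideanSpace ℝ (Fin n) → ℝ)
    (U : Set (EuclideanSpace ℝ (Fin n))) (hU : U ∈ 𝓝 (0 : EuclideanSpace ℝ (Fin n)))
    (hfa : AnalyticOnNhd ℝ f U) (hf0 : f 0 = 0) (hdf : fderiv ℝ f 0 = 0)
    (k : ℕ) (hk : k ≤ n - 1)
    (r₀ : ℝ) (hr₀ : 0 < r₀)
    (hasymp : ∀ r : ℝ, 0 < r → r < r₀ → ∃ c : ℝ, 0 < c ∧
      (fun ε : ℝ =>
          (volume {x : EuclideanSpace ℝ (Fin n) | ‖x‖ < r ∧ |f x| < ε}).toReal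
            - c * ε ^ (1 / (n + 1) : ℝ) * (Real.log (1 / ε)) ^ k)
        =o[𝓝[>] (0 : ℝ)] fun ε : ℝ => ε ^ (1 / (n + 1) : ℝ) * (Real.log (1 / ε)) ^ k) :
    ∃ N : Set (EuclideanSpace ℝ (Fin n)), N ∈ 𝓝 (0 : EuclideanSpace ℝ (Fin n)) ∧ N ⊆ U ∧
      ∀ φ : EuclideanSpace ℝ (Fin n) → ℝ,
        ContDiff ℝ (⊤ : ℕ∞) φ → HasCompactSupport φ → tsupport φ ⊆ N →
        ∃ C : ℝ, 0 < C ∧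
          ∀ ξ : EuclideanSpace ℝ (Fin (n + 1)), 2 < ‖ξ‖ →
            ‖∫ x : EuclideanSpace ℝ (Fin n),
                (φ x : ℂ) * Complex.exp (-(Complex.I) *
                  ((ξ (Fin.last n) * f x + ∑ i : Fin n, ξ i.castSucc * x i : ℝ) : ℂ))‖
              ≤ C * ‖ξ‖ ^ (-(1 / (n + 1) : ℝ)) * (Real.log ‖ξ‖) ^ (k + 1) := by
  let e := (EuclideanSpace.equiv (Fin n) ℝ).symm
  have he : ∀ y, e y = WithLp.toLp 2 y := fun _ => rfl
  have h0 : e 0 = 0 := map_zero e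
  have hf : AnalyticAt ℝ f (e 0) := h0 ▸ hfa 0 (mem_of_mem_nhds hU)
  have hθ : AnalyticAt ℝ (fun y => f (e y)) 0 :=
    hf.comp (e.toContinuousLinearMap.analyticAt 0)
  obtain ⟨F, hF, hFe⟩ := OscDecay.exists_contDiff_extension hθ
  have hF0 : F 0 = 0 := by rw [hFe.self_of_nhds, h0, hf0]
  have hdF : fderiv ℝ F 0 = 0 := by
    rw [Filter.EventuallyEq.fderiv_eq hFe]
    have := hf.differentiableAt.hasFDerivAt.comp (0 : Fin n → ℝ) e.hasFDerivAt
    refine this.fderiv.trans ?_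
    rw [h0, hdf, ContinuousLinearMap.zero_comp]
  obtain ⟨c, hc, hasy⟩ := hasymp (r₀ / 2) (half_pos hr₀) (half_lt_self hr₀)
  obtain ⟨ρ, hρ, A, hA, ε₀, hε₀, hε₁, hgrow⟩ :=
    OscDecay.exists_growth (half_pos hr₀) hc hFe hasy
  obtain ⟨r, hr, hdecay⟩ := OscDecay.exists_decay hF (hθ.congr (hFe.mono fun _ h => h.symm)) hF0 hdF
    hρ hA hε₀ hε₁ hgrow
  obtain ⟨r', hr', hball⟩ := Metric.eventually_nhds_iff_ball.mp hFe
  refine ⟨U ∩ e.symm ⁻¹' Metric.ball 0 (min r r'), inter_mem hU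
    (e.symm.continuous.continuousAt.preimage_mem_nhds ?_), Set.inter_subset_left,
    fun φ hφ hφc hφs => ?_⟩
  · rw [map_zero]
    exact Metric.ball_mem_nhds _ (lt_min hr hr')
  have hts : tsupport (fun y => φ (e y)) ⊆ Metric.ball 0 (min r r') := fun y hy => by
    have := (hφs (tsupport_comp_subset_preimage φ e.continuous hy)).2
    simpa using this
  obtain ⟨C, hC, hb⟩ := hdecay (fun y => φ (e y))
    ((hφ.of_le (by exact_mod_cast le_top)).comp e.contDiff) (hφc.comp_homeomorph e.toHomeomorph)
    (hts.trans (Metric.ball_subset_ball (min_le_left _ _)))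
  refine ⟨C, hC, fun ξ hξ => ?_⟩
  have hle := hb (fun i => -ξ i.castSucc) (-ξ (Fin.last n)) ‖ξ‖ hξ
    (by rw [abs_neg]; exact PiLp.norm_apply_le ξ _) (by
      refine (OscDecay.norm_euclidean_le_sum ξ).trans_eq ?_
      rw [Fin.sum_univ_castSucc]
      simp only [abs_neg]
      ring)
  push_cast at hle ⊢
  refine le_trans (le_of_eq ?_) hle
  rw [← (EuclideanSpace.volume_preserving_symm_measurableEquiv_toLp (Fin n)).symm.integral_comp']
  congr 1
  refine integral_congr_ae (ae_of_all _ fun y => ?_)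
  change (φ (e y) : ℂ) * _ = φ (e y) * _
  by_cases hy : y ∈ tsupport fun y => φ (e y)
  · have hy' : F y = f (e y) :=
      hball y (Metric.ball_subset_ball (min_le_right _ _) (hts hy))
    congr 2
    rw [hy']
    simp only [neg_mul, Finset.sum_neg_distrib]
    rw [← neg_add, mul_neg]
    rfl
  · rw [show φ (e y) = 0 from
      image_eq_zero_of_notMem_tsupport (f := fun y => φ (e y)) hy]
    simp
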